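/- For every prime power q = p^d (p prime, d ≥ 1) and every integer n ≥ 3, σ(GL(n,𝔽_q)) ≥ (q^(n+1) − 1)/(q − 1), where GL(n,𝔽_q) is the group of invertible n×n matrices over the finite field 𝔽_q with q elements. -/

import Mathlib

open scoped ENat

/-- `S` is a cover of the group `G` by proper subgroups: every element of `G`
lies in some member of `S`, and every member of `S` is a proper subgroup. -/
def IsSubgroupCover {G : Type*} [Group G] (S : Finset (Subgroup G)) : Prop :=
  (∀ H ∈ S, H ≠ ⊤) ∧ ∀ g : G, ∃ H ∈ S, g ∈ H

/-- The covering number `σ(G)`: the least size of a cover of `G` by proper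
subgroups, equal to `⊤` (infinity) if no such finite collection exists. -/
noncomputable def coveringNumber (G : Type*) [Group G] : ℕ∞ :=
  sInf {n : ℕ∞ | ∃ S : Finset (Subgroup G), IsSubgroupCover S ∧ (S.card : ℕ∞) = n}

/-! ### Covers by proper subgroups -/

/-- Every finite cover of `G` by proper subgroups has at least `t` members. -/
def CoverBound (G : Type*) [Group G] (t : ℕ) : Prop :=
  ∀ S : Finset (Subgroup G), IsSubgroupCover S → t ≤ S.card

theorem CoverBound.le_coveringNumber {G : Type*} [Group G] {t : ℕ} (h : CoverBound G t) :
    (t : ℕ∞) ≤ coveringNumber G := by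
  refine le_sInf ?_
  rintro n ⟨S, hS, rfl⟩
  exact_mod_cast h S hS

/-- A cover none of whose members contains the image of `j` restricts to a cover along `j`. -/
theorem CoverBound.le_card_of_hom {M G : Type*} [Group M] [Group G] {t : ℕ}
    (h : CoverBound M t) (j : M →* G) {S : Finset (Subgroup G)}
    (hS : ∀ g, ∃ H ∈ S, g ∈ H) (hj : ∀ H ∈ S, ¬ j.range ≤ H) : t ≤ S.card := by
  classical
  refine (h (S.image fun H => H.comap j) ⟨?_, ?_⟩).trans Finset.card_image_le
  · intro K hK
    obtain ⟨H, hH, rfl⟩ := Finset.mem_image.1 hK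
    intro htop
    apply hj H hH
    rintro _ ⟨x, rfl⟩
    have : x ∈ H.comap j := htop ▸ Subgroup.mem_top x
    exact this
  · intro g
    obtain ⟨H, hH, hg⟩ := hS (j g)
    exact ⟨_, Finset.mem_image_of_mem _ hH, hg⟩

theorem CoverBound.of_mulEquiv {M G : Type*} [Group M] [Group G] {t : ℕ}
    (h : CoverBound M t) (e : M ≃* G) : CoverBound G t := by
  intro S hS
  refine h.le_card_of_hom e.toMonoidHom hS.2 fun H hH hr => hS.1 H hH ?_
  rw [eq_top_iff]
  intro g _
  exact hr ⟨e.symm g, by simp⟩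

theorem CoverBound.mono {G : Type*} [Group G] {s t : ℕ} (h : CoverBound G t) (hst : s ≤ t) :
    CoverBound G s := fun S hS => hst.trans (h S hS)

/-- If each member of `S` captures at most a proportion `1 / t` of a family of points covered by
`S`, then `S` has at least `t` members. -/
theorem le_card_of_proportion {ι G : Type*} [Fintype ι] [Nonempty ι] (S : Finset G)
    (P : G → ι → Prop) {t : ℕ}
    (hcov : ∀ i, ∃ H ∈ S, P H i) (hP : ∀ H ∈ S, Nat.card {i // P H i} * t ≤ Fintype.card ι) :
    t ≤ S.card := by
  classical
  have h1 : Fintype.card ι ≤ ∑ H ∈ S, Nat.card {i // P H i} := by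
    have : (Finset.univ : Finset ι) ⊆ S.biUnion fun H => Finset.univ.filter (P H) := by
      intro i _
      obtain ⟨H, hH, hi⟩ := hcov i
      exact Finset.mem_biUnion.2 ⟨H, hH, by simpa using hi⟩
    refine (Finset.card_le_card this).trans (Finset.card_biUnion_le.trans (le_of_eq ?_))
    refine Finset.sum_congr rfl fun H _ => ?_
    rw [Nat.card_eq_fintype_card, Fintype.card_subtype]
  have h2 : Fintype.card ι * t ≤ S.card * Fintype.card ι := by
    calc Fintype.card ι * t ≤ (∑ H ∈ S, Nat.card {i // P H i}) * t := Nat.mul_le_mul_right _ h1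
      _ = ∑ H ∈ S, Nat.card {i // P H i} * t := Finset.sum_mul ..
      _ ≤ ∑ H ∈ S, Fintype.card ι := Finset.sum_le_sum hP
      _ = _ := by simp
  rw [mul_comm] at h2
  exact Nat.le_of_mul_le_mul_right h2 Fintype.card_pos

/-! ### Subgroups containing transvections -/

section Transvections

open Module

variable {F V : Type*} [Field F] [AddCommGroup V] [Module F V]

/-- `H` contains the map `x ↦ x + φ x • c`. -/
def MemT (H : Subgroup (V ≃ₗ[F] V)) (φ : Dual F V) (c : V) : Prop :=
  ∃ g ∈ H, ∀ x, g x = x + φ x • c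

variable {H : Subgroup (V ≃ₗ[F] V)}

theorem MemT.zero_left (c : V) : MemT H 0 c := ⟨1, H.one_mem, by simp⟩

theorem MemT.zero_right (φ : Dual F V) : MemT H φ 0 := ⟨1, H.one_mem, by simp⟩

theorem MemT.smul_iff (φ : Dual F V) (c : V) (a : F) :
    MemT H φ (a • c) ↔ MemT H (a • φ) c := by
  simp only [MemT, LinearMap.smul_apply, smul_smul, smul_eq_mul, mul_comm a]

theorem MemT.add_left {φ ψ : Dual F V} {c : V} (hφ : MemT H φ c) (hψ : MemT H ψ c)
    (h : φ c = 0) : MemT H (φ + ψ) c := by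
  obtain ⟨g, hg, hg'⟩ := hφ
  obtain ⟨k, hk, hk'⟩ := hψ
  refine ⟨g * k, H.mul_mem hg hk, fun x => ?_⟩
  simp only [LinearEquiv.mul_apply, hg', hk', map_add, map_smul, h, LinearMap.add_apply, add_smul,
    smul_zero, add_zero]
  abel

theorem MemT.add_right {φ : Dual F V} {c d : V} (hc : MemT H φ c) (hd : MemT H φ d)
    (h : φ d = 0) : MemT H φ (c + d) := by
  obtain ⟨g, hg, hg'⟩ := hc
  obtain ⟨k, hk, hk'⟩ := hd
  refine ⟨g * k, H.mul_mem hg hk, fun x => ?_⟩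
  simp only [LinearEquiv.mul_apply, hg', hk', map_add, map_smul, h, smul_add,
    smul_zero, add_zero]
  abel

theorem MemT.neg_right {φ : Dual F V} {c : V} (hc : MemT H φ c) (h : φ c = 0) :
    MemT H φ (-c) := by
  obtain ⟨g, hg, hg'⟩ := hc
  refine ⟨g⁻¹, H.inv_mem hg, fun x => ?_⟩
  apply g.injective
  rw [← LinearEquiv.mul_apply, mul_inv_cancel]
  simp [hg', h]

theorem MemT.conj {φ : Dual F V} {c : V} (hc : MemT H φ c) {h : V ≃ₗ[F] V} (hh : h ∈ H) :
    MemT H (φ ∘ₗ (h⁻¹ : V ≃ₗ[F] V).toLinearMap) (h c) := by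
  obtain ⟨g, hg, hg'⟩ := hc
  refine ⟨h * g * h⁻¹, H.mul_mem (H.mul_mem hh hg) (H.inv_mem hh), fun x => ?_⟩
  simp only [LinearEquiv.mul_apply, hg', map_add, map_smul, LinearMap.comp_apply,
    LinearEquiv.coe_coe]
  rw [← LinearEquiv.mul_apply, mul_inv_cancel]
  simp

theorem inv_apply_of_eq {g : V ≃ₗ[F] V} {x y : V} (h : g x = y) : g⁻¹ y = x := by
  rw [← h, ← LinearEquiv.mul_apply, inv_mul_cancel, LinearEquiv.coe_one, id]

/-- Conjugating one transvection by another. -/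
theorem MemT.conj_MemT {φ ψ : Dual F V} {c d : V} (hφ : MemT H φ c) (hc : φ c = 0)
    (hψ : MemT H ψ d) : MemT H (ψ - ψ c • φ) (d + φ d • c) := by
  obtain ⟨g, hg, hg'⟩ := hφ
  have := hψ.conj hg
  rw [hg' d] at this
  convert this using 1
  ext x
  simp only [LinearMap.sub_apply, LinearMap.smul_apply, LinearMap.comp_apply, LinearEquiv.coe_coe,
    smul_eq_mul]
  rw [inv_apply_of_eq (g := g) (x := x - φ x • c) (by simp [hg', hc])]
  simp [mul_comm]

theorem exists_dual_eq_one_of_notMem {U : Submodule F V} {x : V} (hx : x ∉ U) :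
    ∃ φ : Dual F V, (∀ u ∈ U, φ u = 0) ∧ φ x = 1 := by
  obtain ⟨f, hf, hU⟩ := Submodule.exists_dual_map_eq_bot_of_notMem hx inferInstance
  refine ⟨(f x)⁻¹ • f, fun u hu => ?_, by simp [hf]⟩
  have : f u ∈ U.map f := Submodule.mem_map_of_mem hu
  rw [hU, Submodule.mem_bot] at this
  simp [this]

/-- Vectors that are the centre of all possible transvections in an irreducible subgroup: as soon
as there is a nonzero one, the subgroup contains all transvections. -/
theorem memT_of_irreducible
    (hirr : ∀ X : Submodule F V, (∀ h ∈ H, ∀ x ∈ X, h x ∈ X) → X = ⊥ ∨ X = ⊤)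
    {c : V} (hc : c ≠ 0) (hD : ∀ φ : Dual F V, φ c = 0 → MemT H φ c) (φ : Dual F V) (d : V)
    (h : φ d = 0) : MemT H φ d := by
  have hconj : ∀ g ∈ H, ∀ d : V, (∀ φ : Dual F V, φ d = 0 → MemT H φ d) →
      ∀ φ : Dual F V, φ (g d) = 0 → MemT H φ (g d) := by
    intro g hg d hd φ hφ
    have := (hd (φ ∘ₗ g.toLinearMap) (by simpa using hφ)).conj hg
    convert this using 1
    ext x
    simp only [LinearMap.comp_apply, LinearEquiv.coe_coe]
    rw [← LinearEquiv.mul_apply, mul_inv_cancel]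
    simp
  let X : Submodule F V :=
    { carrier := {d | ∀ φ : Dual F V, φ d = 0 → MemT H φ d}
      zero_mem' := fun φ _ => MemT.zero_right φ
      smul_mem' := by
        intro a d hd φ hφ
        rw [MemT.smul_iff]
        exact hd _ (by simpa using hφ)
      add_mem' := by
        intro d e hd he φ hφ
        by_cases hde : e ∈ F ∙ d
        · obtain ⟨a, rfl⟩ := Submodule.mem_span_singleton.1 hde
          have h1 : d + a • d = (1 + a) • d := by rw [add_smul, one_smul]
          rw [h1] at hφ ⊢
          rw [MemT.smul_iff]
          exact hd _ (by simpa using hφ)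
        · obtain ⟨ψ, hψ, hψe⟩ := exists_dual_eq_one_of_notMem hde
          obtain ⟨g, hg, hg'⟩ := hd ψ (hψ _ (Submodule.mem_span_singleton_self _))
          have h1 : d + e = g e := by rw [hg', hψe, one_smul, add_comm]
          rw [h1] at hφ ⊢
          exact hconj g hg e he φ hφ }
  rcases hirr X (fun g hg d hd => hconj g hg d hd) with hX | hX
  · exact absurd ((Submodule.mem_bot F).1 (hX ▸ (show c ∈ X from hD))) hc
  · exact (show d ∈ X from hX ▸ Submodule.mem_top) φ h

variable [FiniteDimensional F V]

theorem mem_of_notMem_sup {n : ℕ}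
    (hT : ∀ (φ : Dual F V) (c : V), φ c = 0 → MemT H φ c)
    (ih : ∀ (g : V ≃ₗ[F] V) (U : Submodule F V), LinearEquiv.det g = 1 → (∀ u ∈ U, g u = u) →
      finrank F U + n = finrank F V → g ∈ H)
    {g : V ≃ₗ[F] V} {U : Submodule F V} (hg : LinearEquiv.det g = 1) (hU : ∀ u ∈ U, g u = u)
    (hn : finrank F U + (n + 1) = finrank F V) {x : V} (hx : x ∉ U ⊔ F ∙ (g x - x)) : g ∈ H := by
  obtain ⟨φ, hφ, hφx⟩ := exists_dual_eq_one_of_notMem hx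
  have h0 : φ (g x - x) = 0 := hφ _ (Submodule.mem_sup_right (Submodule.mem_span_singleton_self _))
  have hφU : ∀ u ∈ U, φ u = 0 := fun u hu => hφ _ (Submodule.mem_sup_left hu)
  have h0' : φ (x - g x) = 0 := by rw [← neg_sub, map_neg, h0, neg_zero]
  obtain ⟨t, ht, ht'⟩ := hT φ (x - g x) h0'
  have htr : t = LinearEquiv.transvection h0' := by
    ext y; rw [ht', LinearEquiv.transvection.apply]
  have hgx : φ (g x) = 1 := by rw [map_sub, hφx, sub_eq_zero] at h0; exact h0
  have hxU : x ∉ U := fun h => hx (Submodule.mem_sup_left h)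
  have : t * g ∈ H := by
    refine ih (t * g) (U ⊔ F ∙ x) ?_ ?_ ?_
    · rw [map_mul, hg, htr, LinearEquiv.transvection.det_eq_one, mul_one]
    · intro u hu
      obtain ⟨v, hv, w, hw, rfl⟩ := Submodule.mem_sup.1 hu
      obtain ⟨a, rfl⟩ := Submodule.mem_span_singleton.1 hw
      have h1 : t v = v := by simp [ht', hφU v hv]
      have h2 : t (g x) = x := by simp [ht', hgx]
      simp [LinearEquiv.mul_apply, hU v hv, h1, h2]
    · rw [← hn]
      have := LinearEquiv.finrank_quotient_sup_span_singleton hxU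
      have h1 := U.finrank_quotient_add_finrank
      have h2 := (U ⊔ F ∙ x).finrank_quotient_add_finrank
      omega
  exact (H.mul_mem_cancel_left ht).1 this

theorem mem_of_det_eq_one_aux
    (hT : ∀ (φ : Dual F V) (c : V), φ c = 0 → MemT H φ c) (n : ℕ) :
    ∀ (g : V ≃ₗ[F] V) (U : Submodule F V), LinearEquiv.det g = 1 → (∀ u ∈ U, g u = u) →
      finrank F U + n = finrank F V → g ∈ H := by
  induction n with
  | zero =>
    intro g U hg hU hn
    have : U = ⊤ := Submodule.eq_top_of_finrank_eq (by simpa using hn)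
    subst this
    have : g = 1 := by ext x; simpa using hU x trivial
    exact this ▸ H.one_mem
  | succ n ih =>
    intro g U hg hU hn
    by_cases hex : ∃ x, x ∉ U ⊔ F ∙ (g x - x)
    · obtain ⟨x, hx⟩ := hex
      exact mem_of_notMem_sup hT ih hg hU hn hx
    push Not at hex
    have hUtop : U ≠ ⊤ := by
      rintro rfl
      rw [finrank_top] at hn
      omega
    obtain ⟨x, hx⟩ : ∃ x, x ∉ U := by
      by_contra! h
      exact hUtop (eq_top_iff.2 fun x _ => h x)
    obtain ⟨u, hu, w, hw, hxe⟩ := Submodule.mem_sup.1 (hex x)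
    obtain ⟨a, rfl⟩ := Submodule.mem_span_singleton.1 hw
    have ha : a ≠ 0 := by
      rintro rfl
      apply hx
      rw [← hxe]
      simpa using hu
    have hgx : g x = (a⁻¹ * (1 + a)) • x - a⁻¹ • u := by
      have : a • g x = (1 + a) • x - u := by
        rw [add_smul, one_smul]
        nth_rewrite 2 [← hxe]
        rw [smul_sub]; abel
      rw [← inv_smul_smul₀ ha (g x), this, smul_sub, smul_smul]
    by_cases hy : ∃ y, y ∉ U ⊔ F ∙ x
    · obtain ⟨y, hy⟩ := hy
      have hgxy : g x ∉ U ⊔ F ∙ y := by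
        intro h
        obtain ⟨v, hv, w, hw, hh⟩ := Submodule.mem_sup.1 h
        obtain ⟨b, rfl⟩ := Submodule.mem_span_singleton.1 hw
        have hb : b ≠ 0 := by
          rintro rfl
          rw [zero_smul, add_zero] at hh
          apply hx
          have : g x = g v := by rw [hU v hv, hh]
          rw [g.injective this]; exact hv
        apply hy
        have : y = b⁻¹ • (g x - v) := by
          rw [← hh, add_sub_cancel_left, inv_smul_smul₀ hb]
        rw [this, hgx]
        refine Submodule.smul_mem _ _ (Submodule.sub_mem _ (Submodule.sub_mem _ ?_ ?_) ?_)
        · exact Submodule.mem_sup_right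
            (Submodule.smul_mem _ _ (Submodule.mem_span_singleton_self x))
        · exact Submodule.mem_sup_left (U.smul_mem _ hu)
        · exact Submodule.mem_sup_left hv
      obtain ⟨φ, hφ, hφx⟩ := exists_dual_eq_one_of_notMem hgxy
      have h0 : φ y = 0 := hφ _ (Submodule.mem_sup_right (Submodule.mem_span_singleton_self _))
      obtain ⟨t, ht, ht'⟩ := hT φ y h0
      have htr : t = LinearEquiv.transvection h0 := by
        ext y; rw [ht', LinearEquiv.transvection.apply]
      refine (H.mul_mem_cancel_left ht).1 (mem_of_notMem_sup hT ih (g := t * g) (U := U) ?_ ?_ hn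
        (x := x) ?_)
      · rw [map_mul, hg, htr, LinearEquiv.transvection.det_eq_one, mul_one]
      · intro v hv
        rw [LinearEquiv.mul_apply, hU v hv, ht', hφ v (Submodule.mem_sup_left hv), zero_smul,
          add_zero]
      · intro h
        obtain ⟨v, hv, w, hw, hh⟩ := Submodule.mem_sup.1 h
        obtain ⟨b, rfl⟩ := Submodule.mem_span_singleton.1 hw
        rw [LinearEquiv.mul_apply, ht', hφx, one_smul] at hh
        have hb : b ≠ 0 := by
          rintro rfl
          apply hx
          rw [← hh]; simpa using hv
        apply hy
        have : y = b⁻¹ • (x - v) - (g x - x) := by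
          rw [← hh, add_sub_cancel_left, inv_smul_smul₀ hb, hh]; abel
        rw [this, hgx]
        have hxm := Submodule.mem_sup_right (S := U) (Submodule.mem_span_singleton_self (R := F) x)
        have hvm := Submodule.mem_sup_left (T := F ∙ x) hv
        have hum := Submodule.mem_sup_left (T := F ∙ x) hu
        exact Submodule.sub_mem _ (Submodule.smul_mem _ _ (Submodule.sub_mem _ hxm hvm))
          (Submodule.sub_mem _ (Submodule.sub_mem _ (Submodule.smul_mem _ _ hxm)
            (Submodule.smul_mem _ _ hum)) hxm)
    · push Not at hy
      obtain ⟨φ, hφ, hφx⟩ := exists_dual_eq_one_of_notMem hx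
      have hgy : ∀ y, g y = y + φ y • (g x - x) := by
        intro y
        obtain ⟨v, hv, w, hw, rfl⟩ := Submodule.mem_sup.1 (hy y)
        obtain ⟨b, rfl⟩ := Submodule.mem_span_singleton.1 hw
        simp only [map_add, map_smul, hU v hv, hφ v hv, hφx, smul_eq_mul, mul_one, zero_add,
          smul_sub]
        abel
      have hdet : LinearMap.det (LinearMap.transvection φ (g x - x)) = 1 := by
        have : LinearMap.transvection φ (g x - x) = g.toLinearMap := by
          ext y; simp [LinearMap.transvection.apply, hgy y]
        rw [this, ← LinearEquiv.coe_det, hg, Units.val_one]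
      rw [LinearMap.transvection.det, add_eq_left] at hdet
      obtain ⟨t, ht, ht'⟩ := hT φ _ hdet
      have : g = t := by ext y; rw [hgy, ht']
      exact this ▸ ht

/-- A subgroup that contains all transvections and has full determinant is everything. -/
theorem eq_top_of_transvections (hT : ∀ (φ : Dual F V) (c : V), φ c = 0 → MemT H φ c)
    (hdet : ∀ u : Fˣ, ∃ h ∈ H, LinearEquiv.det h = u) : H = ⊤ := by
  rw [eq_top_iff]
  intro g _
  obtain ⟨h, hh, hd⟩ := hdet (LinearEquiv.det g)
  have : g * h⁻¹ ∈ H := by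
    refine mem_of_det_eq_one_aux hT (finrank F V) _ ⊥ ?_ ?_ ?_
    · rw [map_mul, map_inv, hd, mul_inv_cancel]
    · simp
    · simp
  exact (H.mul_mem_cancel_right (H.inv_mem hh)).1 this

end Transvections

/-! ### Subgroups of `GL(K)` containing the multiplications by a cubic extension field -/

section Cubic

open Module

variable {F K : Type*} [Field F] [Field K] [Algebra F K]

/-- Multiplication by a unit of an extension field, as a linear automorphism. -/
def unitMul (F : Type*) {K : Type*} [Field F] [Field K] [Algebra F K] : Kˣ →* (K ≃ₗ[F] K) :=
  DistribMulAction.toModuleAut F K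

@[simp] theorem unitMul_apply (a : Kˣ) (x : K) : unitMul F a x = a * x := rfl

theorem MemT.mul_unit {H : Subgroup (K ≃ₗ[F] K)} (hC : ∀ a, unitMul F a ∈ H) {w c u : K}
    (hu : u ≠ 0) (h : MemT H (Algebra.traceForm F K w) c) :
    MemT H (Algebra.traceForm F K (w * u⁻¹)) (u * c) := by
  have := h.conj (hC (Units.mk0 u hu))
  convert this using 1
  · ext x
    simp [← map_inv, mul_assoc]
  · rfl

theorem memT_trace_iff {H : Subgroup (K ≃ₗ[F] K)} (hC : ∀ a, unitMul F a ∈ H) {w c : K}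
    (hw : w ≠ 0) :
    MemT H (Algebra.traceForm F K w) c ↔ MemT H (Algebra.traceForm F K 1) (w * c) := by
  constructor
  · intro h
    simpa [mul_inv_cancel₀ hw] using h.mul_unit hC hw
  · intro h
    simpa [inv_mul_cancel_left₀ hw] using h.mul_unit hC (inv_ne_zero hw)

theorem memT_trace_smul {H : Subgroup (K ≃ₗ[F] K)} (hC : ∀ a, unitMul F a ∈ H) {z z' y : K}
    (hz : MemT H (Algebra.traceForm F K 1) z) (hz' : MemT H (Algebra.traceForm F K 1) z')
    (hz0 : z ≠ 0) (hy0 : y ≠ 0) (htz : Algebra.trace F K z = 0) (htz' : Algebra.trace F K z' = 0)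
    (hty : Algebra.trace F K y = 0) :
    MemT H (Algebra.traceForm F K 1) (Algebra.trace F K (z * z' / y) • y) := by
  have hw : y / z ≠ 0 := div_ne_zero hy0 hz0
  have h2 : MemT H (Algebra.traceForm F K (y / z)) (z' / (y / z)) := by
    rw [memT_trace_iff hC hw, mul_div_cancel₀ _ hw]
    exact hz'
  have h3 := hz.conj_MemT (by simpa using htz) h2
  have h4 : Algebra.traceForm F K (y / z) z = 0 := by
    rw [Algebra.traceForm_apply, div_mul_cancel₀ _ hz0, hty]
  have h5 : Algebra.traceForm F K (y / z) (z' / (y / z)) = 0 := by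
    rw [Algebra.traceForm_apply, mul_div_cancel₀ _ hw, htz']
  rw [h4, zero_smul, sub_zero] at h3
  have h6 := h3.add_right (h2.neg_right h5) (by rw [map_neg, h5, neg_zero])
  rw [add_neg_cancel_comm, memT_trace_iff hC hw, Algebra.traceForm_apply, one_mul] at h6
  convert h6 using 1
  rw [mul_smul_comm, div_mul_cancel₀ _ hz0]
  congr 2
  field_simp

section Finite

variable [Finite K]

theorem eq_zero_of_trace_mul_eq_zero {w : K} (h : ∀ x, Algebra.trace F K (w * x) = 0) : w = 0 := by
  have : Finite F := Finite.of_injective _ (algebraMap F K).injective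
  exact (traceForm_nondegenerate F K).1 w (by simpa using h)

theorem exists_traceForm_eq (φ : Dual F K) : ∃ w, Algebra.traceForm F K w = φ := by
  have : Finite F := Finite.of_injective _ (algebraMap F K).injective
  exact ⟨_, (LinearMap.BilinForm.toDual _ (traceForm_nondegenerate F K)).apply_symm_apply φ⟩

theorem traceForm_ne_zero {w : K} (hw : w ≠ 0) : Algebra.traceForm F K w ≠ 0 := by
  intro h
  exact hw (eq_zero_of_trace_mul_eq_zero (F := F) fun x => by
    simpa using LinearMap.congr_fun h x)

theorem eq_zero_of_quadratic_eq_zero (h3 : finrank F K = 3) {y : K}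
    (hy : y ∉ (algebraMap F K).range) {a b c : F} (h : a • y ^ 2 + b • y + c • (1 : K) = 0) :
    a = 0 ∧ b = 0 ∧ c = 0 := by
  have : Finite F := Finite.of_injective _ (algebraMap F K).injective
  open Polynomial in
  by_contra hne
  have hp : C a * X ^ 2 + C b * X + C c ≠ 0 := by
    intro h0
    have h2 := congrArg (fun p => coeff p 2) h0
    have h1 := congrArg (fun p => coeff p 1) h0
    have h0 := congrArg (fun p => coeff p 0) h0
    simp [coeff_X, coeff_C] at h2 h1 h0
    exact hne ⟨h2, h1, h0⟩
  have hd := minpoly.degree_le_of_ne_zero F y hp (by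
    simpa [Algebra.smul_def] using h)
  have hd2 : (minpoly F y).natDegree ≤ 2 := natDegree_le_of_degree_le (hd.trans degree_quadratic_le)
  have hdvd := minpoly.degree_dvd (IsIntegral.of_finite F y)
  rw [h3] at hdvd
  have h1 : (minpoly F y).natDegree = 1 := by
    rcases (Nat.dvd_prime Nat.prime_three).1 hdvd with h | h <;> omega
  exact hy (minpoly.natDegree_eq_one_iff.1 h1)

theorem exists_eq_smul_add_smul {V : Type*} [AddCommGroup V] [Module F V]
    (h3 : finrank F V = 3) {φ : Dual F V} (hφ : φ ≠ 0) {x y v : V} (hx0 : x ≠ 0)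
    (hxy : y ∉ F ∙ x) (hx : φ x = 0) (hy : φ y = 0) (hv : φ v = 0) :
    ∃ a b : F, a • x + b • y = v := by
  have : FiniteDimensional F V := Module.finite_of_finrank_pos (by omega)
  have hli : LinearIndependent F ![x, y] := by
    rw [LinearIndependent.pair_iff' hx0]
    intro a ha
    exact hxy (Submodule.mem_span_singleton.2 ⟨a, ha⟩)
  have hle : Submodule.span F (Set.range ![x, y]) ≤ LinearMap.ker φ := by
    rw [Submodule.span_le]
    rintro _ ⟨i, rfl⟩
    fin_cases i <;> simp [hx, hy]
  have hker := LinearMap.finrank_range_add_finrank_ker φ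
  rw [LinearMap.range_eq_top.2 (LinearMap.surjective hφ), finrank_top, finrank_self] at hker
  have heq := Submodule.eq_of_le_of_finrank_eq hle (by
    rw [finrank_span_eq_card hli, Fintype.card_fin]; omega)
  have hv' : v ∈ Submodule.span F (Set.range ![x, y]) := heq ▸ hv
  rw [Matrix.range_cons, Matrix.range_cons, Matrix.range_empty, Set.union_empty,
    Set.singleton_union, Submodule.mem_span_pair] at hv'
  exact hv'

theorem exists_ne_zero_traceForm_eq_zero (h3 : finrank F K = 3) (w : K) :
    ∃ y ≠ 0, Algebra.trace F K (w * y) = 0 := by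
  have : FiniteDimensional F K := Module.finite_of_finrank_pos (by omega)
  have hker := LinearMap.finrank_range_add_finrank_ker (Algebra.traceForm F K w)
  have h1 := Submodule.finrank_le (LinearMap.range (Algebra.traceForm F K w))
  rw [finrank_self] at h1
  obtain ⟨y, hy, hy0⟩ := (LinearMap.ker (Algebra.traceForm F K w)).exists_mem_ne_zero_of_ne_bot
    (by intro h; rw [h, finrank_bot] at hker; omega)
  exact ⟨y, hy0, by simpa using hy⟩

variable {H : Subgroup (K ≃ₗ[F] K)}

/-- Over a cubic field, the centres of the transvections in `H` do not lie on one line. -/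
theorem exists_memT_notMem_span (h3 : finrank F K = 3) (hC : ∀ a, unitMul F a ∈ H) {z : K}
    (hz0 : z ≠ 0) (htz : Algebra.trace F K z = 0)
    (hz : MemT H (Algebra.traceForm F K 1) z) (y : K) :
    ∃ z', Algebra.trace F K z' = 0 ∧ MemT H (Algebra.traceForm F K 1) z' ∧ z' ∉ F ∙ y := by
  by_contra! hcon
  have hFz : ∀ z', Algebra.trace F K z' = 0 → MemT H (Algebra.traceForm F K 1) z' → z' ∈ F ∙ z := by
    intro z' h1 h2
    obtain ⟨a, ha⟩ := Submodule.mem_span_singleton.1 (hcon z htz hz)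
    obtain ⟨b, hb⟩ := Submodule.mem_span_singleton.1 (hcon z' h1 h2)
    have ha0 : a ≠ 0 := by rintro rfl; exact hz0 (by rw [← ha, zero_smul])
    exact Submodule.mem_span_singleton.2 ⟨b * a⁻¹, by
      rw [← ha, smul_smul, mul_assoc, inv_mul_cancel₀ ha0, mul_one, hb]⟩
  have hne1 : Algebra.traceForm F K 1 ≠ 0 := traceForm_ne_zero one_ne_zero
  -- an element of the trace hyperplane off the line
  obtain ⟨v, hv, hvz⟩ : ∃ v, Algebra.trace F K v = 0 ∧ v ∉ F ∙ z := by
    have : FiniteDimensional F K := Module.finite_of_finrank_pos (by omega)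
    by_contra! hcon'
    have hle : LinearMap.ker (Algebra.traceForm F K 1) ≤ F ∙ z := fun v hv =>
      hcon' v (by simpa using hv)
    have h1 := Submodule.finrank_mono hle
    rw [finrank_span_singleton hz0] at h1
    have hker := LinearMap.finrank_range_add_finrank_ker (Algebra.traceForm F K 1)
    rw [LinearMap.range_eq_top.2 (LinearMap.surjective hne1), finrank_top, finrank_self] at hker
    omega
  have hv0 : v ≠ 0 := by rintro rfl; exact hvz (zero_mem _)
  obtain ⟨a, ha⟩ := Submodule.mem_span_singleton.1 (hFz _ (by rw [map_smul, hv, smul_zero])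
    (memT_trace_smul hC hz hz hz0 hv0 htz htz hv))
  have htr : Algebra.trace F K (z * z / v) = 0 := by
    by_contra hne
    apply hvz
    refine Submodule.mem_span_singleton.2 ⟨(Algebra.trace F K (z * z / v))⁻¹ * a, ?_⟩
    rw [mul_smul, ha, inv_smul_smul₀ hne]
  obtain ⟨b, c, hbc⟩ := exists_eq_smul_add_smul h3 hne1 (x := z) (y := v) (v := z * z / v) hz0 hvz
    (by simpa using htz) (by simpa using hv) (by simpa using htr)
  have hm : v / z ∉ (algebraMap F K).range := by
    rintro ⟨t, ht⟩
    exact hvz (Submodule.mem_span_singleton.2 ⟨t, by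
      rw [Algebra.smul_def, ht, div_mul_cancel₀ _ hz0]⟩)
  have := eq_zero_of_quadratic_eq_zero h3 hm (a := c) (b := b) (c := -1) (by
    rw [Algebra.smul_def] at hbc ⊢
    rw [Algebra.smul_def] at hbc ⊢
    simp only [neg_smul, one_smul]
    field_simp at hbc ⊢
    linear_combination hbc)
  simpa using this.2.2

/-- Over a cubic field, a single transvection together with the multiplications yields all
transvections with the trace hyperplane as axis. -/
theorem memT_of_exists_transvection (h3 : finrank F K = 3) (hC : ∀ a, unitMul F a ∈ H) {z : K}
    (hz0 : z ≠ 0) (htz : Algebra.trace F K z = 0) (hz : MemT H (Algebra.traceForm F K 1) z)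
    (y : K) (hty : Algebra.trace F K y = 0) : MemT H (Algebra.traceForm F K 1) y := by
  classical
  have : Finite F := Finite.of_injective _ (algebraMap F K).injective
  have := Fintype.ofFinite F
  have := Fintype.ofFinite K
  have hne1 : Algebra.traceForm F K 1 ≠ 0 := traceForm_ne_zero one_ne_zero
  let B : AddSubgroup K :=
    { carrier := {b | Algebra.trace F K b = 0 ∧ MemT H (Algebra.traceForm F K 1) b}
      zero_mem' := ⟨map_zero _, MemT.zero_right _⟩
      add_mem' := fun {a b} ha hb => ⟨by rw [map_add, ha.1, hb.1, add_zero],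
        ha.2.add_right hb.2 (by simpa using hb.1)⟩
      neg_mem' := fun {a} ha => ⟨by rw [map_neg, ha.1, neg_zero],
        ha.2.neg_right (by simpa using ha.1)⟩ }
  have hBmem : ∀ b, b ∈ B ↔ Algebra.trace F K b = 0 ∧ MemT H (Algebra.traceForm F K 1) b :=
    fun b => Iff.rfl
  -- the set of scalars `a` such that `a • y` is a centre
  let κ : K → ℕ := fun y => Fintype.card {a : F // a • y ∈ B}
  have hκ : ∀ y ≠ 0, Algebra.trace F K y = 0 → Fintype.card B ≤ κ y * κ y := by
    intro y hy0 hty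
    obtain ⟨w, htw, hw, hwy⟩ := exists_memT_notMem_span h3 hC hz0 htz hz y
    have hw0 : w ≠ 0 := by rintro rfl; exact hwy (zero_mem _)
    let f : B →+ F := (Algebra.traceForm F K (w / y)).toAddMonoidHom.comp B.subtype
    have hf : ∀ b : B, f b = Algebra.trace F K (w / y * b) := fun b => rfl
    have hcard := f.ker.card_eq_card_quotient_mul_card_addSubgroup
    rw [Nat.card_congr (QuotientAddGroup.quotientKerEquivRange f).toEquiv] at hcard
    rw [← Nat.card_eq_fintype_card, hcard]
    refine Nat.mul_le_mul ?_ ?_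
    · rw [show κ y = Nat.card {a : F // a • y ∈ B} from Nat.card_eq_fintype_card.symm]
      refine Nat.card_le_card_of_injective (fun a => ⟨a.1, ?_⟩) ?_
      · obtain ⟨_, b, rfl⟩ := a
        refine ⟨by rw [map_smul, hty, smul_zero], ?_⟩
        have := memT_trace_smul hC hw b.2.2 hw0 hy0 htw b.2.1 hty
        rw [← div_mul_eq_mul_div] at this
        exact this
      · intro a b h
        have h' : (a : F) = b := Subtype.mk.inj h
        exact Subtype.ext h'
    · rw [show κ y = Nat.card {a : F // a • y ∈ B} from Nat.card_eq_fintype_card.symm]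
      have hex : ∀ b : f.ker, ∃ a : F, a • y = (b : B) := by
        intro b
        have hb : Algebra.traceForm F K (w / y) (b : B) = 0 := b.2
        by_contra! hne
        have hby : ((b : B) : K) ∉ F ∙ y := fun h => by
          obtain ⟨a, ha⟩ := Submodule.mem_span_singleton.1 h
          exact hne a ha
        have hkill : ∀ v, Algebra.trace F K v = 0 → Algebra.traceForm F K (w / y) v = 0 := by
          intro v hv
          obtain ⟨s, t, rfl⟩ := exists_eq_smul_add_smul h3 hne1 hy0 hby (by simpa using hty)
            (by simpa using (b : B).2.1) (v := v) (by simpa using hv)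
          rw [map_add, map_smul, map_smul, hb, Algebra.traceForm_apply, div_mul_cancel₀ _ hy0, htw]
          simp
        obtain ⟨t, ht⟩ := Algebra.trace_surjective F K 1
        have hwt : w / y = algebraMap F K (Algebra.traceForm F K (w / y) t) := by
          rw [← sub_eq_zero]
          apply eq_zero_of_trace_mul_eq_zero (F := F)
          intro x
          have := hkill (x - Algebra.trace F K x • t) (by rw [map_sub, map_smul, ht]; simp)
          rw [map_sub, map_smul, sub_eq_zero] at this
          rw [sub_mul, map_sub, ← Algebra.smul_def, map_smul, ← Algebra.traceForm_apply, this]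
          simp [mul_comm]
        apply hwy
        refine Submodule.mem_span_singleton.2 ⟨Algebra.traceForm F K (w / y) t, ?_⟩
        rw [Algebra.smul_def, ← hwt, div_mul_cancel₀ _ hy0]
      choose a ha using hex
      refine Nat.card_le_card_of_injective (fun b => ⟨a b, by rw [ha]; exact b.1.2⟩) ?_
      intro b b' h
      have : a b = a b' := congrArg Subtype.val h
      exact Subtype.ext (Subtype.ext (by rw [← ha, ← ha, this]))
  -- count pairs `(y, a)` with `y` in the punctured trace hyperplane, `a ≠ 0` and `a • y ∈ B`
  let Y := {y : K // y ≠ 0 ∧ Algebra.trace F K y = 0}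
  have hYcard : Fintype.card Y + 1 = Fintype.card F ^ 2 := by
    have h1 : Fintype.card (LinearMap.ker (Algebra.traceForm F K 1)) = Fintype.card F ^ 2 := by
      have hker := LinearMap.finrank_range_add_finrank_ker (Algebra.traceForm F K 1)
      rw [LinearMap.range_eq_top.2 (LinearMap.surjective hne1), finrank_top, finrank_self,
        h3] at hker
      rw [Module.card_eq_pow_finrank (K := F)]
      congr 1
      omega
    rw [← h1, ← Fintype.card_option]
    refine Fintype.card_congr (Equiv.ofBijective
      (fun o : Option Y => o.elim 0 fun y => ⟨y.1, by simpa using y.2.2⟩) ⟨?_, ?_⟩)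
    · rintro (_ | ⟨a, ha⟩) (_ | ⟨b, hb⟩) h
      · rfl
      · exact absurd (congrArg Subtype.val h).symm hb.1
      · exact absurd (congrArg Subtype.val h) ha.1
      · have h' : a = b := congrArg Subtype.val h
        subst h'
        rfl
    · rintro ⟨b, hb⟩
      by_cases h0 : b = 0
      · exact ⟨none, Subtype.ext h0.symm⟩
      · exact ⟨some ⟨b, h0, by simpa using hb⟩, rfl⟩
  have hcount : (∑ y : Y, (κ y - 1)) = (Fintype.card F - 1) * (Fintype.card B - 1) := by
    have h1 : ∀ y : Y, κ y - 1 = Fintype.card {a : Fˣ // a • (y : K) ∈ B} := by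
      intro y
      have : κ y = Fintype.card (Option {a : Fˣ // a • (y : K) ∈ B}) := by
        refine (Fintype.card_congr (Equiv.ofBijective
          (fun o : Option {a : Fˣ // a • (y : K) ∈ B} => (o.elim ⟨0, by simp [B.zero_mem]⟩
            fun a => ⟨a.1, a.2⟩ : {a : F // a • (y : K) ∈ B})) ⟨?_, ?_⟩)).symm
        · rintro (_ | ⟨a, ha⟩) (_ | ⟨b, hb⟩) h
          · rfl
          · exact absurd (congrArg Subtype.val h).symm b.ne_zero
          · exact absurd (congrArg Subtype.val h) a.ne_zero
          · simpa [Units.ext_iff] using h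
        · rintro ⟨b, hb⟩
          by_cases h0 : b = 0
          · exact ⟨none, Subtype.ext h0.symm⟩
          · exact ⟨some ⟨Units.mk0 b h0, hb⟩, rfl⟩
      rw [this, Fintype.card_option, Nat.add_sub_cancel]
    rw [Finset.sum_congr rfl fun y _ => h1 y, ← Fintype.card_sigma, ← Fintype.card_units]
    have h2 : Fintype.card B - 1 = Fintype.card {b : B // b ≠ 0} := by
      rw [Fintype.card_subtype_compl, Fintype.card_subtype_eq]
    rw [h2, ← Fintype.card_prod]
    refine Fintype.card_congr (Equiv.ofBijective
      (fun p => (p.2.1, ⟨⟨p.2.1 • (p.1 : K), p.2.2⟩, fun h =>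
        p.1.2.1 ((smul_eq_zero_iff_eq _).1 (congrArg Subtype.val h))⟩)) ⟨?_, ?_⟩)
    · rintro ⟨⟨y, hy⟩, ⟨a, ha⟩⟩ ⟨⟨y', hy'⟩, ⟨a', ha'⟩⟩ h
      obtain rfl : a = a' := congrArg Prod.fst h
      have h2 : a • y = a • y' := congrArg (fun p => (p.2.1 : K)) h
      obtain rfl := smul_left_cancel a h2
      rfl
    · rintro ⟨a, ⟨⟨b, hb⟩, hb0⟩⟩
      have hb0' : b ≠ 0 := fun h => hb0 (Subtype.ext h)
      refine ⟨⟨⟨a⁻¹ • b, fun h => hb0' ((smul_eq_zero_iff_eq _).1 h), ?_⟩, ⟨a, ?_⟩⟩, ?_⟩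
      · rw [Units.smul_def, map_smul, hb.1, smul_zero]
      · rw [smul_inv_smul]; exact hb
      · exact Prod.ext rfl (Subtype.ext (Subtype.ext (smul_inv_smul a b)))
  have hz1 : 1 < Fintype.card B :=
    Fintype.one_lt_card_iff.2 ⟨⟨z, htz, hz⟩, 0, fun h => hz0 (congrArg Subtype.val h)⟩
  have hFcard : 1 < Fintype.card F := Fintype.one_lt_card
  -- the minimal fibre is the whole line
  have hfull : ∀ y : Y, Fintype.card F ≤ κ y := by
    have hYne : Nonempty Y := ⟨⟨z, hz0, htz⟩⟩
    obtain ⟨y₀, hy₀⟩ := Finite.exists_min (fun y : Y => κ y)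
    suffices Fintype.card F ≤ κ y₀ from fun y => this.trans (hy₀ y)
    have h1 : Fintype.card Y * (κ y₀ - 1) ≤ ∑ y : Y, (κ y - 1) := by
      rw [← smul_eq_mul, ← Finset.card_univ]
      exact Finset.card_nsmul_le_sum _ _ _ fun y _ => Nat.sub_le_sub_right (hy₀ y) 1
    have h2 := hκ y₀ y₀.2.1 y₀.2.2
    rw [hcount] at h1
    have h4 : 1 < κ y₀ := by
      by_contra! h
      have := Nat.mul_le_mul h h
      omega
    obtain ⟨k, hk⟩ : ∃ k, κ y₀ = k + 2 := ⟨κ y₀ - 2, by omega⟩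
    obtain ⟨b, hb⟩ : ∃ b, Fintype.card B = b + 1 := ⟨Fintype.card B - 1, by omega⟩
    obtain ⟨f, hf⟩ : ∃ f, Fintype.card F = f + 2 := ⟨Fintype.card F - 2, by omega⟩
    have h5 : Fintype.card Y = (f + 1) * (f + 3) := by
      have := hYcard; rw [hf] at this; nlinarith
    rw [hk] at h2 h1 ⊢
    rw [hb] at h2 h1
    rw [hf] at h1 ⊢
    rw [h5] at h1
    simp only [Nat.add_sub_cancel, show k + 2 - 1 = k + 1 by omega,
      show f + 2 - 1 = f + 1 by omega] at h1
    rw [mul_assoc] at h1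
    have h6 := Nat.le_of_mul_le_mul_left h1 (Nat.succ_pos f)
    have h7 : (f + 3) * (k + 1) ≤ (k + 3) * (k + 1) := by nlinarith
    have := Nat.le_of_mul_le_mul_right h7 (Nat.succ_pos k)
    omega
  by_cases hy0 : y = 0
  · exact hy0 ▸ MemT.zero_right _
  have hle := hfull ⟨y, hy0, hty⟩
  have hall : ∀ a : F, a • y ∈ B := by
    by_contra! h
    obtain ⟨a, ha⟩ := h
    exact absurd hle (not_le.2 (Fintype.card_subtype_lt (p := fun a : F => a • y ∈ B) ha))
  have := (hall 1).2
  rwa [one_smul] at this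

end Finite

end Cubic

section CubicOvergroups

open Module

section MemT

variable {F V : Type*} [Field F] [AddCommGroup V] [Module F V] {H : Subgroup (V ≃ₗ[F] V)}
  {φ ψ : Dual F V} {c d : V}

theorem MemT.one_add_ne_zero (h : MemT H φ c) : 1 + φ c ≠ 0 := by
  obtain ⟨g, -, hg⟩ := h
  intro h0
  have h1 : g c = 0 := by
    rw [hg, eq_neg_of_add_eq_zero_right h0, neg_one_smul, add_neg_cancel]
  rw [g.map_eq_zero_iff.1 h1, map_zero, add_zero] at h0
  exact one_ne_zero h0

theorem MemT.comp (hc : MemT H φ c) (hd : MemT H φ d) : MemT H φ (c + d + φ d • c) := by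
  obtain ⟨g, hgH, hg⟩ := hc
  obtain ⟨k, hkH, hk⟩ := hd
  refine ⟨g * k, H.mul_mem hgH hkH, fun x => ?_⟩
  rw [LinearEquiv.mul_apply, hk, hg, map_add, map_smul, smul_eq_mul]
  module

theorem MemT.inv (hc : MemT H φ c) : MemT H φ (-(1 + φ c)⁻¹ • c) := by
  have h0 := hc.one_add_ne_zero
  obtain ⟨g, hgH, hg⟩ := hc
  refine ⟨g⁻¹, H.inv_mem hgH, fun x => inv_apply_of_eq ?_⟩
  rw [hg, map_add, map_smul, map_smul, add_assoc, add_eq_left, smul_smul, ← add_smul,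
    smul_eq_mul, smul_eq_mul]
  convert zero_smul F c using 2
  field_simp
  ring

/-- The product of `1 + φ ⊗ a` and the inverse of `1 + φ ⊗ b`. -/
theorem MemT.comp_inv {a b : V} (ha : MemT H φ a) (hb : MemT H φ b) :
    MemT H φ ((1 + φ b)⁻¹ • (a - b)) := by
  convert ha.comp hb.inv using 1
  have := hb.one_add_ne_zero
  rw [map_smul, smul_eq_mul]
  match_scalars <;> field_simp
  ring

theorem MemT.conj_of_apply_eq_zero (hc : MemT H φ c) (hd : MemT H ψ d) (h : φ d = 0) :
    MemT H φ (c + ψ c • d) := by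
  obtain ⟨k, hkH, hk⟩ := hd
  have := hc.conj hkH
  rw [hk] at this
  convert this using 1
  ext x
  obtain ⟨y, rfl⟩ := k.surjective x
  have h1 : k⁻¹ (k y) = y := inv_apply_of_eq rfl
  change φ (k y) = φ (k⁻¹ (k y))
  rw [h1, hk, map_add, map_smul, h, smul_zero, add_zero]

end MemT

variable {F K : Type*} [Field F] [Field K] [Algebra F K]

theorem coe_det_unitMul (a : Kˣ) :
    (LinearEquiv.det (unitMul F a) : F) = Algebra.norm F (a : K) := by
  rw [LinearEquiv.coe_det, Algebra.norm_apply]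
  rfl

variable [Finite K] {H : Subgroup (K ≃ₗ[F] K)}

theorem eq_top_of_transvection_of_cubic (h3 : finrank F K = 3) (hC : ∀ a, unitMul F a ∈ H) {z : K}
    (hz0 : z ≠ 0) (htz : Algebra.trace F K z = 0) (hz : MemT H (Algebra.traceForm F K 1) z) :
    H = ⊤ := by
  have : FiniteDimensional F K := Module.finite_of_finrank_pos (by omega)
  refine eq_top_of_transvections (fun φ c h => ?_) fun u => ?_
  · obtain ⟨w, rfl⟩ := exists_traceForm_eq φ
    by_cases hw : w = 0
    · rw [hw, map_zero]
      exact MemT.zero_left c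
    · rw [memT_trace_iff hC hw]
      exact memT_of_exists_transvection h3 hC hz0 htz hz _ h
  · obtain ⟨x, hx⟩ := FiniteField.norm_surjective F K (u : F)
    have hx0 : x ≠ 0 := by
      rintro rfl
      exact u.ne_zero (by rw [← hx, Algebra.norm_zero])
    exact ⟨_, hC (Units.mk0 x hx0), Units.ext (by rw [coe_det_unitMul, Units.val_mk0, hx])⟩

theorem eq_top_of_memT_of_cubic (h3 : finrank F K = 3) (hC : ∀ a, unitMul F a ∈ H)
    {φ : Dual F K} {c : K} (hφ : φ ≠ 0) (hc : c ≠ 0) (h : MemT H φ c) : H = ⊤ := by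
  obtain ⟨w, rfl⟩ := exists_traceForm_eq φ
  have hw : w ≠ 0 := by
    rintro rfl
    exact hφ (map_zero _)
  rw [memT_trace_iff hC hw] at h
  set z := w * c with hzdef
  have hz0 : z ≠ 0 := mul_ne_zero hw hc
  by_cases htz : Algebra.trace F K z = 0
  · exact eq_top_of_transvection_of_cubic h3 hC hz0 htz h
  by_contra hH
  have hT1 : ∀ x, Algebra.traceForm F K 1 x = Algebra.trace F K x := fun x => by simp
  have hprop : ∀ z', MemT H (Algebra.traceForm F K 1) z' →
      Algebra.trace F K z' • z = Algebra.trace F K z • z' := by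
    intro z' h'
    by_contra hne
    have h2 := (h.comp h').comp_inv (h'.comp h)
    have h4 := (h'.comp h).one_add_ne_zero
    simp only [hT1] at h2 h4
    refine hH (eq_top_of_transvection_of_cubic h3 hC (smul_ne_zero (inv_ne_zero h4) ?_) ?_ h2)
    · rw [sub_ne_zero]
      intro heq
      apply hne
      rw [add_comm z' z] at heq
      exact add_left_cancel heq
    · simp only [map_smul, map_sub, map_add, smul_eq_mul]
      ring
  have hinv : ∀ y ≠ 0, Algebra.trace F K (z * y) = 0 → Algebra.trace F K (z * y⁻¹) = 0 := by
    intro y hy0 hy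
    have h2 : MemT H (Algebra.traceForm F K y⁻¹) (z * y) := by
      rw [memT_trace_iff hC (inv_ne_zero hy0), mul_comm z, inv_mul_cancel_left₀ hy0]
      exact h
    have h5 := hprop _ (h.conj_of_apply_eq_zero h2 (by rw [hT1, hy]))
    rw [map_add, map_smul, hy, smul_zero, add_zero, Algebra.traceForm_apply] at h5
    have h6 := (smul_right_injective K htz h5).symm
    rw [add_eq_left, smul_eq_zero] at h6
    rw [mul_comm]
    exact h6.resolve_right (mul_ne_zero hz0 hy0)
  obtain ⟨y, hy0, hy⟩ := exists_ne_zero_traceForm_eq_zero (F := F) h3 z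
  have hyF : y ∉ (algebraMap F K).range := by
    rintro ⟨a, rfl⟩
    rw [mul_comm, ← Algebra.smul_def, map_smul, smul_eq_mul] at hy
    exact (mul_ne_zero (fun h => hy0 (by rw [h, map_zero])) htz) hy
  have hyF2 : y ^ 2 ∉ (algebraMap F K).range := by
    rintro ⟨a, ha⟩
    have := eq_zero_of_quadratic_eq_zero h3 hyF (a := 1) (b := 0) (c := -a) (by
      rw [← ha]; simp [Algebra.smul_def])
    exact one_ne_zero this.1
  have hy1 : y⁻¹ ∉ F ∙ y := by
    intro hmem
    obtain ⟨a, ha⟩ := Submodule.mem_span_singleton.1 hmem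
    have ha0 : a ≠ 0 := by
      rintro rfl
      exact inv_ne_zero hy0 (by rw [← ha, zero_smul])
    apply hyF2
    refine ⟨a⁻¹, ?_⟩
    rw [Algebra.smul_def] at ha
    have ha0' : algebraMap F K a ≠ 0 := by simpa using ha0
    rw [map_inv₀]
    field_simp at ha ⊢
    exact ha.symm
  have hsum : y + y⁻¹ ≠ 0 := by
    intro h0
    apply hyF2
    refine ⟨-1, ?_⟩
    rw [map_neg, map_one]
    field_simp at h0
    linear_combination -h0
  have hy' := hinv y hy0 hy
  have hs := hinv (y + y⁻¹) hsum (by rw [mul_add, map_add, hy, hy', add_zero])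
  obtain ⟨a, b, hab⟩ := exists_eq_smul_add_smul h3 (traceForm_ne_zero hz0) hy0 hy1
    (v := (y + y⁻¹)⁻¹) hy hy' hs
  have := eq_zero_of_quadratic_eq_zero h3 hyF2 (a := a) (b := a + b - 1) (c := b) (by
    have h7 := congrArg (fun x => x * (y + y⁻¹)) hab
    simp only [inv_mul_cancel₀ hsum] at h7
    simp only [Algebra.smul_def, map_add, map_sub, map_one] at h7 ⊢
    field_simp at h7
    linear_combination h7)
  obtain ⟨ha, hb, hb'⟩ := this
  rw [ha, hb', add_zero, zero_sub, neg_eq_zero] at hb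
  exact one_ne_zero hb

end CubicOvergroups

section CubicNormalizer

open Module

variable {F K : Type*} [Field F] [Field K] [Algebra F K]

/-- The elements of `K` along which the linear automorphism `g` is multiplicative up to `g 1`. -/
def multStab (g : K ≃ₗ[F] K) : Subalgebra F K where
  carrier := {μ | ∀ x, g (μ * x) * g 1 = g μ * g x}
  mul_mem' {μ ν} hμ hν x := by
    have h1 : g 1 ≠ 0 := by simp
    apply mul_right_cancel₀ h1
    have h2 := hμ (ν * x)
    have h3 := hμ ν
    have h4 := hν x
    rw [mul_assoc μ ν x]
    linear_combination g 1 * h2 + g μ * h4 - g x * h3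
  add_mem' {μ ν} hμ hν x := by
    have h2 := hμ x
    have h3 := hν x
    rw [add_mul, map_add, map_add]
    linear_combination h2 + h3
  algebraMap_mem' r x := by
    rw [← Algebra.smul_def, map_smul, Algebra.algebraMap_eq_smul_one, map_smul]
    rw [smul_mul_assoc, smul_mul_assoc, mul_comm]

theorem mem_multStab {g : K ≃ₗ[F] K} {μ : K} :
    μ ∈ multStab g ↔ ∀ x, g (μ * x) * g 1 = g μ * g x := Iff.rfl

/-- An automorphism that is multiplicative up to `g 1` is a multiple of an algebra homomorphism. -/
def algHomOfMultStab (g : K ≃ₗ[F] K) (h : multStab g = ⊤) : K →ₐ[F] K :=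
  AlgHom.ofLinearMap ((g 1)⁻¹ • g.toLinearMap) (by simp) fun x y => by
    have h1 : g 1 ≠ 0 := by simp
    have h2 : x ∈ multStab g := h ▸ Algebra.mem_top
    have := h2 y
    simp only [LinearMap.smul_apply, LinearEquiv.coe_coe, smul_eq_mul]
    field_simp
    rw [mul_comm, this]

theorem apply_eq_algHomOfMultStab (g : K ≃ₗ[F] K) (h : multStab g = ⊤) (x : K) :
    g x = g 1 * algHomOfMultStab g h x := by
  have h1 : g 1 ≠ 0 := by simp
  change _ = g 1 * ((g 1)⁻¹ * g x)
  rw [mul_inv_cancel_left₀ h1]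

theorem multStab_eq_top_of_mem (h3 : finrank F K = 3) {g : K ≃ₗ[F] K} {μ : K}
    (hμ : μ ∉ (algebraMap F K).range) (h : μ ∈ multStab g) : multStab g = ⊤ := by
  have : Fact (finrank F K).Prime := ⟨h3 ▸ Nat.prime_three⟩
  have := Subalgebra.isSimpleOrder_of_finrank_prime F K Fact.out
  refine (eq_bot_or_eq_top (multStab g)).resolve_left fun hb => hμ ?_
  rw [hb] at h
  exact Algebra.mem_bot.1 h

variable {H : Subgroup (K ≃ₗ[F] K)}

/-- The automorphism `x ↦ g (μ x) / g μ`. -/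
def twist (g : K ≃ₗ[F] K) (μ : Kˣ) : K ≃ₗ[F] K :=
  unitMul F (Units.mk0 (g μ) (by simp))⁻¹ * g * unitMul F μ

theorem twist_apply (g : K ≃ₗ[F] K) (μ : Kˣ) (x : K) : twist g μ x = (g μ)⁻¹ * g (μ * x) := rfl

theorem twist_mem {g : K ≃ₗ[F] K} {μ : Kˣ} (hC : ∀ a, unitMul F a ∈ H) (hg : g ∈ H) :
    twist g μ ∈ H := H.mul_mem (H.mul_mem (hC _) hg) (hC _)

/-- The twisted action of `Kˣ` on the stabiliser of `1` in a group containing the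
multiplications. -/
abbrev twistedAction (hC : ∀ a, unitMul F a ∈ H) :
    MulAction Kˣ {g : K ≃ₗ[F] K // g ∈ H ∧ g 1 = 1} where
  smul μ g := ⟨twist g.1 μ, twist_mem hC g.2.1, by
    have : g.1 μ ≠ 0 := by simp
    rw [twist_apply, mul_one, inv_mul_cancel₀ this]⟩
  one_smul g := Subtype.ext (LinearEquiv.ext fun x => by
    change twist g.1 1 x = g.1 x
    rw [twist_apply, Units.val_one, g.2.2, inv_one, one_mul, one_mul])
  mul_smul μ ν g := Subtype.ext (LinearEquiv.ext fun x => by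
    change twist g.1 (μ * ν) x = twist (twist g.1 ν) μ x
    have : g.1 ν ≠ 0 := by simp
    simp only [twist_apply]
    rw [Units.val_mul, mul_inv, inv_inv, mul_mul_mul_comm, mul_inv_cancel₀ this, one_mul,
      mul_comm (μ : K) ν, mul_assoc])

theorem card_units_mem_multStab (h3 : finrank F K = 3) {g : K ≃ₗ[F] K} (hg : multStab g ≠ ⊤) :
    Nat.card {μ : Kˣ // (μ : K) ∈ multStab g} = Nat.card F - 1 := by
  rw [← Nat.card_units F]
  refine (Nat.card_congr (Equiv.ofBijective
    (fun a : Fˣ => (⟨Units.map (algebraMap F K : F →* K) a, (multStab g).algebraMap_mem a⟩ :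
      {μ : Kˣ // (μ : K) ∈ multStab g})) ⟨?_, ?_⟩)).symm
  · intro a b hab
    have h1 : algebraMap F K a = algebraMap F K b := congrArg (fun μ => ((μ.1 : Kˣ) : K)) hab
    exact Units.ext ((algebraMap F K).injective h1)
  · rintro ⟨μ, hμ⟩
    obtain ⟨a, ha⟩ : (μ : K) ∈ (algebraMap F K).range := by
      by_contra h
      exact hg (multStab_eq_top_of_mem h3 h hμ)
    have ha0 : a ≠ 0 := by
      rintro rfl
      exact μ.ne_zero (by rw [← ha, map_zero])
    exact ⟨Units.mk0 a ha0, Subtype.ext (Units.ext ha)⟩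

variable [Finite K]

theorem card_multStab_le (h3 : finrank F K = 3) :
    Nat.card {g : K ≃ₗ[F] K // multStab g = ⊤} ≤ (Nat.card K - 1) * 3 := by
  have : FiniteDimensional F K := Module.finite_of_finrank_pos (by omega)
  classical
  have := Fintype.ofFinite K
  have h1 : Nat.card (K →ₐ[F] K) ≤ 3 := by
    rw [Nat.card_eq_fintype_card, ← h3]
    exact AlgHom.card_le
  have h2 : Nat.card Kˣ = Nat.card K - 1 := Nat.card_units K
  rw [← h2]
  refine le_trans ?_ (Nat.mul_le_mul_left _ h1)
  rw [← Nat.card_prod]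
  refine Nat.card_le_card_of_injective
    (fun g => (Units.mk0 (g.1 1) (by simp), algHomOfMultStab g.1 g.2)) ?_
  intro g g' h
  have h4 : g.1 1 = g'.1 1 := congrArg (fun p => (p.1 : K)) h
  have h5 := congrArg Prod.snd h
  simp only at h5
  refine Subtype.ext (LinearEquiv.ext fun x => ?_)
  rw [apply_eq_algHomOfMultStab _ g.2, apply_eq_algHomOfMultStab _ g'.2, h4, h5]

/-- A group meeting no pointwise stabiliser of a hyperplane acts semiregularly off the line of a
vector that it fixes. -/
theorem card_stabilizer_dvd (h3 : finrank F K = 3)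
    (hT : ∀ φ c, MemT H φ c → φ = 0 ∨ c = 0) :
    Nat.card {g : K ≃ₗ[F] K // g ∈ H ∧ g 1 = 1} ∣ Nat.card K - Nat.card F := by
  classical
  have : FiniteDimensional F K := Module.finite_of_finrank_pos (by omega)
  let H₁ : Subgroup (K ≃ₗ[F] K) := H ⊓ MulAction.stabilizer (K ≃ₗ[F] K) (1 : K)
  let X : SubMulAction H₁ K :=
    { carrier := {x | x ∉ (algebraMap F K).range}
      smul_mem' := by
        rintro ⟨h, hH⟩ x hx ⟨a, ha⟩
        have h1 := hH.2
        refine hx ⟨a, ?_⟩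
        change h 1 = 1 at h1
        change algebraMap F K a = h x at ha
        apply h.injective
        rw [← ha, Algebra.algebraMap_eq_smul_one, map_smul, h1] }
  have hfree : ∀ x : X, MulAction.stabilizer H₁ x = ⊥ := by
    rintro ⟨x, hx⟩
    rw [eq_bot_iff]
    rintro ⟨h, hH, h1⟩ hh
    change h 1 = 1 at h1
    have hhx : h x = x := congrArg Subtype.val hh
    have hlt : finrank F (Submodule.span F {1, x}) < finrank F K := by
      rw [h3]
      refine (finrank_span_le_card _).trans_lt ?_
      rw [Set.toFinset_insert, Set.toFinset_singleton]
      exact lt_of_le_of_lt Finset.card_le_two (by norm_num)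
    obtain ⟨v, hv⟩ : ∃ v, v ∉ Submodule.span F {1, x} := by
      by_contra! hcon
      rw [(Submodule.eq_top_iff').2 hcon, finrank_top] at hlt
      exact hlt.false
    obtain ⟨φ, hφ, hφv⟩ := exists_dual_eq_one_of_notMem hv
    have hφ0 : φ ≠ 0 := by
      rintro rfl
      exact zero_ne_one hφv
    have hx1 : x ∉ F ∙ (1 : K) := fun hmem => by
      obtain ⟨a, ha⟩ := Submodule.mem_span_singleton.1 hmem
      exact hx ⟨a, by rw [Algebra.algebraMap_eq_smul_one, ha]⟩
    have hform : ∀ w, h w = w + φ w • (h v - v) := by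
      intro w
      obtain ⟨a, b, hab⟩ := exists_eq_smul_add_smul h3 hφ0 one_ne_zero hx1
        (hφ 1 (Submodule.subset_span (by simp))) (hφ x (Submodule.subset_span (by simp)))
        (v := w - φ w • v) (by rw [map_sub, map_smul, hφv]; simp)
      have h2 : h (w - φ w • v) = w - φ w • v := by
        rw [← hab, map_add, map_smul, map_smul, h1, hhx]
      rw [map_sub, map_smul] at h2
      rw [smul_sub]
      linear_combination h2
    have hc := (hT φ _ ⟨h, hH, hform⟩).resolve_left hφ0
    refine Subgroup.mem_bot.2 (Subtype.ext (LinearEquiv.ext fun w => ?_))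
    change h w = w
    rw [hform w, hc, smul_zero, add_zero]
  have : Finite F := Finite.of_injective _ (algebraMap F K).injective
  have : Finite (K ≃ₗ[F] K) := DFunLike.finite _
  have := Fintype.ofFinite H₁
  have := Fintype.ofFinite X
  have := Fintype.ofFinite (Quotient (MulAction.orbitRel H₁ X))
  have hsum := MulAction.card_eq_sum_card_group_div_card_stabilizer H₁ X
  have hterm : ∀ x : X, Fintype.card (MulAction.stabilizer H₁ x) = 1 := by
    intro x
    rw [← Nat.card_eq_fintype_card, hfree x, Subgroup.card_bot]
  simp only [hterm, Nat.div_one, Finset.sum_const, smul_eq_mul] at hsum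
  have hX : Nat.card X = Nat.card K - Nat.card F := by
    have h1 := Set.ncard_add_ncard_compl (Set.range (algebraMap F K))
    rw [Set.ncard_range_of_injective (algebraMap F K).injective] at h1
    have h2 : Nat.card X = (Set.range (algebraMap F K))ᶜ.ncard := rfl
    omega
  rw [← hX, Nat.card_eq_fintype_card (α := X), hsum]
  exact Dvd.intro_left _ (by rw [← Nat.card_eq_fintype_card (α := H₁)]; rfl)

theorem twisted_arithmetic {q s t e r : ℕ} (hq : 2 ≤ q) (hs : s = e + r * (q ^ 2 + q + 1))
    (hst : s * t = q ^ 3 - q) (he1 : 1 ≤ e) (he3 : e ≤ 3) : r = 0 := by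
  by_contra hr
  have hq3 : q ≤ q ^ 3 := Nat.le_self_pow (by norm_num) q
  have hst' : s * t + q = q ^ 3 := by omega
  have hdvd : q ^ 2 + q + 1 ∣ t * e + (q - 1) := by
    zify [show 1 ≤ q by omega]
    have h1 : (s : ℤ) * t + q = q ^ 3 := by exact_mod_cast hst'
    have h2 : (s : ℤ) = e + r * (q ^ 2 + q + 1) := by exact_mod_cast hs
    refine ⟨(q - 1) - r * t, ?_⟩
    rw [h2] at h1
    linear_combination h1
  have hle := Nat.le_of_dvd (by omega) hdvd
  have hte : q ^ 2 + 2 ≤ t * e := by omega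
  have ht3 : q ^ 2 + 2 ≤ t * 3 := hte.trans (Nat.mul_le_mul_left t he3)
  have hsv : q ^ 2 + q + 2 ≤ s := by
    have : 1 * (q ^ 2 + q + 1) ≤ r * (q ^ 2 + q + 1) := Nat.mul_le_mul_right _ (by omega)
    omega
  have h5 : (q ^ 2 + q + 2) * (q ^ 2 + 2) ≤ 3 * (q ^ 3 - q) := by
    calc _ ≤ s * (t * 3) := Nat.mul_le_mul hsv ht3
      _ = 3 * (q ^ 3 - q) := by rw [← hst]; ring
  have h6 : (q ^ 2 + q + 2) * (q ^ 2 + 2) + 3 * q ≤ 3 * q ^ 3 := by omega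
  nlinarith [sq_nonneg ((q : ℤ) - 1), h6, Nat.zero_le (q ^ 2 * (q - 1) ^ 2),
    mul_nonneg (sq_nonneg (q : ℤ)) (sq_nonneg ((q : ℤ) - 1))]

/-- The orbit count in a group that meets no pointwise stabiliser of a hyperplane. -/
theorem multStab_eq_top_of_mem_of_forall_memT (h3 : finrank F K = 3)
    (hC : ∀ a, unitMul F a ∈ H) (hT : ∀ φ c, MemT H φ c → φ = 0 ∨ c = 0)
    {g : K ≃ₗ[F] K} (hg : g ∈ H) (hg1 : g 1 = 1) : multStab g = ⊤ := by
  classical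
  have : FiniteDimensional F K := Module.finite_of_finrank_pos (by omega)
  have : Finite F := Finite.of_injective _ (algebraMap F K).injective
  have : Finite (K ≃ₗ[F] K) := DFunLike.finite _
  let X := {g : K ≃ₗ[F] K // g ∈ H ∧ g 1 = 1}
  have := Fintype.ofFinite X
  have := Fintype.ofFinite Kˣ
  let _ : MulAction Kˣ X := twistedAction hC
  have hsmul : ∀ (μ : Kˣ) (g : X), (μ • g).1 = twist g.1 μ := fun _ _ => rfl
  have hstab : ∀ (μ : Kˣ) (g : X), μ • g = g ↔ (μ : K) ∈ multStab g.1 := by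
    intro μ g
    have h0 : g.1 μ ≠ 0 := by simp
    rw [Subtype.ext_iff, LinearEquiv.ext_iff, mem_multStab]
    refine forall_congr' fun x => ?_
    rw [hsmul, twist_apply, g.2.2, mul_one, inv_mul_eq_iff_eq_mul₀ h0]
  let Ω := Quotient (MulAction.orbitRel Kˣ X)
  have := Fintype.ofFinite Ω
  have hsum := MulAction.card_eq_sum_card_group_div_card_stabilizer Kˣ X
  set q := Nat.card F with hq
  have hq2 : 2 ≤ q := Finite.one_lt_card
  have hKq : Nat.card K = q ^ 3 := by rw [Module.natCard_eq_pow_finrank (K := F), h3]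
  have hterm : ∀ ω : Ω, Fintype.card Kˣ / Fintype.card (MulAction.stabilizer Kˣ ω.out) =
      if multStab ω.out.1 = ⊤ then 1 else q ^ 2 + q + 1 := by
    intro ω
    have h1 : Fintype.card (MulAction.stabilizer Kˣ ω.out) =
        Nat.card {μ : Kˣ // (μ : K) ∈ multStab ω.out.1} := by
      rw [← Nat.card_eq_fintype_card]
      exact Nat.card_congr (Equiv.subtypeEquivRight fun μ => hstab μ ω.out)
    rw [h1, ← Nat.card_eq_fintype_card]
    split_ifs with h
    · rw [h]
      simp only [Algebra.mem_top]
      rw [Nat.card_congr (Equiv.subtypeUnivEquiv fun _ => trivial)]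
      exact Nat.div_self Nat.card_pos
    · rw [card_units_mem_multStab h3 h, Nat.card_units, hKq, ← hq]
      apply Nat.div_eq_of_eq_mul_left (by omega)
      obtain ⟨k, hk⟩ : ∃ k, q = k + 1 := ⟨q - 1, by omega⟩
      rw [hk, Nat.add_sub_cancel, Nat.sub_eq_iff_eq_add (Nat.one_le_pow' 3 k)]
      ring
  rw [Finset.sum_congr rfl fun ω _ => hterm ω, Finset.sum_ite, Finset.sum_const,
    Finset.sum_const, smul_eq_mul, smul_eq_mul, mul_one] at hsum
  obtain ⟨t, ht⟩ := card_stabilizer_dvd h3 hT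
  rw [← hq, hKq, Nat.card_eq_fintype_card] at ht
  have hfix : ∀ g : X, multStab g.1 = ⊤ → ∀ g' : X, (⟦g⟧ : Ω) = ⟦g'⟧ → g = g' := by
    intro g hg g' h
    obtain ⟨μ, hμ⟩ := (MulAction.orbitRel_apply.1 (Quotient.exact h.symm))
    rw [← hμ]
    exact ((hstab μ g).2 (hg ▸ Algebra.mem_top)).symm
  have hr := twisted_arithmetic hq2 hsum ht.symm ?_ ?_
  · rw [Finset.card_eq_zero, Finset.filter_eq_empty_iff] at hr
    have h1 := not_not.1 (hr (Finset.mem_univ (⟦⟨g, hg, hg1⟩⟧ : Ω)))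
    have h2 := hfix _ h1 ⟨g, hg, hg1⟩ (Quotient.out_eq _)
    rw [h2] at h1
    exact h1
  · rw [Nat.one_le_iff_ne_zero, Finset.card_ne_zero]
    have htop : multStab (1 : K ≃ₗ[F] K) = ⊤ := by
      rw [eq_top_iff]
      intro x _ y
      simp
    refine ⟨⟦⟨1, H.one_mem, rfl⟩⟧, Finset.mem_filter.2 ⟨Finset.mem_univ _, ?_⟩⟩
    rw [← hfix ⟨1, H.one_mem, rfl⟩ htop _ (Quotient.out_eq _).symm]
    exact htop
  · have h1 : Fintype.card (K →ₐ[F] K) ≤ 3 := by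
      rw [← h3]
      exact AlgHom.card_le
    refine le_trans ?_ h1
    rw [← Fintype.card_coe]
    refine Fintype.card_le_of_injective (fun ω => algHomOfMultStab ω.1.out.1
      (Finset.mem_filter.1 ω.2).2) ?_
    intro ω ω' h
    simp only at h
    apply Subtype.ext
    rw [← Quotient.out_eq ω.1, ← Quotient.out_eq ω'.1]
    congr 1
    refine Subtype.ext (LinearEquiv.ext fun x => ?_)
    rw [apply_eq_algHomOfMultStab _ (Finset.mem_filter.1 ω.2).2,
      apply_eq_algHomOfMultStab _ (Finset.mem_filter.1 ω'.2).2, h, ω.1.out.2.2, ω'.1.out.2.2]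

end CubicNormalizer

section CubicCover

open Module

variable {F K : Type*} [Field F] [Field K] [Algebra F K] [Finite K] {H : Subgroup (K ≃ₗ[F] K)}

/-- A proper subgroup containing the multiplications by a cubic field normalises them. -/
theorem multStab_eq_top_of_ne_top (h3 : finrank F K = 3) (hC : ∀ a, unitMul F a ∈ H) (hH : H ≠ ⊤)
    {g : K ≃ₗ[F] K} (hg : g ∈ H) : multStab g = ⊤ := by
  have hg1 : g 1 ≠ 0 := by simp
  have happ : ∀ x, (unitMul F (Units.mk0 (g 1) hg1)⁻¹ * g) x = (g 1)⁻¹ * g x := fun x => rfl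
  have h := multStab_eq_top_of_mem_of_forall_memT h3 hC (fun φ c hφc => by
    by_contra! hne
    exact hH (eq_top_of_memT_of_cubic h3 hC hne.1 hne.2 hφc))
    (H.mul_mem (hC (Units.mk0 (g 1) hg1)⁻¹) hg) (by rw [happ, inv_mul_cancel₀ hg1])
  rw [eq_top_iff]
  intro x _ y
  have hx : x ∈ multStab (unitMul F (Units.mk0 (g 1) hg1)⁻¹ * g) := h ▸ Algebra.mem_top
  have := hx y
  rw [happ, happ, happ, happ] at this
  field_simp at this
  exact (mul_comm _ _).trans this

theorem exists_pow_three_eq_unitMul (h3 : finrank F K = 3) {h : K ≃ₗ[F] K}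
    (hh : multStab h = ⊤) : ∃ b, h ^ 3 = unitMul F b := by
  have : FiniteDimensional F K := Module.finite_of_finrank_pos (by omega)
  have : Finite F := Finite.of_injective _ (algebraMap F K).injective
  have h1 : h 1 ≠ 0 := by simp
  set σ := algHomOfMultStab h hh
  have hσ : ∀ x, σ (σ (σ x)) = x := by
    intro x
    have hcard : ((algEquivEquivAlgHom F K).symm σ) ^ 3 = 1 := by
      rw [← h3, ← IsGalois.card_aut_eq_finrank]
      exact pow_card_eq_one'
    exact DFunLike.congr_fun hcard x
  have happ : ∀ x, h x = h 1 * σ x := apply_eq_algHomOfMultStab h hh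
  refine ⟨Units.mk0 (h 1 * σ (h 1) * σ (σ (h 1))) (by simp [h1]), LinearEquiv.ext fun x => ?_⟩
  rw [unitMul_apply, Units.val_mk0]
  change h (h (h x)) = _
  rw [happ (h (h x)), happ (h x), happ x, map_mul, map_mul, map_mul, hσ]
  ring

theorem card_conj_mem_le (h3 : finrank F K = 3) {γ : Kˣ} (hγ : ∀ x, x ∈ Subgroup.zpowers γ)
    (hH : H ≠ ⊤) :
    Nat.card {g : K ≃ₗ[F] K // g * unitMul F γ * g⁻¹ ∈ H} ≤ (Nat.card K - 1) * 3 := by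
  have : FiniteDimensional F K := Module.finite_of_finrank_pos (by omega)
  have : Finite F := Finite.of_injective _ (algebraMap F K).injective
  have : Finite (K ≃ₗ[F] K) := DFunLike.finite _
  rcases isEmpty_or_nonempty {g : K ≃ₗ[F] K // g * unitMul F γ * g⁻¹ ∈ H} with hempty | ⟨⟨k, hk⟩⟩
  · rw [Nat.card_of_isEmpty]
    exact Nat.zero_le _
  refine le_trans ?_ (card_multStab_le (F := F) h3)
  let H' : Subgroup (K ≃ₗ[F] K) := H.comap (MulAut.conj k).toMonoidHom
  have hmem : ∀ g, g ∈ H' ↔ k * g * k⁻¹ ∈ H := fun g => Iff.rfl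
  have hH' : H' ≠ ⊤ := by
    intro h
    apply hH
    rw [eq_top_iff]
    intro g _
    have : k⁻¹ * g * k ∈ H' := h ▸ Subgroup.mem_top _
    rw [hmem] at this
    convert this using 1
    group
  have hC : ∀ a, unitMul F a ∈ H' := by
    intro a
    obtain ⟨n, rfl⟩ := hγ a
    simp only [map_zpow]
    exact H'.zpow_mem ((hmem _).2 hk) n
  have hγF : (γ : K) ^ 3 ∉ (algebraMap F K).range := by
    rintro ⟨a, ha⟩
    have ha0 : a ≠ 0 := by
      rintro rfl
      rw [map_zero] at ha
      exact pow_ne_zero 3 γ.ne_zero ha.symm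
    have := Fintype.ofFinite F
    have h1 : γ ^ (3 * (Fintype.card F - 1)) = 1 := by
      ext
      rw [pow_mul, Units.val_pow_eq_pow_val, Units.val_pow_eq_pow_val, ← ha, ← map_pow,
        FiniteField.pow_card_sub_one_eq_one a ha0, map_one, Units.val_one]
    have hq : 2 ≤ Fintype.card F := Fintype.one_lt_card
    have h2 := Nat.le_of_dvd (by omega) (orderOf_dvd_of_pow_eq_one h1)
    rw [orderOf_eq_card_of_forall_mem_zpowers hγ, Nat.card_units,
      Module.natCard_eq_pow_finrank (K := F), h3, Nat.card_eq_fintype_card] at h2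
    have h4 : Fintype.card F ^ 3 ≤ 3 * Fintype.card F := by omega
    have h5 : 2 ^ 2 * Fintype.card F ≤ Fintype.card F ^ 2 * Fintype.card F :=
      Nat.mul_le_mul_right _ (Nat.pow_le_pow_left hq 2)
    rw [← pow_succ, show 2 + 1 = 3 from rfl] at h5
    omega
  refine Nat.card_le_card_of_injective (fun g => ⟨k⁻¹ * g.1, ?_⟩) ?_
  · have hg : (k⁻¹ * g.1) * unitMul F γ * (k⁻¹ * g.1)⁻¹ ∈ H' := by
      rw [hmem]
      convert g.2 using 1
      group
    set x := k⁻¹ * g.1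
    obtain ⟨b, hb⟩ := exists_pow_three_eq_unitMul h3 (multStab_eq_top_of_ne_top h3 hC hH' hg)
    rw [conj_pow, ← map_pow, mul_inv_eq_iff_eq_mul] at hb
    have hxb : ∀ y, x ((γ : K) ^ 3 * y) = b * x y := fun y => DFunLike.congr_fun hb y
    refine multStab_eq_top_of_mem h3 hγF fun y => ?_
    have h2 := hxb 1
    rw [mul_one] at h2
    rw [hxb, h2]
    ring
  · intro g g' h
    exact Subtype.ext (mul_left_cancel (Subtype.mk.inj h))

theorem coverBound_of_cubic (h3 : finrank F K = 3) {t : ℕ}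
    (ht : (Nat.card K - 1) * 3 * t ≤ Nat.card (K ≃ₗ[F] K)) : CoverBound (K ≃ₗ[F] K) t := by
  have : FiniteDimensional F K := Module.finite_of_finrank_pos (by omega)
  have : Finite F := Finite.of_injective _ (algebraMap F K).injective
  have : Finite (K ≃ₗ[F] K) := DFunLike.finite _
  have := Fintype.ofFinite (K ≃ₗ[F] K)
  obtain ⟨γ, hγ⟩ := IsCyclic.exists_generator (α := Kˣ)
  intro S hS
  refine le_card_of_proportion S (fun H g => g * unitMul F γ * g⁻¹ ∈ H) (fun g => hS.2 _)
    fun H hH => ?_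
  rw [← Nat.card_eq_fintype_card]
  exact (Nat.mul_le_mul_right t (card_conj_mem_le h3 hγ (hS.1 H hH))).trans ht

end CubicCover

/-! ### Covering a class of block diagonal automorphisms -/

section TwoSubspaces

open Module

variable {F V : Type*} [Field F] [AddCommGroup V] [Module F V]

theorem exists_dual_add_of_inf_le {Y Y' : Submodule F V} {φ : Dual F V}
    (h : ∀ x ∈ Y ⊓ Y', φ x = 0) :
    ∃ φ₁ φ₂ : Dual F V, (∀ y ∈ Y, φ₁ y = 0) ∧ (∀ y ∈ Y', φ₂ y = 0) ∧ φ₁ + φ₂ = φ := by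
  have : φ ∈ (Y ⊓ Y').dualAnnihilator := (Submodule.mem_dualAnnihilator φ).2 h
  rw [Subspace.dualAnnihilator_inf_eq, Submodule.mem_sup] at this
  obtain ⟨φ₁, h₁, φ₂, h₂, h₃⟩ := this
  exact ⟨φ₁, φ₂, (Submodule.mem_dualAnnihilator φ₁).1 h₁, (Submodule.mem_dualAnnihilator φ₂).1 h₂,
    h₃⟩

variable [FiniteDimensional F V] {H : Subgroup (V ≃ₗ[F] V)}

/-- If `H` contains the unipotent radicals attached to two distinct planes, then some vector is
the centre of all transvections in `H` that it could be the centre of. -/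
theorem exists_center_of_two_planes {Y Y' : Submodule F V} (hYr : finrank F Y = 2)
    (hYr' : finrank F Y' = 2) (hne : Y ≠ Y')
    (hY : ∀ c ∈ Y, ∀ φ : Dual F V, (∀ y ∈ Y, φ y = 0) → MemT H φ c)
    (hY' : ∀ c ∈ Y', ∀ φ : Dual F V, (∀ y ∈ Y', φ y = 0) → MemT H φ c) :
    ∃ c ≠ 0, ∀ φ : Dual F V, φ c = 0 → MemT H φ c := by
  by_cases hinf : Y ⊓ Y' = ⊥
  · obtain ⟨c, hc, hc0⟩ := Y.exists_mem_ne_zero_of_ne_bot (by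
      rintro rfl; rw [finrank_bot] at hYr; omega)
    obtain ⟨c', hc', hc0'⟩ := Y'.exists_mem_ne_zero_of_ne_bot (by
      rintro rfl; rw [finrank_bot] at hYr'; omega)
    have hcY' : c ∉ Y' := fun h => hc0 (by
      have : c ∈ Y ⊓ Y' := ⟨hc, h⟩
      rwa [hinf, Submodule.mem_bot] at this)
    have hcc0 : c' + c ≠ 0 := fun h => hcY' (by
      rw [eq_neg_of_add_eq_zero_right h]; exact Y'.neg_mem hc')
    have hmain : ∀ ψ : Dual F V, ψ (c' + c) = 0 → ψ c ≠ 0 → MemT H ψ (c' + c) := by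
      intro ψ hψ hs
      obtain ⟨φ, φ', hφ, hφ', rfl⟩ := exists_dual_add_of_inf_le (Y := Y) (Y' := Y') (φ := ψ)
        (by rw [hinf]; rintro x hx; rw [(Submodule.mem_bot F).1 hx, map_zero])
      rw [LinearMap.add_apply, hφ c hc, zero_add] at hs
      rw [LinearMap.add_apply, map_add, map_add, hφ c hc, hφ' c' hc', add_zero, zero_add] at hψ
      have h1 := (hY c hc (-(φ' c)⁻¹ • φ) (fun y hy => by simp [hφ y hy])).conj_MemT
        (by simp [hφ c hc]) (hY' c' hc' φ' hφ')
      convert h1 using 1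
      · rw [smul_smul, mul_neg, mul_inv_cancel₀ hs, neg_one_smul, sub_neg_eq_add, add_comm]
      · rw [LinearMap.smul_apply, smul_eq_mul, eq_neg_of_add_eq_zero_left hψ, neg_mul_neg,
          inv_mul_cancel₀ hs, one_smul]
    refine ⟨c' + c, hcc0, fun ψ hψ => ?_⟩
    by_cases hs : ψ c = 0
    · obtain ⟨χ, hχ, hχc⟩ := exists_dual_eq_one_of_notMem (U := F ∙ (c' + c)) (x := c) (by
        intro hmem
        obtain ⟨a, ha⟩ := Submodule.mem_span_singleton.1 hmem
        have h2 : a • c' = (1 - a) • c := by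
          rw [sub_smul, one_smul, eq_sub_iff_add_eq, ← smul_add, ha]
        have h3 : a • c' ∈ Y ⊓ Y' := ⟨h2 ▸ Y.smul_mem _ hc, Y'.smul_mem _ hc'⟩
        rw [hinf, Submodule.mem_bot, smul_eq_zero] at h3
        rw [h3.resolve_right hc0', zero_smul] at ha
        exact hc0 ha.symm)
      have hχ0 := hχ _ (Submodule.mem_span_singleton_self _)
      have h1 := hmain (ψ + χ) (by rw [LinearMap.add_apply, hψ, hχ0, add_zero])
        (by rw [LinearMap.add_apply, hs, hχc, zero_add]; exact one_ne_zero)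
      have h2 := hmain (-χ) (by rw [LinearMap.neg_apply, hχ0, neg_zero])
        (by rw [LinearMap.neg_apply, hχc]; exact neg_ne_zero.2 one_ne_zero)
      have h3 := h1.add_left h2 (by simp [hψ, hχ0])
      rwa [add_neg_cancel_right] at h3
    · exact hmain ψ hψ hs
  · obtain ⟨c, hc, hc0⟩ := (Y ⊓ Y').exists_mem_ne_zero_of_ne_bot hinf
    refine ⟨c, hc0, fun φ hφ => ?_⟩
    have hle : Y ⊓ Y' ≤ F ∙ c := by
      have hlt : finrank F ↥(Y ⊓ Y') < 2 := by
        by_contra! h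
        apply hne
        have h1 : Y ⊓ Y' = Y := Submodule.eq_of_le_of_finrank_le inf_le_left (by omega)
        have h2 : Y ⊓ Y' = Y' := Submodule.eq_of_le_of_finrank_le inf_le_right (by omega)
        rw [← h1, h2]
      have hspan : F ∙ c ≤ Y ⊓ Y' := (Submodule.span_singleton_le_iff_mem _ _).2 hc
      exact (Submodule.eq_of_le_of_finrank_le hspan (by
        rw [finrank_span_singleton hc0]; omega)).ge
    obtain ⟨φ₁, φ₂, h₁, h₂, rfl⟩ := exists_dual_add_of_inf_le (Y := Y) (Y' := Y') (φ := φ)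
      (fun x hx => by
        obtain ⟨a, rfl⟩ := Submodule.mem_span_singleton.1 (hle hx)
        rw [map_smul, hφ, smul_zero])
    exact (hY c hc.1 φ₁ h₁).add_left (hY' c hc.2 φ₂ h₂) (h₁ c hc.1)

end TwoSubspaces

section Block

open Module

variable {F E K : Type*} [Field F] [AddCommGroup E] [AddCommGroup K] [Module F E] [Module F K]

/-- The unipotent automorphism `(e, y) ↦ (e + φ y, y)`. -/
def upper (φ : K →ₗ[F] E) : (E × K) ≃ₗ[F] (E × K) where
  toFun v := (v.1 + φ v.2, v.2)
  map_add' v w := by ext <;> simp; abel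
  map_smul' a v := by ext <;> simp
  invFun v := (v.1 - φ v.2, v.2)
  left_inv v := by simp
  right_inv v := by simp

/-- The unipotent automorphism `(e, y) ↦ (e, y + f e)`. -/
def lower (f : E →ₗ[F] K) : (E × K) ≃ₗ[F] (E × K) where
  toFun v := (v.1, v.2 + f v.1)
  map_add' v w := by ext <;> simp; abel
  map_smul' a v := by ext <;> simp
  invFun v := (v.1, v.2 - f v.1)
  left_inv v := by simp
  right_inv v := by simp

@[simp] theorem upper_apply (φ : K →ₗ[F] E) (v : E × K) : upper φ v = (v.1 + φ v.2, v.2) := rfl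

@[simp] theorem lower_apply (f : E →ₗ[F] K) (v : E × K) : lower f v = (v.1, v.2 + f v.1) := rfl

theorem upper_add (φ ψ : K →ₗ[F] E) : upper (φ + ψ) = upper φ * upper ψ := by
  ext v <;> simp [add_comm, add_left_comm]

theorem upper_zero : upper (0 : K →ₗ[F] E) = 1 := by
  ext v <;> simp

theorem upper_neg (φ : K →ₗ[F] E) : upper (-φ) = (upper φ)⁻¹ := by
  rw [eq_inv_iff_mul_eq_one, ← upper_add, neg_add_cancel, upper_zero]

/-- The block diagonal automorphism with blocks `a` and `b`. -/
abbrev diag (a : E ≃ₗ[F] E) (b : K ≃ₗ[F] K) : (E × K) ≃ₗ[F] (E × K) := a.prodCongr b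

/-- The conjugation action of `diag a b` on the unipotent radical. -/
def twistHom (a : E ≃ₗ[F] E) (b : K ≃ₗ[F] K) (ψ : K →ₗ[F] E) : K →ₗ[F] E :=
  a.toLinearMap ∘ₗ ψ ∘ₗ b.symm.toLinearMap

theorem twistHom_add (a : E ≃ₗ[F] E) (b : K ≃ₗ[F] K) (φ ψ : K →ₗ[F] E) :
    twistHom a b (φ + ψ) = twistHom a b φ + twistHom a b ψ := by
  ext; simp [twistHom]

theorem twistHom_sub (a : E ≃ₗ[F] E) (b : K ≃ₗ[F] K) (φ ψ : K →ₗ[F] E) :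
    twistHom a b (φ - ψ) = twistHom a b φ - twistHom a b ψ := by
  ext; simp [twistHom]

theorem diag_mul_upper (a : E ≃ₗ[F] E) (b : K ≃ₗ[F] K) (ψ : K →ₗ[F] E) :
    diag a b * upper ψ = upper (twistHom a b ψ) * diag a b := by
  ext v <;> simp [twistHom]

/-- The graph of `f`, as the image of the first factor under `lower f`. -/
def plane (f : E →ₗ[F] K) : Submodule F (E × K) :=
  LinearMap.range ((lower f).toLinearMap ∘ₗ LinearMap.inl F E K)

theorem mem_plane {f : E →ₗ[F] K} {v : E × K} : v ∈ plane f ↔ ∃ e, lower f (e, 0) = v := Iff.rfl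

theorem plane_injective : Function.Injective (plane : (E →ₗ[F] K) → Submodule F (E × K)) := by
  intro f f' h
  ext e
  have h1 : (e, f e) ∈ plane f' := by
    rw [← h, mem_plane]; exact ⟨e, by simp⟩
  obtain ⟨e', he'⟩ := mem_plane.1 h1
  simp only [lower_apply, zero_add, Prod.mk.injEq] at he'
  rw [← he'.2, he'.1]

theorem finrank_plane (f : E →ₗ[F] K) : finrank F (plane f) = finrank F E :=
  LinearMap.finrank_range_of_inj
    ((lower f).injective.comp (LinearMap.inl_injective (R := F) (M := E) (M₂ := K)))

variable {H : Subgroup ((E × K) ≃ₗ[F] (E × K))} {f : E →ₗ[F] K}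

theorem memT_of_conj_upper_mem (h : ∀ ψ, lower f * upper ψ * (lower f)⁻¹ ∈ H) (c : E × K)
    (hc : c ∈ plane f) (φ : Dual F (E × K)) (hφ : ∀ y ∈ plane f, φ y = 0) : MemT H φ c := by
  obtain ⟨e, rfl⟩ := mem_plane.1 hc
  refine ⟨_, h ((φ ∘ₗ (lower f).toLinearMap ∘ₗ LinearMap.inr F E K).smulRight e), fun x => ?_⟩
  obtain ⟨v, rfl⟩ := (lower f).surjective x
  have h1 : (lower f)⁻¹ (lower f v) = v := inv_apply_of_eq rfl
  have h2 : φ (lower f v) = φ (lower f (0, v.2)) := by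
    have : lower f v = lower f (v.1, 0) + lower f (0, v.2) := by rw [← map_add]; simp
    rw [this, map_add, hφ _ (mem_plane.2 ⟨_, rfl⟩), zero_add]
  rw [LinearEquiv.mul_apply, LinearEquiv.mul_apply, h1, h2, ← map_smul, ← map_add]
  congr 1
  ext <;> simp

/-- Only the obvious subspaces are invariant under the block triangular group with irreducible
blocks. -/
theorem eq_bot_or_eq_range_inl_or_eq_top {a : E ≃ₗ[F] E} {b : K ≃ₗ[F] K}
    (ha : ∀ U : Submodule F E, (∀ x ∈ U, a x ∈ U) → U = ⊥ ∨ U = ⊤)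
    (hb : ∀ U : Submodule F K, (∀ x ∈ U, b x ∈ U) → U = ⊥ ∨ U = ⊤)
    {X : Submodule F (E × K)} (hX : ∀ ψ : K →ₗ[F] E, ∀ x ∈ X, upper ψ x ∈ X)
    (hX' : ∀ x ∈ X, diag a b x ∈ X) :
    X = ⊥ ∨ X = LinearMap.range (LinearMap.inl F E K) ∨ X = ⊤ := by
  by_cases hle : X ≤ LinearMap.range (LinearMap.inl F E K)
  · rcases ha (X.comap (LinearMap.inl F E K)) (fun x hx => by
      have := hX' _ hx
      simpa using this) with h | h
    · left
      rw [eq_bot_iff]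
      intro v hv
      obtain ⟨e, rfl⟩ := hle hv
      have : e ∈ X.comap (LinearMap.inl F E K) := hv
      rw [h, Submodule.mem_bot] at this
      rw [this, map_zero]
      exact zero_mem _
    · right; left
      refine le_antisymm hle ?_
      rintro _ ⟨e, rfl⟩
      have : e ∈ X.comap (LinearMap.inl F E K) := h ▸ Submodule.mem_top
      exact this
  · right; right
    obtain ⟨v, hv, hv'⟩ := SetLike.not_le_iff_exists.1 hle
    have hv2 : v.2 ≠ 0 := fun h => hv' ⟨v.1, by rw [LinearMap.inl_apply, ← h]⟩
    obtain ⟨φ, -, hφ⟩ := exists_dual_eq_one_of_notMem (U := (⊥ : Submodule F K)) (x := v.2)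
      (by simpa using hv2)
    have hE : ∀ e : E, (e, (0 : K)) ∈ X := by
      intro e
      have := X.sub_mem (hX (φ.smulRight e) v hv) hv
      simpa [Prod.sub_def, hφ] using this
    have hK : ∀ {w : E × K}, w ∈ X → (0, w.2) ∈ X := by
      intro w hw
      have := X.sub_mem hw (hE w.1)
      simpa [Prod.sub_def] using this
    rcases hb (X.comap (LinearMap.inr F E K)) (fun x hx => by
      have := hX' _ hx
      simpa using this) with h | h
    · have : v.2 ∈ X.comap (LinearMap.inr F E K) := hK hv
      rw [h, Submodule.mem_bot] at this
      exact absurd this hv2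
    · rw [eq_top_iff]
      intro w _
      have h1 : w.2 ∈ X.comap (LinearMap.inr F E K) := h ▸ Submodule.mem_top
      have := X.add_mem (hE w.1) h1
      simpa using this

theorem eq_bot_or_eq_plane_or_eq_top {a : E ≃ₗ[F] E} {b : K ≃ₗ[F] K}
    (ha : ∀ U : Submodule F E, (∀ x ∈ U, a x ∈ U) → U = ⊥ ∨ U = ⊤)
    (hb : ∀ U : Submodule F K, (∀ x ∈ U, b x ∈ U) → U = ⊥ ∨ U = ⊤)
    (hu : ∀ ψ, lower f * upper ψ * (lower f)⁻¹ ∈ H) (hd : lower f * diag a b * (lower f)⁻¹ ∈ H)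
    {X : Submodule F (E × K)} (hX : ∀ h ∈ H, ∀ x ∈ X, h x ∈ X) :
    X = ⊥ ∨ X = plane f ∨ X = ⊤ := by
  have hconj : ∀ g, lower f * g * (lower f)⁻¹ ∈ H →
      ∀ x ∈ X.comap (lower f).toLinearMap, g x ∈ X.comap (lower f).toLinearMap := by
    intro g hg x hx
    have := hX _ hg _ hx
    rw [LinearEquiv.mul_apply, LinearEquiv.mul_apply] at this
    have h1 : (lower f)⁻¹ (lower f x) = x := inv_apply_of_eq rfl
    rw [LinearEquiv.coe_coe, h1] at this
    exact this
  have hmap : X = (X.comap (lower f).toLinearMap).map (lower f).toLinearMap :=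
    (Submodule.map_comap_eq_of_surjective (lower f).surjective X).symm
  rw [hmap]
  rcases eq_bot_or_eq_range_inl_or_eq_top ha hb (fun ψ => hconj _ (hu ψ)) (hconj _ hd) with
    h | h | h
  · left; rw [h, Submodule.map_bot]
  · right; left; rw [h, ← LinearMap.range_comp]; rfl
  · right; right; rw [h, Submodule.map_top]; exact LinearMap.range_eq_top.2 (lower f).surjective

theorem det_conj_diag [FiniteDimensional F E] [FiniteDimensional F K]
    (g : (E × K) ≃ₗ[F] (E × K)) (a : E ≃ₗ[F] E) (b : K ≃ₗ[F] K) :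
    LinearEquiv.det (g * diag a b * g⁻¹) = LinearEquiv.det a * LinearEquiv.det b := by
  rw [map_mul, map_mul, map_inv, mul_right_comm, mul_inv_cancel, one_mul]
  ext
  rw [Units.val_mul, LinearEquiv.coe_det, LinearEquiv.coe_det, LinearEquiv.coe_det,
    ← LinearMap.det_prodMap]
  rfl

/-- A subgroup containing the full block triangular data for two different complements is
everything. -/
theorem eq_top_of_two_planes [FiniteDimensional F K] (hE : finrank F E = 2)
    {a a' : E ≃ₗ[F] E} {b b' : K ≃ₗ[F] K} {f' : E →ₗ[F] K}
    (ha : ∀ U : Submodule F E, (∀ x ∈ U, a x ∈ U) → U = ⊥ ∨ U = ⊤)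
    (hb : ∀ U : Submodule F K, (∀ x ∈ U, b x ∈ U) → U = ⊥ ∨ U = ⊤)
    (ha' : ∀ U : Submodule F E, (∀ x ∈ U, a' x ∈ U) → U = ⊥ ∨ U = ⊤)
    (hb' : ∀ U : Submodule F K, (∀ x ∈ U, b' x ∈ U) → U = ⊥ ∨ U = ⊤)
    (hdet : ∀ u : Fˣ, u ∈ Subgroup.zpowers (LinearEquiv.det a * LinearEquiv.det b))
    (hff : f ≠ f')
    (hu : ∀ ψ, lower f * upper ψ * (lower f)⁻¹ ∈ H) (hd : lower f * diag a b * (lower f)⁻¹ ∈ H)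
    (hu' : ∀ ψ, lower f' * upper ψ * (lower f')⁻¹ ∈ H)
    (hd' : lower f' * diag a' b' * (lower f')⁻¹ ∈ H) : H = ⊤ := by
  have : FiniteDimensional F E := Module.finite_of_finrank_pos (by omega)
  have hpl : plane f ≠ plane f' := fun h => hff (plane_injective h)
  obtain ⟨c, hc0, hc⟩ := exists_center_of_two_planes ((finrank_plane f).trans hE)
    ((finrank_plane f').trans hE) hpl (memT_of_conj_upper_mem hu) (memT_of_conj_upper_mem hu')
  refine eq_top_of_transvections (memT_of_irreducible (fun X hX => ?_) hc0 hc) fun u => ?_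
  · rcases eq_bot_or_eq_plane_or_eq_top ha hb hu hd hX with h | h | h
    · exact Or.inl h
    · rcases eq_bot_or_eq_plane_or_eq_top ha' hb' hu' hd' hX with h' | h' | h'
      · exact Or.inl h'
      · exact absurd (h.symm.trans h') hpl
      · exact Or.inr h'
    · exact Or.inr h
  · obtain ⟨m, hm⟩ := hdet u
    refine ⟨_, H.zpow_mem hd m, ?_⟩
    rw [map_zpow, det_conj_diag]
    exact hm

end Block

section BlockCover

open Module

variable {F E K : Type*} [Field F] [AddCommGroup E] [AddCommGroup K] [Module F E] [Module F K]

theorem conj_upper_diag (a : E ≃ₗ[F] E) (b : K ≃ₗ[F] K) (φ : K →ₗ[F] E) :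
    upper φ * diag a b * (upper φ)⁻¹ = upper (φ - twistHom a b φ) * diag a b := by
  rw [mul_inv_eq_iff_eq_mul, mul_assoc, diag_mul_upper, ← mul_assoc, ← upper_add, sub_add_cancel]

/-- The unipotent elements whose conjugate by `lower f` lies in `H`. -/
def upperPart (H : Subgroup ((E × K) ≃ₗ[F] (E × K))) (f : E →ₗ[F] K) :
    AddSubgroup (K →ₗ[F] E) where
  carrier := {ψ | lower f * upper ψ * (lower f)⁻¹ ∈ H}
  zero_mem' := by
    change lower f * upper 0 * (lower f)⁻¹ ∈ H
    rw [upper_zero, mul_one, mul_inv_cancel]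
    exact H.one_mem
  add_mem' {φ ψ} hφ hψ := by
    change lower f * upper (φ + ψ) * (lower f)⁻¹ ∈ H
    rw [upper_add, ← conj_mul]
    exact H.mul_mem hφ hψ
  neg_mem' {φ} hφ := by
    change lower f * upper (-φ) * (lower f)⁻¹ ∈ H
    rw [upper_neg, ← conj_inv]
    exact H.inv_mem hφ

theorem mem_upperPart {H : Subgroup ((E × K) ≃ₗ[F] (E × K))} {f : E →ₗ[F] K} {ψ : K →ₗ[F] E} :
    ψ ∈ upperPart H f ↔ lower f * upper ψ * (lower f)⁻¹ ∈ H := Iff.rfl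

variable {H : Subgroup ((E × K) ≃ₗ[F] (E × K))} {f : E →ₗ[F] K} {a : E ≃ₗ[F] E} {b : K ≃ₗ[F] K}

theorem twistHom_mem_upperPart {φ ψ : K →ₗ[F] E}
    (hφ : lower f * (upper φ * diag a b * (upper φ)⁻¹) * (lower f)⁻¹ ∈ H)
    (hψ : ψ ∈ upperPart H f) : twistHom a b ψ ∈ upperPart H f := by
  have h1 := H.mul_mem (H.mul_mem hφ hψ) (H.inv_mem hφ)
  rw [conj_inv, conj_mul, conj_mul] at h1
  rw [mem_upperPart]
  convert h1 using 3
  rw [eq_mul_inv_iff_mul_eq, conj_upper_diag, mul_assoc, diag_mul_upper, ← mul_assoc, ← mul_assoc,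
    ← upper_add, ← upper_add, add_comm]

theorem sub_twistHom_mem_upperPart {φ φ' : K →ₗ[F] E}
    (hφ : lower f * (upper φ * diag a b * (upper φ)⁻¹) * (lower f)⁻¹ ∈ H)
    (hφ' : lower f * (upper φ' * diag a b * (upper φ')⁻¹) * (lower f)⁻¹ ∈ H) :
    (φ' - φ) - twistHom a b (φ' - φ) ∈ upperPart H f := by
  have h1 := H.mul_mem hφ' (H.inv_mem hφ)
  rw [conj_inv, conj_mul] at h1
  rw [mem_upperPart]
  convert h1 using 3
  rw [eq_mul_inv_iff_mul_eq, conj_upper_diag, conj_upper_diag, ← mul_assoc, ← upper_add,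
    twistHom_sub]
  congr 2
  abel

theorem diag_conj_mem_of_upperPart_eq_top {φ : K →ₗ[F] E}
    (hφ : lower f * (upper φ * diag a b * (upper φ)⁻¹) * (lower f)⁻¹ ∈ H)
    (h : upperPart H f = ⊤) : lower f * diag a b * (lower f)⁻¹ ∈ H := by
  rw [conj_upper_diag, ← conj_mul] at hφ
  have h1 : φ - twistHom a b φ ∈ upperPart H f := h ▸ AddSubgroup.mem_top _
  exact (H.mul_mem_cancel_left h1).1 hφ

/-- Subgroups covering the conjugates of sufficiently many block diagonal automorphisms with
irreducible blocks. -/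
theorem le_card_of_cover_diag [Finite F] [FiniteDimensional F K] (hE : finrank F E = 2)
    {I : Type*} [Fintype I] [Nonempty I] (a : I → E ≃ₗ[F] E) (b : I → K ≃ₗ[F] K)
    (ha : ∀ i, ∀ U : Submodule F E, (∀ x ∈ U, a i x ∈ U) → U = ⊥ ∨ U = ⊤)
    (hb : ∀ i, ∀ U : Submodule F K, (∀ x ∈ U, b i x ∈ U) → U = ⊥ ∨ U = ⊤)
    (hab : ∀ i ψ, twistHom (a i) (b i) ψ = ψ → ψ = 0)
    (hdet : ∀ i, ∀ u : Fˣ, u ∈ Subgroup.zpowers (LinearEquiv.det (a i) * LinearEquiv.det (b i)))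
    {T : ℕ} (hT : T ≤ Nat.card (K →ₗ[F] E))
    (hB : ∀ B : AddSubgroup (K →ₗ[F] E), B ≠ ⊥ → B ≠ ⊤ →
      Nat.card {i // ∀ ψ ∈ B, twistHom (a i) (b i) ψ ∈ B} * Nat.card B * T ≤
        Fintype.card I * Nat.card (K →ₗ[F] E))
    (S : Finset (Subgroup ((E × K) ≃ₗ[F] (E × K)))) (hS : ∀ H ∈ S, H ≠ ⊤)
    (hcov : ∀ i g, ∃ H ∈ S, g * diag (a i) (b i) * g⁻¹ ∈ H) : T ≤ S.card := by
  have : FiniteDimensional F E := Module.finite_of_finrank_pos (by omega)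
  have : Finite E := Module.finite_of_finite F
  have : Finite K := Module.finite_of_finite F
  have : Finite (K →ₗ[F] E) := DFunLike.finite _
  have : Finite (E →ₗ[F] K) := DFunLike.finite _
  have := Fintype.ofFinite (K →ₗ[F] E)
  by_cases hgood : ∀ f : E →ₗ[F] K, ∃ H ∈ S, upperPart H f = ⊤ ∧
      ∃ i, lower f * diag (a i) (b i) * (lower f)⁻¹ ∈ H
  · choose Φ hΦS hΦu hΦi using hgood
    have hinj : Function.Injective fun f => (⟨Φ f, hΦS f⟩ : S) := by
      intro f f' h
      by_contra hne
      have h' : Φ f = Φ f' := Subtype.mk.inj h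
      obtain ⟨i, hi⟩ := hΦi f
      obtain ⟨j, hj⟩ := hΦi f'
      have hu' := hΦu f'
      rw [← h'] at hj hu'
      exact hS _ (hΦS f) (eq_top_of_two_planes hE (ha i) (hb i) (ha j) (hb j) (hdet i) hne
        (fun ψ => mem_upperPart.1 (hΦu f ▸ AddSubgroup.mem_top ψ)) hi
        (fun ψ => mem_upperPart.1 (hu' ▸ AddSubgroup.mem_top ψ)) hj)
    have h1 := Nat.card_le_card_of_injective _ hinj
    rw [Nat.card_eq_fintype_card (α := S), Fintype.card_coe] at h1
    refine hT.trans (le_trans (le_of_eq ?_) h1)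
    rw [Module.natCard_eq_pow_finrank (K := F) (V := K →ₗ[F] E),
      Module.natCard_eq_pow_finrank (K := F) (V := E →ₗ[F] K),
      finrank_linearMap, finrank_linearMap, mul_comm]
  · push Not at hgood
    obtain ⟨f, hf⟩ := hgood
    refine le_card_of_proportion (ι := I × (K →ₗ[F] E)) S
      (fun H p => lower f * (upper p.2 * diag (a p.1) (b p.1) * (upper p.2)⁻¹) * (lower f)⁻¹ ∈ H)
      (fun p => ?_) fun H hH => ?_
    · obtain ⟨H, hH, h⟩ := hcov p.1 (lower f * upper p.2)
      refine ⟨H, hH, ?_⟩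
      convert h using 1
      group
    rw [Fintype.card_prod, ← Nat.card_eq_fintype_card (α := K →ₗ[F] E)]
    set P : I × (K →ₗ[F] E) → Prop := fun p =>
      lower f * (upper p.2 * diag (a p.1) (b p.1) * (upper p.2)⁻¹) * (lower f)⁻¹ ∈ H with hP
    change Nat.card {p // P p} * T ≤ _
    by_cases htop : upperPart H f = ⊤
    · have : IsEmpty {p // P p} := ⟨fun p =>
        hf H hH htop p.1.1 (diag_conj_mem_of_upperPart_eq_top p.2 htop)⟩
      rw [Nat.card_of_isEmpty, zero_mul]
      exact Nat.zero_le _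
    have hcard : Nat.card {p // P p} ≤
        Nat.card {i // ∀ ψ ∈ upperPart H f, twistHom (a i) (b i) ψ ∈ upperPart H f} *
          Nat.card (upperPart H f) := by
      rw [← Nat.card_prod]
      have hbase : ∀ i, ∃ φ₀, ∀ φ, P (i, φ) → P (i, φ₀) := by
        intro i
        by_cases h : ∃ φ, P (i, φ)
        · obtain ⟨φ, hφ⟩ := h
          exact ⟨φ, fun _ _ => hφ⟩
        · exact ⟨0, fun φ hφ => absurd ⟨φ, hφ⟩ h⟩
      choose φ₀ hφ₀ using hbase
      refine Nat.card_le_card_of_injective (fun p =>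
        (⟨p.1.1, fun ψ hψ => twistHom_mem_upperPart p.2 hψ⟩,
          ⟨_, sub_twistHom_mem_upperPart (hφ₀ _ _ p.2) p.2⟩)) ?_
      rintro ⟨⟨i, φ⟩, hp⟩ ⟨⟨j, φ'⟩, hp'⟩ h
      obtain rfl : i = j := congrArg (fun x => x.1.1) h
      have h2 : (φ - φ₀ i) - twistHom (a i) (b i) (φ - φ₀ i) =
        (φ' - φ₀ i) - twistHom (a i) (b i) (φ' - φ₀ i) := congrArg (fun x => x.2.1) h
      have h3 := hab i (φ - φ') (by
        simp only [twistHom_sub] at h2 ⊢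
        rw [← sub_eq_zero] at h2 ⊢
        rw [← neg_eq_zero, ← h2]
        abel)
      obtain rfl := sub_eq_zero.1 h3
      rfl
    refine (Nat.mul_le_mul_right T hcard).trans ?_
    by_cases hbot : upperPart H f = ⊥
    · rw [hbot, AddSubgroup.card_bot, mul_one]
      refine Nat.mul_le_mul ?_ hT
      rw [← Nat.card_eq_fintype_card]
      exact Finite.card_subtype_le _
    · exact hB _ hbot htop

end BlockCover

/-! ### Additive subgroups of `Hom(K, E)` closed under field multiplications -/

section Closure

open Module

section Twist

variable {F E K : Type*} [Field F] [AddCommGroup E] [AddCommGroup K] [Module F E] [Module F K]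

theorem twistHom_apply (a : E ≃ₗ[F] E) (b : K ≃ₗ[F] K) (ψ : K →ₗ[F] E) (x : K) :
    twistHom a b ψ x = a (ψ (b.symm x)) := rfl

theorem twistHom_mul (a a' : E ≃ₗ[F] E) (b b' : K ≃ₗ[F] K) (ψ : K →ₗ[F] E) :
    twistHom (a * a') (b * b') ψ = twistHom a b (twistHom a' b' ψ) := rfl

theorem twistHom_one (ψ : K →ₗ[F] E) : twistHom (1 : E ≃ₗ[F] E) (1 : K ≃ₗ[F] K) ψ = ψ := rfl

theorem twistHom_inv_twistHom (a : E ≃ₗ[F] E) (b : K ≃ₗ[F] K) (ψ : K →ₗ[F] E) :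
    twistHom a⁻¹ b⁻¹ (twistHom a b ψ) = ψ := by
  rw [← twistHom_mul, inv_mul_cancel, inv_mul_cancel, twistHom_one]

theorem twistHom_twistHom_inv (a : E ≃ₗ[F] E) (b : K ≃ₗ[F] K) (ψ : K →ₗ[F] E) :
    twistHom a b (twistHom a⁻¹ b⁻¹ ψ) = ψ := by
  rw [← twistHom_mul, mul_inv_cancel, mul_inv_cancel, twistHom_one]

/-- Conjugation by a block diagonal automorphism as an additive automorphism of `Hom(K, E)`. -/
def twistAddEquiv (a : E ≃ₗ[F] E) (b : K ≃ₗ[F] K) : (K →ₗ[F] E) ≃+ (K →ₗ[F] E) where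
  toFun := twistHom a b
  invFun := twistHom a⁻¹ b⁻¹
  left_inv := twistHom_inv_twistHom a b
  right_inv := twistHom_twistHom_inv a b
  map_add' := twistHom_add a b

/-- The preimage of `B` under `twistHom a b`. -/
def untwist (a : E ≃ₗ[F] E) (b : K ≃ₗ[F] K) (B : AddSubgroup (K →ₗ[F] E)) :
    AddSubgroup (K →ₗ[F] E) := B.comap (twistAddEquiv a b).toAddMonoidHom

variable {a : E ≃ₗ[F] E} {b : K ≃ₗ[F] K} {B : AddSubgroup (K →ₗ[F] E)}

theorem mem_untwist {ψ : K →ₗ[F] E} : ψ ∈ untwist a b B ↔ twistHom a b ψ ∈ B := Iff.rfl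

theorem untwist_ne_bot (hB : B ≠ ⊥) : untwist a b B ≠ ⊥ := by
  obtain ⟨⟨ψ, hψ⟩, hψ0⟩ := AddSubgroup.ne_bot_iff_exists_ne_zero.1 hB
  intro h
  have h1 : twistHom a⁻¹ b⁻¹ ψ ∈ untwist a b B := by
    rw [mem_untwist, twistHom_twistHom_inv]; exact hψ
  rw [h, AddSubgroup.mem_bot] at h1
  exact hψ0 (Subtype.ext ((twistAddEquiv a⁻¹ b⁻¹).map_eq_zero_iff.1 h1))

theorem untwist_ne_top (hB : B ≠ ⊤) : untwist a b B ≠ ⊤ := by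
  refine fun h => hB (eq_top_iff.2 fun ψ _ => ?_)
  have h1 : twistHom a⁻¹ b⁻¹ ψ ∈ untwist a b B := h ▸ AddSubgroup.mem_top _
  rwa [mem_untwist, twistHom_twistHom_inv] at h1

theorem card_untwist : Nat.card (untwist a b B) = Nat.card B :=
  Nat.card_congr ((twistAddEquiv a b).toEquiv.subtypeEquiv fun _ => Iff.rfl)

theorem twistHom_mem_untwist {a' : E ≃ₗ[F] E} {b' : K ≃ₗ[F] K}
    (h : ∀ ψ ∈ B, twistHom (a * a' * a⁻¹) (b * b' * b⁻¹) ψ ∈ B) :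
    ∀ ψ ∈ untwist a b B, twistHom a' b' ψ ∈ untwist a b B := by
  intro ψ hψ
  have := h _ (mem_untwist.1 hψ)
  rwa [twistHom_mul, twistHom_mul, twistHom_inv_twistHom] at this

theorem eq_zero_of_twistHom_conj {a' : E ≃ₗ[F] E} {b' : K ≃ₗ[F] K}
    (h : ∀ ψ, twistHom a' b' ψ = ψ → ψ = 0) (ψ : K →ₗ[F] E)
    (hψ : twistHom (a * a' * a⁻¹) (b * b' * b⁻¹) ψ = ψ) : ψ = 0 := by
  have h1 := h (twistHom a⁻¹ b⁻¹ ψ) (by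
    conv_rhs => rw [← hψ, twistHom_mul, twistHom_mul, twistHom_inv_twistHom])
  exact (twistAddEquiv a⁻¹ b⁻¹).map_eq_zero_iff.1 h1

theorem irreducible_conj {c : E ≃ₗ[F] E}
    (hc : ∀ U : Submodule F E, (∀ x ∈ U, c x ∈ U) → U = ⊥ ∨ U = ⊤)
    (U : Submodule F E) (hU : ∀ x ∈ U, (a * c * a⁻¹) x ∈ U) : U = ⊥ ∨ U = ⊤ := by
  have hmap : U = (U.comap a.toLinearMap).map a.toLinearMap :=
    (Submodule.map_comap_eq_of_surjective a.surjective U).symm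
  rw [hmap]
  rcases hc (U.comap a.toLinearMap) (fun x hx => by
    have := hU _ hx
    rw [LinearEquiv.mul_apply, LinearEquiv.mul_apply, LinearEquiv.coe_coe,
      inv_apply_of_eq (y := a x) rfl] at this
    exact this) with h | h
  · left; rw [h, Submodule.map_bot]
  · right; rw [h, Submodule.map_top]; exact LinearMap.range_eq_top.2 a.surjective

theorem eq_top_of_smulRight_mem [FiniteDimensional F E]
    (h : ∀ (φ : Dual F K) (e : E), φ.smulRight e ∈ B) : B = ⊤ := by
  refine eq_top_iff.2 fun ψ _ => ?_
  let v := finBasis F E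
  have : ψ = ∑ i, (v.coord i ∘ₗ ψ).smulRight (v i) := by
    ext x
    simp only [LinearMap.coe_sum, Finset.sum_apply, LinearMap.smulRight_apply,
      LinearMap.comp_apply, Basis.coord_apply]
    exact (v.sum_repr (ψ x)).symm
  rw [this]
  exact B.sum_mem fun i _ => h _ _

end Twist

section Fields

variable {F E K : Type*} [Field F] [Field E] [Field K] [Algebra F E] [Algebra F K]
  {B : AddSubgroup (K →ₗ[F] E)}

theorem twistHom_unitMul_apply (α : Eˣ) (β : Kˣ) (ψ : K →ₗ[F] E) (x : K) :
    twistHom (unitMul F α) (unitMul F β) ψ x = α * ψ ((β⁻¹ : Kˣ) * x) := rfl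

theorem twistHom_unitMul_mul_apply (α : Eˣ) (β : Kˣ) (ψ : K →ₗ[F] E) (x : K) :
    twistHom (unitMul F α) (unitMul F β) ψ (β * x) = α * ψ x := by
  rw [twistHom_unitMul_apply, Units.inv_mul_cancel_left]

theorem irreducible_unitMul_of_generator {β : Kˣ} [Finite K] (hβ : ∀ x, x ∈ Subgroup.zpowers β)
    (U : Submodule F K) (hU : ∀ x ∈ U, unitMul F β x ∈ U) : U = ⊥ ∨ U = ⊤ := by
  rw [or_iff_not_imp_left]
  intro h
  obtain ⟨x, hx, hx0⟩ := U.exists_mem_ne_zero_of_ne_bot h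
  have hpow : ∀ k : ℕ, (β : K) ^ k * x ∈ U := by
    intro k
    induction k with
    | zero => simpa using hx
    | succ k ih =>
      have := hU _ ih
      rwa [unitMul_apply, ← mul_assoc, ← pow_succ'] at this
  refine eq_top_iff.2 fun y _ => ?_
  by_cases hy : y = 0
  · rw [hy]; exact zero_mem _
  obtain ⟨k, hk⟩ := mem_powers_iff_mem_zpowers.2
    (hβ (Units.mk0 (y / x) (div_ne_zero hy hx0)))
  have hk' : (β : K) ^ k = y / x := by
    have := congrArg Units.val hk
    simpa using this
  have := hpow k
  rwa [hk', div_mul_cancel₀ _ hx0] at this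

theorem irreducible_unitMul_of_notMem (hE : finrank F E = 2) {α : Eˣ}
    (hα : (α : E) ∉ (algebraMap F E).range)
    (U : Submodule F E) (hU : ∀ x ∈ U, unitMul F α x ∈ U) : U = ⊥ ∨ U = ⊤ := by
  have : FiniteDimensional F E := Module.finite_of_finrank_pos (by omega)
  rw [or_iff_not_imp_left]
  intro h
  obtain ⟨x, hx, hx0⟩ := U.exists_mem_ne_zero_of_ne_bot h
  have h1 : F ∙ x ≤ U := (Submodule.span_singleton_le_iff_mem _ _).2 hx
  have h2 : F ∙ x < U := lt_of_le_of_ne h1 fun h => by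
    have := hU x hx
    rw [← h] at this
    obtain ⟨c, hc⟩ := Submodule.mem_span_singleton.1 this
    rw [unitMul_apply, Algebra.smul_def] at hc
    exact hα ⟨c, mul_right_cancel₀ hx0 hc⟩
  have h3 := Submodule.finrank_lt_finrank_of_lt h2
  rw [finrank_span_singleton hx0] at h3
  have := Submodule.finrank_le U
  exact Submodule.eq_top_of_finrank_eq (by omega)

theorem exists_eq_smul_one_add_smul (hE : finrank F E = 2) {α : E}
    (hα : α ∉ (algebraMap F E).range) (e : E) : ∃ s t : F, e = s • 1 + t • α := by
  have : FiniteDimensional F E := Module.finite_of_finrank_pos (by omega)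
  have hα0 : α ≠ 0 := fun h => hα ⟨0, by rw [map_zero, h]⟩
  have hone : F ∙ (1 : E) < Submodule.span F {1, α} := by
    refine lt_of_le_of_ne (Submodule.span_mono (by simp)) fun h => ?_
    have : α ∈ F ∙ (1 : E) := h ▸ Submodule.subset_span (by simp)
    obtain ⟨c, hc⟩ := Submodule.mem_span_singleton.1 this
    exact hα ⟨c, by rw [← hc, Algebra.smul_def, mul_one]⟩
  have h3 := Submodule.finrank_lt_finrank_of_lt hone
  rw [finrank_span_singleton one_ne_zero] at h3
  have := Submodule.finrank_le (Submodule.span F {1, α})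
  have htop : Submodule.span F {1, α} = ⊤ := Submodule.eq_top_of_finrank_eq (by omega)
  obtain ⟨s, t, h⟩ := Submodule.mem_span_pair.1 (htop ▸ Submodule.mem_top : e ∈ _)
  exact ⟨s, t, h.symm⟩

/-- An element of relative norm one generating a quadratic extension. -/
theorem exists_pow_eq_one_notMem [Finite E] (hE : finrank F E = 2) :
    ∃ α₀ : Eˣ, (∀ x, x ∈ Subgroup.zpowers α₀) ∧
      ((α₀ ^ (Nat.card F - 1) : Eˣ) : E) ∉ (algebraMap F E).range := by
  have : Finite F := Finite.of_injective _ (algebraMap F E).injective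
  have : FiniteDimensional F E := Module.finite_of_finrank_pos (by omega)
  have hq : 1 < Nat.card F := Finite.one_lt_card
  obtain ⟨α₀, h₀⟩ := IsCyclic.exists_generator (α := Eˣ)
  refine ⟨α₀, h₀, fun ⟨c, hc⟩ => ?_⟩
  have hc0 : c ≠ 0 := by
    rintro rfl
    rw [map_zero] at hc
    exact (Units.ne_zero _) hc.symm
  have := Fintype.ofFinite F
  have h1 : α₀ ^ ((Nat.card F - 1) * (Nat.card F - 1)) = 1 := by
    ext
    rw [pow_mul, Units.val_pow_eq_pow_val, ← hc, ← map_pow, Nat.card_eq_fintype_card,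
      FiniteField.pow_card_sub_one_eq_one c hc0, map_one, Units.val_one]
  have h2 := Nat.le_of_dvd (Nat.mul_pos (by omega) (by omega)) (orderOf_dvd_of_pow_eq_one h1)
  rw [orderOf_eq_card_of_forall_mem_zpowers h₀, Nat.card_units,
    Module.natCard_eq_pow_finrank (K := F), hE] at h2
  obtain ⟨r, hr⟩ : ∃ r, Nat.card F = r + 1 := ⟨Nat.card F - 1, by omega⟩
  rw [hr, Nat.add_sub_cancel] at h2
  have : (r + 1) ^ 2 = r * r + 2 * r + 1 := by ring
  omega

theorem mul_card_le_of_right_closed (hR : ∀ ψ ∈ B, ∀ k : K, ψ ∘ₗ LinearMap.mulLeft F k ∈ B)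
    [Finite (K →ₗ[F] E)] (hB : B ≠ ⊤) : Nat.card B * Nat.card K ≤ Nat.card (K →ₗ[F] E) := by
  obtain ⟨ψ₀, hψ₀⟩ : ∃ ψ₀, ψ₀ ∉ B := by
    by_contra! h
    exact hB (eq_top_iff.2 fun ψ _ => h ψ)
  rw [← Nat.card_prod]
  refine Nat.card_le_card_of_injective
    (fun x : B × K => (x.1 : K →ₗ[F] E) + ψ₀ ∘ₗ LinearMap.mulLeft F x.2) ?_
  rintro ⟨⟨ψ, hψ⟩, k⟩ ⟨⟨ψ', hψ'⟩, k'⟩ h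
  simp only at h
  have h1 : ψ₀ ∘ₗ LinearMap.mulLeft F (k - k') ∈ B := by
    have : ψ₀ ∘ₗ LinearMap.mulLeft F (k - k') = ψ' - ψ := by
      ext x
      have := LinearMap.congr_fun h x
      simp only [LinearMap.add_apply, LinearMap.comp_apply, LinearMap.mulLeft_apply] at this
      simp only [LinearMap.sub_apply, LinearMap.comp_apply, LinearMap.mulLeft_apply, sub_mul,
        map_sub]
      linear_combination this
    rw [this]
    exact B.sub_mem hψ' hψ
  have hk : k = k' := by
    by_contra hne
    apply hψ₀
    have := hR _ h1 (k - k')⁻¹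
    convert this using 1
    ext x
    simp [mul_inv_cancel_left₀ (sub_ne_zero.2 hne)]
  subst hk
  rw [add_left_inj] at h
  subst h
  rfl

theorem card_le_of_right_closed (hR : ∀ ψ ∈ B, ∀ k : K, ψ ∘ₗ LinearMap.mulLeft F k ∈ B)
    [Finite (K →ₗ[F] E)] (hB : B ≠ ⊥) : Nat.card K ≤ Nat.card B := by
  obtain ⟨⟨ψ, hψ⟩, hψ0⟩ := AddSubgroup.ne_bot_iff_exists_ne_zero.1 hB
  refine Nat.card_le_card_of_injective (fun k => (⟨_, hR ψ hψ k⟩ : B)) fun k k' h => ?_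
  by_contra hne
  apply hψ0
  ext x
  have h1 := LinearMap.congr_fun (Subtype.mk.inj h) ((k - k')⁻¹ * x)
  rw [LinearMap.comp_apply, LinearMap.comp_apply, LinearMap.mulLeft_apply, LinearMap.mulLeft_apply,
    ← sub_eq_zero, ← map_sub, ← sub_mul, mul_inv_cancel_left₀ (sub_ne_zero.2 hne)] at h1
  exact h1

theorem eq_top_of_rank_one_mem [Finite K] [FiniteDimensional F E]
    (hR : ∀ ψ ∈ B, ∀ k : K, ψ ∘ₗ LinearMap.mulLeft F k ∈ B)
    (hL : ∀ ψ ∈ B, ∀ e : E, e • ψ ∈ B) {φ : Dual F K} {e : E} (hφ : φ ≠ 0) (he : e ≠ 0)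
    (h : φ.smulRight e ∈ B) : B = ⊤ := by
  refine eq_top_of_smulRight_mem fun φ' e' => ?_
  obtain ⟨w, rfl⟩ := exists_traceForm_eq φ
  obtain ⟨w', rfl⟩ := exists_traceForm_eq φ'
  have hw : w ≠ 0 := by
    rintro rfl
    exact hφ (map_zero _)
  have := hL _ (hR _ h (w' / w)) (e' / e)
  convert this using 1
  ext x
  simp only [LinearMap.smulRight_apply, LinearMap.smul_apply, LinearMap.comp_apply,
    LinearMap.mulLeft_apply, Algebra.traceForm_apply, smul_eq_mul]
  rw [← mul_assoc w, mul_div_cancel₀ _ hw, mul_smul_comm, div_mul_cancel₀ _ he]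

end Fields

end Closure

section LargeBlock

open Module

variable {F E K : Type*} [Field F] [Field E] [Field K] [Algebra F E] [Algebra F K]

/-- The elements of `K` by which `B` is closed under right multiplication. -/
def rightStab [Finite K] (B : AddSubgroup (K →ₗ[F] E)) : Subfield K where
  carrier := {k | ∀ ψ ∈ B, ψ ∘ₗ LinearMap.mulLeft F k ∈ B}
  mul_mem' {x y} hx hy ψ hψ := by
    rw [LinearMap.mulLeft_mul, ← LinearMap.comp_assoc]
    exact hy _ (hx _ hψ)
  one_mem' ψ hψ := by
    rwa [LinearMap.mulLeft_one]
  add_mem' {x y} hx hy ψ hψ := by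
    have : ψ ∘ₗ LinearMap.mulLeft F (x + y) =
        ψ ∘ₗ LinearMap.mulLeft F x + ψ ∘ₗ LinearMap.mulLeft F y := by
      ext z; simp [add_mul]
    rw [this]
    exact B.add_mem (hx _ hψ) (hy _ hψ)
  zero_mem' ψ hψ := by
    have : ψ ∘ₗ LinearMap.mulLeft F (0 : K) = 0 := by ext z; simp
    rw [this]
    exact B.zero_mem
  neg_mem' {x} hx ψ hψ := by
    have : ψ ∘ₗ LinearMap.mulLeft F (-x) = -(ψ ∘ₗ LinearMap.mulLeft F x) := by ext z; simp
    rw [this]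
    exact B.neg_mem (hx _ hψ)
  inv_mem' x hx := by
    by_cases hx0 : x = 0
    · rwa [hx0, inv_zero, ← hx0]
    have hpow : ∀ k : ℕ, ∀ ψ ∈ B, ψ ∘ₗ LinearMap.mulLeft F (x ^ k) ∈ B := by
      intro k
      induction k with
      | zero => intro ψ hψ; rwa [pow_zero, LinearMap.mulLeft_one]
      | succ k ih =>
        intro ψ hψ
        rw [pow_succ, LinearMap.mulLeft_mul, ← LinearMap.comp_assoc]
        exact hx _ (ih _ hψ)
    have h1 : x⁻¹ = x ^ (orderOf (Units.mk0 x hx0) - 1) := by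
      rw [inv_eq_iff_eq_inv, eq_comm, inv_eq_of_mul_eq_one_left]
      rw [← pow_succ', Nat.sub_add_cancel (orderOf_pos _)]
      exact congrArg Units.val (pow_orderOf_eq_one (Units.mk0 x hx0))
    rw [h1]
    exact hpow _

theorem mem_rightStab [Finite K] {B : AddSubgroup (K →ₗ[F] E)} {k : K} :
    k ∈ rightStab B ↔ ∀ ψ ∈ B, ψ ∘ₗ LinearMap.mulLeft F k ∈ B := Iff.rfl

/-- A subfield containing a small power of a primitive element is the whole field. -/
theorem subfield_eq_top_of_pow_mem [Finite K] {q : ℕ} (hq : 2 ≤ q) (hK : q ^ 2 < Nat.card K)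
    {γ : Kˣ} (hγ : ∀ x, x ∈ Subgroup.zpowers γ) {R : Subfield K} (hR : (γ : K) ^ (q + 1) ∈ R) :
    R = ⊤ := by
  have hr : 1 < Nat.card R := Finite.one_lt_card
  have hpow : γ ^ ((q + 1) * (Nat.card R - 1)) = 1 := by
    have := Fintype.ofFinite R
    have h := FiniteField.pow_card_sub_one_eq_one (⟨_, hR⟩ : R)
      (fun h => pow_ne_zero (q + 1) γ.ne_zero (congrArg Subtype.val h))
    ext
    rw [pow_mul, Nat.card_eq_fintype_card]
    exact congrArg Subtype.val h
  have hle := Nat.le_of_dvd (Nat.mul_pos (by omega) (by omega)) (orderOf_dvd_of_pow_eq_one hpow)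
  rw [orderOf_eq_card_of_forall_mem_zpowers hγ, Nat.card_units] at hle
  have hd := Module.natCard_eq_pow_finrank (K := R) (V := K)
  have hd0 : 0 < finrank R K := Module.finrank_pos
  obtain ⟨r, hrr⟩ : ∃ r, Nat.card R = r + 1 := ⟨Nat.card R - 1, by omega⟩
  rw [hrr, Nat.add_sub_cancel] at hle
  by_cases h1 : finrank R K = 1
  · rw [h1, pow_one] at hd
    have : (R : Set K) = Set.univ := by
      refine Set.eq_of_subset_of_ncard_le (Set.subset_univ _) ?_
      rw [Set.ncard_univ, hd]
      rfl
    exact SetLike.coe_injective this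
  · exfalso
    have h2 : (r + 1) ^ 2 ≤ Nat.card K := by
      rw [hd, hrr]
      exact Nat.pow_le_pow_right (by omega) (by omega)
    have hle' : Nat.card K ≤ (q + 1) * r + 1 := by omega
    have h3 : r * (r + 2) ≤ r * (q + 1) := by linarith
    have h4 : r + 2 ≤ q + 1 := Nat.le_of_mul_le_mul_left h3 (by omega)
    have h5 : (q + 1) * (r + 1) ≤ (q + 1) * q := Nat.mul_le_mul_left _ (by omega)
    linarith

variable {B : AddSubgroup (K →ₗ[F] E)} {α : Eˣ} {β : Kˣ}

theorem right_closed_of_twistHom_mem [Finite K] {q : ℕ} (hq : 2 ≤ q) (hK : q ^ 2 < Nat.card K)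
    (hα : α ^ (q + 1) = 1) (hβ : ∀ x, x ∈ Subgroup.zpowers β)
    (hB : ∀ ψ ∈ B, twistHom (unitMul F α) (unitMul F β) ψ ∈ B) (ψ : K →ₗ[F] E) (hψ : ψ ∈ B)
    (k : K) : ψ ∘ₗ LinearMap.mulLeft F k ∈ B := by
  have hpow : ∀ n : ℕ, ∀ ψ ∈ B, twistHom (unitMul F (α ^ n)) (unitMul F (β ^ n)) ψ ∈ B := by
    intro n
    induction n with
    | zero => intro ψ hψ; rwa [pow_zero, pow_zero, map_one, map_one, twistHom_one]
    | succ n ih =>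
      intro ψ hψ
      rw [pow_succ, pow_succ, map_mul, map_mul, twistHom_mul]
      exact ih _ (hB _ hψ)
  have h1 : ((β⁻¹ : Kˣ) : K) ^ (q + 1) ∈ rightStab B := by
    intro ψ hψ
    have := hpow (q + 1) ψ hψ
    convert this using 1
    ext x
    rw [hα, twistHom_unitMul_apply, Units.val_one, one_mul, ← inv_pow, Units.val_pow_eq_pow_val]
    rfl
  have h2 := subfield_eq_top_of_pow_mem hq hK (γ := β⁻¹) (fun x => by
    rw [Subgroup.zpowers_inv]; exact hβ x) h1
  exact mem_rightStab.1 (h2 ▸ Subfield.mem_top k) ψ hψ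

theorem left_closed_of_twistHom_mem (hE : finrank F E = 2) (hα : (α : E) ∉ (algebraMap F E).range)
    (hR : ∀ ψ ∈ B, ∀ k : K, ψ ∘ₗ LinearMap.mulLeft F k ∈ B)
    (hB : ∀ ψ ∈ B, twistHom (unitMul F α) (unitMul F β) ψ ∈ B) (ψ : K →ₗ[F] E) (hψ : ψ ∈ B)
    (e : E) : e • ψ ∈ B := by
  have hF : ∀ c : F, ∀ ψ ∈ B, c • ψ ∈ B := by
    intro c ψ hψ
    have := hR ψ hψ (algebraMap F K c)
    convert this using 1
    ext x
    rw [LinearMap.comp_apply, LinearMap.mulLeft_apply, ← Algebra.smul_def, map_smul]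
    rfl
  have hαψ : (α : E) • ψ ∈ B := by
    have := hR _ (hB _ hψ) β
    convert this using 1
    ext x
    rw [LinearMap.comp_apply, LinearMap.mulLeft_apply, twistHom_unitMul_mul_apply]
    rfl
  obtain ⟨s, t, rfl⟩ := exists_eq_smul_one_add_smul hE hα e
  have : (s • (1 : E) + t • (α : E)) • ψ = s • ψ + t • ((α : E) • ψ) := by
    rw [add_smul, smul_assoc, one_smul, smul_assoc]
  rw [this]
  exact B.add_mem (hF _ _ hψ) (hF _ _ hαψ)

theorem twistHom_unitMul_eq_zero {q : ℕ} (hK : q + 2 < Nat.card K) (hα : α ^ (q + 1) = 1)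
    (hβ : ∀ x, x ∈ Subgroup.zpowers β) (ψ : K →ₗ[F] E)
    (hψ : twistHom (unitMul F α) (unitMul F β) ψ = ψ) : ψ = 0 := by
  have h1 : ∀ x, ψ (β * x) = α * ψ x := fun x => by
    conv_lhs => rw [← hψ]
    exact twistHom_unitMul_mul_apply α β ψ x
  have h2 : ∀ n : ℕ, ∀ x, ψ (β ^ n * x) = α ^ n * ψ x := by
    intro n
    induction n with
    | zero => simp
    | succ n ih => intro x; rw [pow_succ', mul_assoc, h1, ih, pow_succ', mul_assoc]
  have hne : (β : K) ^ (q + 1) - 1 ≠ 0 := by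
    intro h
    have h3 : β ^ (q + 1) = 1 := by ext; simpa using sub_eq_zero.1 h
    have h4 := Nat.le_of_dvd (by omega) (orderOf_dvd_of_pow_eq_one h3)
    rw [orderOf_eq_card_of_forall_mem_zpowers hβ, Nat.card_units] at h4
    omega
  ext x
  have h3 := h2 (q + 1) (((β : K) ^ (q + 1) - 1)⁻¹ * x)
  have h4 : (α : E) ^ (q + 1) = 1 := by
    rw [← Units.val_pow_eq_pow_val, hα, Units.val_one]
  rw [h4, one_mul, ← sub_eq_zero, ← map_sub, ← sub_one_mul, mul_inv_cancel_left₀ hne] at h3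
  rw [h3, LinearMap.zero_apply]

/-- A subgroup closed under two field actions differing by a transvection is everything. -/
theorem eq_top_of_right_closed_transvection [Finite K] [FiniteDimensional F E] (hB : B ≠ ⊥)
    (hcard : Nat.card E < Nat.card K) [Finite E]
    (hR : ∀ ψ ∈ B, ∀ k : K, ψ ∘ₗ LinearMap.mulLeft F k ∈ B)
    (hL : ∀ ψ ∈ B, ∀ e : E, e • ψ ∈ B) {w : K} (hw : w ≠ 0) {φ : Dual F K} (hφ : φ ≠ 0)
    (hR' : ∀ ψ ∈ B, ψ w = 0 → ∀ k : K,
      ψ ∘ₗ LinearMap.mulLeft F k - φ.smulRight (ψ (k * w)) ∈ B) : B = ⊤ := by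
  have : Finite (K →ₗ[F] E) := DFunLike.finite _
  obtain ⟨ψ, hψ, hψ0, hψw⟩ : ∃ ψ ∈ B, ψ ≠ 0 ∧ ψ w = 0 := by
    have hninj : ¬ Function.Injective fun ψ : B => (ψ : K →ₗ[F] E) w := fun h =>
      absurd ((card_le_of_right_closed hR hB).trans (Nat.card_le_card_of_injective _ h))
        (by omega)
    simp only [Function.Injective, not_forall] at hninj
    obtain ⟨ψ, ψ', h, hne⟩ := hninj
    exact ⟨ψ - ψ', B.sub_mem ψ.2 ψ'.2, fun h => hne (Subtype.ext (sub_eq_zero.1 h)),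
      by rw [LinearMap.sub_apply, h, sub_self]⟩
  obtain ⟨y, hy⟩ : ∃ y, ψ y ≠ 0 := by
    by_contra! h
    exact hψ0 (LinearMap.ext h)
  have h1 := B.sub_mem (hR ψ hψ (y / w)) (hR' ψ hψ hψw (y / w))
  rw [sub_sub_cancel, div_mul_cancel₀ _ hw] at h1
  exact eq_top_of_rank_one_mem hR hL hφ hy h1

end LargeBlock

section LargeBlockCover

open Module

variable {F E K : Type*} [Field F] [Field E] [Field K] [Algebra F E] [Algebra F K]

theorem det_conj {V : Type*} [AddCommGroup V] [Module F V] (g h : V ≃ₗ[F] V) :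
    LinearEquiv.det (g * h * g⁻¹) = LinearEquiv.det h := by
  rw [map_mul, map_mul, map_inv, mul_right_comm, mul_inv_cancel, one_mul]

theorem pow_card_sub_one_pow_card_add_one [Finite E] (hE : finrank F E = 2) (α₀ : Eˣ) :
    (α₀ ^ (Nat.card F - 1)) ^ (Nat.card F + 1) = 1 := by
  have : Finite F := Finite.of_injective _ (algebraMap F E).injective
  have : FiniteDimensional F E := Module.finite_of_finrank_pos (by omega)
  rw [← pow_mul, mul_comm, ← Nat.sq_sub_sq, one_pow, ← hE, ← Module.natCard_eq_pow_finrank,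
    ← Nat.card_units, pow_card_eq_one']

theorem mem_zpowers_det_unitMul [Finite E] [Finite K] (hE : finrank F E = 2) {α : Eˣ} {β : Kˣ}
    (hα : α ^ (Nat.card F + 1) = 1) (hβ : ∀ x, x ∈ Subgroup.zpowers β) (u : Fˣ) :
    u ∈ Subgroup.zpowers (LinearEquiv.det (unitMul F α) * LinearEquiv.det (unitMul F β)) := by
  have : Finite F := Finite.of_injective _ (algebraMap F E).injective
  have h1 : LinearEquiv.det (unitMul F α) = 1 := by
    ext
    apply (algebraMap F E).injective
    rw [coe_det_unitMul, FiniteField.algebraMap_norm_eq_pow_sum, hE, Finset.sum_range_succ,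
      Finset.sum_range_one, pow_zero, pow_one, add_comm, ← Units.val_pow_eq_pow_val, hα,
      Units.val_one, Units.val_one, map_one]
  have h2 : LinearEquiv.det (unitMul F β) = Units.map (Algebra.norm F (S := K)) β := by
    ext
    rw [coe_det_unitMul]
    rfl
  obtain ⟨x, rfl⟩ := FiniteField.unitsMap_norm_surjective F K u
  obtain ⟨k, rfl⟩ := hβ x
  exact ⟨k, by rw [h1, h2, one_mul]; exact (map_zpow _ β k).symm⟩

theorem card_linearMap [Finite F] [FiniteDimensional F E] [FiniteDimensional F K] :
    Nat.card (K →ₗ[F] E) = Nat.card F ^ (finrank F K * finrank F E) := by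
  rw [Module.natCard_eq_pow_finrank (K := F) (V := K →ₗ[F] E), finrank_linearMap]

theorem card_ker_trace [Finite K] [FiniteDimensional F K] :
    Nat.card (LinearMap.ker (Algebra.trace F K)) = Nat.card F ^ (finrank F K - 1) := by
  have : Finite F := Finite.of_injective _ (algebraMap F K).injective
  rw [Module.natCard_eq_pow_finrank (K := F)]
  have h := LinearMap.finrank_range_add_finrank_ker (Algebra.trace F K)
  rw [LinearMap.range_eq_top.2 (Algebra.trace_surjective F K), finrank_top, finrank_self] at h
  congr 1
  omega

/-- The transvections along the trace form. -/
noncomputable def traceTransvection (u : LinearMap.ker (Algebra.trace F K)) : K ≃ₗ[F] K :=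
  LinearEquiv.transvection (LinearMap.mem_ker.1 u.2)

theorem traceTransvection_apply (u : LinearMap.ker (Algebra.trace F K)) (x : K) :
    traceTransvection u x = x + Algebra.trace F K x • (u : K) := rfl

theorem traceTransvection_symm_apply (u : LinearMap.ker (Algebra.trace F K)) (x : K) :
    (traceTransvection u).symm x = x - Algebra.trace F K x • (u : K) := by
  change x + Algebra.trace F K x • -(u : K) = _
  rw [smul_neg, sub_eq_add_neg]

theorem traceTransvection_add (u v : LinearMap.ker (Algebra.trace F K)) :
    traceTransvection (u + v) = traceTransvection u * traceTransvection v := by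
  ext x
  rw [LinearEquiv.mul_apply, traceTransvection_apply, traceTransvection_apply,
    traceTransvection_apply, map_add, map_smul, LinearMap.mem_ker.1 v.2, smul_zero, add_zero,
    Submodule.coe_add, smul_add]
  abel

theorem left_right_closed_untwist [Finite K] (hE : finrank F E = 2) (hF : 2 ≤ Nat.card F)
    (hK : Nat.card F ^ 2 < Nat.card K) {α : Eˣ} {β : Kˣ} (hα : α ^ (Nat.card F + 1) = 1)
    (hαF : (α : E) ∉ (algebraMap F E).range) (hβ : ∀ x, x ∈ Subgroup.zpowers β)
    {B : AddSubgroup (K →ₗ[F] E)} {b : K ≃ₗ[F] K}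
    (hB : ∀ ψ ∈ B, twistHom (unitMul F α) (b * unitMul F β * b⁻¹) ψ ∈ B) :
    (∀ ψ ∈ untwist 1 b B, ∀ k : K, ψ ∘ₗ LinearMap.mulLeft F k ∈ untwist 1 b B) ∧
      ∀ ψ ∈ untwist 1 b B, ∀ e : E, e • ψ ∈ untwist 1 b B := by
  have h := twistHom_mem_untwist (a := 1) (a' := unitMul F α) (b := b) (b' := unitMul F β)
    (B := B) (by simpa using hB)
  have hR := right_closed_of_twistHom_mem hF hK hα hβ h
  exact ⟨hR, left_closed_of_twistHom_mem hE hαF hR h⟩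

theorem coverBound_of_large_block [Finite E] [Finite K] (hE : finrank F E = 2)
    (hK : 3 ≤ finrank F K) {T : ℕ} (hT : T ≤ Nat.card F ^ (finrank F K + 3)) :
    CoverBound ((E × K) ≃ₗ[F] (E × K)) T := by
  intro S hS
  have : Finite F := Finite.of_injective _ (algebraMap F E).injective
  have : FiniteDimensional F E := Module.finite_of_finrank_pos (by omega)
  have : FiniteDimensional F K := Module.finite_of_finrank_pos (by omega)
  have : Finite (K →ₗ[F] E) := DFunLike.finite _
  have hq : 2 ≤ Nat.card F := Finite.one_lt_card
  have hcE : Nat.card E = Nat.card F ^ 2 := by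
    rw [Module.natCard_eq_pow_finrank (K := F), hE]
  have hcK : Nat.card K = Nat.card F ^ finrank F K := Module.natCard_eq_pow_finrank
  have hcA : Nat.card (K →ₗ[F] E) = Nat.card F ^ (finrank F K * 2) := by rw [card_linearMap, hE]
  have hEK : Nat.card F ^ 2 < Nat.card K := hcK ▸ Nat.pow_lt_pow_right (by omega) (by omega)
  obtain ⟨α₀, -, hαF⟩ := exists_pow_eq_one_notMem hE
  have hα := pow_card_sub_one_pow_card_add_one hE α₀
  generalize α₀ ^ (Nat.card F - 1) = α at hα hαF
  obtain ⟨β, hβ⟩ := IsCyclic.exists_generator (α := Kˣ)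
  have := Fintype.ofFinite (LinearMap.ker (Algebra.trace F K))
  refine le_card_of_cover_diag hE (I := LinearMap.ker (Algebra.trace F K))
    (fun _ => unitMul F α)
    (fun u => traceTransvection u * unitMul F β * (traceTransvection u)⁻¹)
    (fun _ => irreducible_unitMul_of_notMem hE hαF)
    (fun u => irreducible_conj (irreducible_unitMul_of_generator hβ))
    (fun u ψ h => eq_zero_of_twistHom_conj (a := 1) (b := traceTransvection u)
      (twistHom_unitMul_eq_zero (q := Nat.card F) (by nlinarith) hα hβ) ψ (by simpa using h))
    (fun u v => by rw [det_conj]; exact mem_zpowers_det_unitMul hE hα hβ v)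
    (hT.trans (hcA ▸ Nat.pow_le_pow_right (by omega) (by omega)))
    (fun B hB hB' => ?_) S hS.1 fun u g => hS.2 _
  by_cases hex : ∃ u : LinearMap.ker (Algebra.trace F K), ∀ ψ ∈ B, twistHom (unitMul F α)
      (traceTransvection u * unitMul F β * (traceTransvection u)⁻¹) ψ ∈ B
  swap
  · have : IsEmpty {u : LinearMap.ker (Algebra.trace F K) // ∀ ψ ∈ B, twistHom (unitMul F α)
      (traceTransvection u * unitMul F β * (traceTransvection u)⁻¹) ψ ∈ B} :=
      ⟨fun u => hex ⟨u.1, u.2⟩⟩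
    rw [Nat.card_of_isEmpty, zero_mul, zero_mul]
    exact Nat.zero_le _
  obtain ⟨u, hu⟩ := hex
  obtain ⟨hR, hL⟩ := left_right_closed_untwist hE hq hEK hα hαF hβ hu
  have hle := mul_card_le_of_right_closed hR (untwist_ne_top hB')
  have hge := card_le_of_right_closed hR (untwist_ne_bot hB)
  rw [card_untwist, hcA, hcK, mul_two, pow_add] at hle
  replace hle := Nat.le_of_mul_le_mul_right hle (pow_pos (by omega) _)
  rw [card_untwist, hcK] at hge
  have hm : finrank F K ≠ 3 := by
    intro h3
    let M : Submodule E (K →ₗ[F] E) :=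
      { untwist 1 (traceTransvection u) B with smul_mem' := fun e ψ hψ => hL ψ hψ e }
    have h1 : Nat.card M = Nat.card B := card_untwist (a := 1) (b := traceTransvection u)
    rw [Module.natCard_eq_pow_finrank (K := E), le_antisymm hle hge, hcE, ← pow_mul, h3] at h1
    have := Nat.pow_right_injective hq h1
    omega
  have hsub : Subsingleton {u : LinearMap.ker (Algebra.trace F K) // ∀ ψ ∈ B,
      twistHom (unitMul F α)
        (traceTransvection u * unitMul F β * (traceTransvection u)⁻¹) ψ ∈ B} := by
    refine ⟨fun ⟨u, hu⟩ ⟨v, hv⟩ => Subtype.ext ?_⟩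
    by_contra hne
    simp only at hne
    obtain ⟨hR, hL⟩ := left_right_closed_untwist hE hq hEK hα hαF hβ hu
    have h1 : ∀ ψ ∈ untwist 1 (traceTransvection u) B, twistHom (unitMul F α)
        (traceTransvection (v - u) * unitMul F β * (traceTransvection (v - u))⁻¹) ψ ∈
          untwist 1 (traceTransvection u) B := by
      refine twistHom_mem_untwist fun ψ hψ => ?_
      have := hv ψ hψ
      have h2 : v = u + (v - u) := by abel
      rw [h2, traceTransvection_add] at this
      convert this using 2
      · simp
      · group
    obtain ⟨hR', -⟩ := left_right_closed_untwist hE hq hEK hα hαF hβ h1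
    have hw : ((v - u : LinearMap.ker (Algebra.trace F K)) : K) ≠ 0 := fun h =>
      hne (sub_eq_zero.1 (Subtype.ext h)).symm
    have hφ : Algebra.trace F K ≠ 0 := fun h => by
      obtain ⟨x, hx⟩ := Algebra.trace_surjective F K 1
      rw [h] at hx
      exact zero_ne_one hx
    refine untwist_ne_top hB' (eq_top_of_right_closed_transvection (untwist_ne_bot hB)
      (hcE ▸ hEK) hR hL hw hφ fun ψ hψ hψw k => ?_)
    have h3 : ψ ∈ untwist 1 (traceTransvection (v - u)) (untwist 1 (traceTransvection u) B) := by
      rw [mem_untwist]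
      convert hψ using 1
      ext x
      rw [twistHom_apply, traceTransvection_symm_apply, map_sub, map_smul, hψw, smul_zero, sub_zero]
      rfl
    have h4 := mem_untwist.1 (hR' ψ h3 k)
    convert h4 using 1
    ext x
    rw [twistHom_apply, traceTransvection_symm_apply, LinearMap.comp_apply,
      LinearMap.mulLeft_apply, mul_sub, mul_smul_comm, map_sub, map_smul]
    rfl
  have hone := Finite.card_le_one_iff_subsingleton.2 hsub
  calc _ ≤ 1 * Nat.card F ^ finrank F K * Nat.card F ^ (finrank F K + 3) :=
        Nat.mul_le_mul (Nat.mul_le_mul hone hle) hT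
    _ ≤ Nat.card F ^ (finrank F K - 1) * Nat.card F ^ (finrank F K * 2) := by
        rw [one_mul, ← pow_add, ← pow_add]
        exact Nat.pow_le_pow_right (by omega) (by omega)
    _ = _ := by rw [← Nat.card_eq_fintype_card, card_ker_trace, hcA]

end LargeBlockCover

/-! ### Dimension four: two quadratic blocks -/

section QuadraticBlocks

open Module

variable {F E : Type*} [Field F] [Field E] [Algebra F E]

theorem smul_mem_of_twistHom_mem [Finite E] (hE : finrank F E = 2) {β : Eˣ}
    (hβ : ∀ x, x ∈ Subgroup.zpowers β) {B : AddSubgroup (E →ₗ[F] E)}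
    (hB : ∀ ψ ∈ B, twistHom (unitMul F (β ^ (Nat.card F - 1))) (unitMul F β) ψ ∈ B)
    (ψ : E →ₗ[F] E) (hψ : ψ ∈ B) (c : F) : c • ψ ∈ B := by
  have : Finite F := Finite.of_injective _ (algebraMap F E).injective
  have hα := pow_card_sub_one_pow_card_add_one hE β
  generalize β ^ (Nat.card F - 1) = α at hα hB
  have hpow : ∀ n : ℕ, ∀ ψ ∈ B, twistHom (unitMul F (α ^ n)) (unitMul F (β ^ n)) ψ ∈ B := by
    intro n
    induction n with
    | zero => intro ψ hψ; rwa [pow_zero, pow_zero, map_one, twistHom_one]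
    | succ n ih =>
      intro ψ hψ
      rw [pow_succ, pow_succ, map_mul, map_mul, twistHom_mul]
      exact ih _ (hB _ hψ)
  by_cases hc : c = 0
  · rw [hc, zero_smul]
    exact B.zero_mem
  obtain ⟨x, hx⟩ := FiniteField.unitsMap_norm_surjective F E (Units.mk0 c hc)
  obtain ⟨k, hk⟩ := mem_powers_iff_mem_zpowers.2 (hβ x⁻¹)
  have hk' : β ^ k = x⁻¹ := hk
  have h := hpow ((Nat.card F + 1) * k) ψ hψ
  convert h using 1
  ext y
  have hnorm : algebraMap F E c = ((x ^ (Nat.card F + 1) : Eˣ) : E) := by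
    have h1 : Algebra.norm F (x : E) = c := congrArg Units.val hx
    rw [← h1, FiniteField.algebraMap_norm_eq_pow_sum, hE, Finset.sum_range_succ,
      Finset.sum_range_one, pow_zero, pow_one, add_comm, Units.val_pow_eq_pow_val]
  rw [twistHom_unitMul_apply, pow_mul, hα, one_pow, Units.val_one, one_mul,
    mul_comm (Nat.card F + 1), pow_mul, hk',
    inv_pow, inv_inv, ← hnorm, ← Algebra.smul_def, map_smul]
  rfl

theorem left_right_closed_of_twistHom_mem [Finite E] (hE : finrank F E = 2) (hq : 3 ≤ Nat.card F)
    {β : Eˣ} (hβ : ∀ x, x ∈ Subgroup.zpowers β)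
    (hαF : ((β ^ (Nat.card F - 1) : Eˣ) : E) ∉ (algebraMap F E).range)
    {B : AddSubgroup (E →ₗ[F] E)}
    (hB : ∀ ψ ∈ B, twistHom (unitMul F (β ^ (Nat.card F - 1))) (unitMul F β) ψ ∈ B) :
    (∀ ψ ∈ B, ∀ k : E, ψ ∘ₗ LinearMap.mulLeft F k ∈ B) ∧ ∀ ψ ∈ B, ∀ e : E, e • ψ ∈ B := by
  have : Finite F := Finite.of_injective _ (algebraMap F E).injective
  have : FiniteDimensional F E := Module.finite_of_finrank_pos (by omega)
  have hF := smul_mem_of_twistHom_mem hE hβ hB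
  have hα := pow_card_sub_one_pow_card_add_one hE β
  have hα3 : ((β ^ (Nat.card F - 1) : Eˣ) : E) ^ 3 - 1 ≠ 0 := by
    intro h
    have h1 : β ^ ((Nat.card F - 1) * 3) = 1 := by
      ext
      rw [pow_mul, Units.val_pow_eq_pow_val, sub_eq_zero.1 h, Units.val_one]
    have h2 := Nat.le_of_dvd (by omega) (orderOf_dvd_of_pow_eq_one h1)
    rw [orderOf_eq_card_of_forall_mem_zpowers hβ, Nat.card_units,
      Module.natCard_eq_pow_finrank (K := F), hE] at h2
    obtain ⟨r, hr⟩ : ∃ r, Nat.card F = r + 3 := ⟨Nat.card F - 3, by omega⟩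
    rw [hr] at h2
    have h3 : (r + 3) ^ 2 = r * r + 6 * r + 9 := by ring
    omega
  have hβq : β ^ Nat.card F = β * β ^ (Nat.card F - 1) := by
    rw [← pow_succ', Nat.sub_add_cancel (by omega)]
  generalize β ^ (Nat.card F - 1) = α at hα hαF hα3 hB hβq
  set γ : E := ((β⁻¹ : Eˣ) : E) with hγ
  have hα0 : (α : E) ≠ 0 := α.ne_zero
  have hγ0 : γ ≠ 0 := (β⁻¹).ne_zero
  have hαq : (α : E) ^ Nat.card F = (α : E)⁻¹ := by
    rw [← mul_eq_one_iff_eq_inv₀ hα0, ← pow_succ, ← Units.val_pow_eq_pow_val, hα, Units.val_one]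
  have hγq : γ ^ Nat.card F = γ * (α : E)⁻¹ := by
    rw [hγ, ← Units.val_pow_eq_pow_val, inv_pow, hβq, mul_inv, Units.val_mul,
      Units.val_inv_eq_inv_val α]
  obtain ⟨t, ht⟩ : ∃ t : F, algebraMap F E t = α + (α : E)⁻¹ :=
    ⟨Algebra.trace F E α, by
      rw [FiniteField.algebraMap_trace_eq_sum_pow, hE, Finset.sum_range_succ,
        Finset.sum_range_one, pow_zero, pow_one, pow_one, hαq]⟩
  obtain ⟨s, hs⟩ : ∃ s : F, algebraMap F E s = γ + γ * (α : E)⁻¹ :=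
    ⟨Algebra.trace F E γ, by
      rw [FiniteField.algebraMap_trace_eq_sum_pow, hE, Finset.sum_range_succ,
        Finset.sum_range_one, pow_zero, pow_one, pow_one, hγq]⟩
  obtain ⟨ν, hν⟩ : ∃ ν : F, algebraMap F E ν = γ * (γ * (α : E)⁻¹) :=
    ⟨Algebra.norm F γ, by
      rw [FiniteField.algebraMap_norm_eq_pow_sum, hE, Finset.sum_range_succ,
        Finset.sum_range_one, pow_zero, pow_one, pow_add, pow_one, hγq]⟩
  have hν0 : ν ≠ 0 := by
    rintro rfl
    rw [map_zero] at hν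
    exact mul_ne_zero hγ0 (mul_ne_zero hγ0 (inv_ne_zero hα0)) hν.symm
  have hD : t ^ 2 * ν - s ^ 2 ≠ 0 := by
    intro h
    have h1 := congrArg (algebraMap F E) h
    rw [map_sub, map_mul, map_pow, map_pow, map_zero, ht, hs, hν] at h1
    have h2 : γ ^ 2 * (((α : E) - 1) * ((α : E) ^ 3 - 1)) = 0 := by
      field_simp at h1
      linear_combination h1
    refine mul_ne_zero (pow_ne_zero 2 hγ0) (mul_ne_zero (fun h => hαF ⟨1, ?_⟩) hα3) h2
    rw [map_one, sub_eq_zero.1 h]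
  have hαsq : (α : E) * α = algebraMap F E t * α - 1 := by
    rw [ht, add_mul, inv_mul_cancel₀ hα0, add_sub_cancel_right]
  have hγsq : ∀ x, γ * (γ * x) = s • (γ * x) - ν • x := by
    intro x
    rw [Algebra.smul_def, Algebra.smul_def, hs, hν]
    ring
  have hTB : ∀ ψ ∈ B, ∃ χ ∈ B, ∀ x, χ x = α * ψ (γ * x) := fun ψ hψ =>
    ⟨_, hB ψ hψ, fun x => twistHom_unitMul_apply α β ψ x⟩
  have hP : ∀ ψ ∈ B, ∃ χ ∈ B, ∀ x, χ x =
      algebraMap F E (t * ν) * α * ψ x + algebraMap F E s * ψ (γ * x) := by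
    intro ψ hψ
    obtain ⟨χ₁, h₁, hχ₁⟩ := hTB ψ hψ
    obtain ⟨χ₂, h₂, hχ₂⟩ := hTB χ₁ h₁
    refine ⟨(t * s) • χ₁ + ν • ψ - χ₂,
      B.sub_mem (B.add_mem (hF _ h₁ _) (hF _ hψ _)) h₂, fun x => ?_⟩
    simp only [LinearMap.sub_apply, LinearMap.add_apply, LinearMap.smul_apply, hχ₂, hχ₁, hγsq,
      map_sub, map_smul]
    simp only [Algebra.smul_def, map_mul]
    linear_combination (algebraMap F E ν * ψ x - algebraMap F E s * ψ (γ * x)) * hαsq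
  have hαψ : ∀ ψ ∈ B, (α : E) • ψ ∈ B := by
    intro ψ hψ
    obtain ⟨χ₁, h₁, hχ₁⟩ := hTB ψ hψ
    obtain ⟨χ₂, h₂, hχ₂⟩ := hP χ₁ h₁
    obtain ⟨χ₃, h₃, hχ₃⟩ := hP ψ hψ
    have h4 : (t ^ 2 * ν - s ^ 2)⁻¹ •
        (t • χ₃ - (s * ν⁻¹) • ((t ^ 2 * ν + s ^ 2) • χ₁ - χ₂)) ∈ B :=
      hF _ (B.sub_mem (hF _ h₃ _) (hF _ (B.sub_mem (hF _ h₁ _) h₂) _)) _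
    convert h4 using 1
    rw [eq_inv_smul_iff₀ hD]
    ext x
    have hν1 : algebraMap F E ν ≠ 0 := by simpa using hν0
    simp only [LinearMap.sub_apply, LinearMap.smul_apply, hχ₃, hχ₂, hχ₁, hγsq,
      map_sub, map_smul, smul_eq_mul]
    simp only [Algebra.smul_def, map_sub, map_mul, map_add, map_pow, map_inv₀]
    field_simp
    linear_combination
      -(algebraMap F E ν * algebraMap F E s * algebraMap F E t * ψ (γ * x)) * hαsq
  have hL : ∀ ψ ∈ B, ∀ e : E, e • ψ ∈ B := by
    intro ψ hψ e
    obtain ⟨c, d, rfl⟩ := exists_eq_smul_one_add_smul hE hαF e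
    have : (c • (1 : E) + d • (α : E)) • ψ = c • ψ + d • ((α : E) • ψ) := by
      rw [add_smul, smul_assoc, one_smul, smul_assoc]
    rw [this]
    exact B.add_mem (hF _ hψ _) (hF _ (hαψ _ hψ) _)
  refine ⟨fun ψ hψ k => ?_, hL⟩
  have hγF : γ ∉ (algebraMap F E).range := by
    rintro ⟨c, hc⟩
    have := Fintype.ofFinite F
    have h1 : γ * (α : E)⁻¹ = γ * 1 := by
      rw [← hγq, ← hc, ← map_pow, Nat.card_eq_fintype_card, FiniteField.pow_card, mul_one]
    exact hαF ⟨1, by rw [map_one, ← inv_inv (α : E), mul_left_cancel₀ hγ0 h1, inv_one]⟩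
  obtain ⟨c, d, rfl⟩ := exists_eq_smul_one_add_smul hE hγF k
  have hγψ : ψ ∘ₗ LinearMap.mulLeft F γ ∈ B := by
    convert hL _ (hB ψ hψ) (α : E)⁻¹ using 1
    ext x
    rw [LinearMap.smul_apply, twistHom_unitMul_apply, smul_eq_mul, inv_mul_cancel_left₀ hα0]
    rfl
  have : ψ ∘ₗ LinearMap.mulLeft F (c • (1 : E) + d • γ) =
      c • ψ + d • (ψ ∘ₗ LinearMap.mulLeft F γ) := by
    ext x
    simp [add_mul]
  rw [this]
  exact B.add_mem (hF _ hψ _) (hF _ hγψ _)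

end QuadraticBlocks

section QuadraticBlocksCover

open Module

variable {F E : Type*} [Field F] [Field E] [Algebra F E]

theorem exists_eq_mulLeft_add_mulLeft_comp [Finite E] (hE : finrank F E = 2) {g : E →ₗ[F] E}
    (hg : ∀ k, g ≠ LinearMap.mulLeft F k) (f : E →ₗ[F] E) :
    ∃ x y : E, f = LinearMap.mulLeft F x + LinearMap.mulLeft F y ∘ₗ g := by
  have : Finite F := Finite.of_injective _ (algebraMap F E).injective
  have : FiniteDimensional F E := Module.finite_of_finrank_pos (by omega)
  let j : E × E →ₗ[F] (E →ₗ[F] E) :=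
    { toFun := fun v => LinearMap.mulLeft F v.1 + LinearMap.mulLeft F v.2 ∘ₗ g
      map_add' := fun v w => by ext x; simp [add_mul]; ring
      map_smul' := fun c v => by ext x; simp }
  have hj : Function.Injective j := by
    rw [← LinearMap.ker_eq_bot, LinearMap.ker_eq_bot']
    rintro ⟨x, y⟩ h
    have h1 : ∀ z, x * z + y * g z = 0 := fun z => LinearMap.congr_fun h z
    by_cases hy : y = 0
    · have := h1 1
      simp only [hy, mul_one, zero_mul, add_zero] at this
      rw [this, hy]
      rfl
    · refine absurd (LinearMap.ext fun z => ?_) (hg (-x / y))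
      rw [LinearMap.mulLeft_apply]
      field_simp
      linear_combination h1 z
  have hs := (LinearMap.injective_iff_surjective_of_finrank_eq_finrank (f := j)
    (by rw [finrank_prod, finrank_linearMap, hE])).1 hj
  obtain ⟨v, hv⟩ := hs f
  exact ⟨v.1, v.2, hv.symm⟩

variable {B : AddSubgroup (E →ₗ[F] E)}

theorem exists_eq_mulLeft_of_right_closed [Finite E] (hE : finrank F E = 2)
    (hR : ∀ ψ ∈ B, ∀ k : E, ψ ∘ₗ LinearMap.mulLeft F k ∈ B)
    (hL : ∀ ψ ∈ B, ∀ e : E, e • ψ ∈ B) (hB : B ≠ ⊥) (hB' : B ≠ ⊤) {g : E →ₗ[F] E}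
    (hg : ∀ ψ ∈ B, ψ ∘ₗ g ∈ B) : ∃ k, g = LinearMap.mulLeft F k := by
  have : FiniteDimensional F E := Module.finite_of_finrank_pos (by omega)
  by_contra! hne
  obtain ⟨⟨ψ, hψ⟩, hψ0⟩ := AddSubgroup.ne_bot_iff_exists_ne_zero.1 hB
  have hψ0 : ψ ≠ 0 := fun h => hψ0 (Subtype.ext h)
  obtain ⟨e, he⟩ := DFunLike.ne_iff.1 hψ0
  obtain ⟨φ, -, hφ⟩ := exists_dual_eq_one_of_notMem (U := (⊥ : Submodule F E)) (x := (1 : E))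
    (by simp)
  have hφ0 : φ ≠ 0 := fun h => by simp [h] at hφ
  obtain ⟨x, y, hxy⟩ := exists_eq_mulLeft_add_mulLeft_comp hE hne (φ.smulRight e)
  refine hB' (eq_top_of_rank_one_mem hR hL hφ0 he ?_)
  have h1 : ψ ∘ₗ φ.smulRight e ∈ B := by
    rw [hxy, LinearMap.comp_add, ← LinearMap.comp_assoc]
    exact B.add_mem (hR _ hψ _) (hg _ (hR _ hψ _))
  convert h1 using 1
  ext z
  simp

theorem exists_eq_mulLeft_of_left_closed [Finite E] (hE : finrank F E = 2)
    (hR : ∀ ψ ∈ B, ∀ k : E, ψ ∘ₗ LinearMap.mulLeft F k ∈ B)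
    (hL : ∀ ψ ∈ B, ∀ e : E, e • ψ ∈ B) (hB : B ≠ ⊥) (hB' : B ≠ ⊤) {g : E →ₗ[F] E}
    (hg : ∀ ψ ∈ B, g ∘ₗ ψ ∈ B) : ∃ k, g = LinearMap.mulLeft F k := by
  have : FiniteDimensional F E := Module.finite_of_finrank_pos (by omega)
  by_contra! hne
  obtain ⟨⟨ψ, hψ⟩, hψ0⟩ := AddSubgroup.ne_bot_iff_exists_ne_zero.1 hB
  have hψ0 : ψ ≠ 0 := fun h => hψ0 (Subtype.ext h)
  obtain ⟨e, he⟩ := DFunLike.ne_iff.1 hψ0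
  obtain ⟨φ, -, hφ⟩ := exists_dual_eq_one_of_notMem (U := (⊥ : Submodule F E)) (x := ψ e)
    (by simpa using he)
  have hφ0 : φ ∘ₗ ψ ≠ 0 := fun h => by
    rw [← LinearMap.comp_apply, h] at hφ
    simp at hφ
  obtain ⟨x, y, hxy⟩ := exists_eq_mulLeft_add_mulLeft_comp hE hne (φ.smulRight 1)
  refine hB' (eq_top_of_rank_one_mem hR hL hφ0 one_ne_zero ?_)
  have h1 : φ.smulRight 1 ∘ₗ ψ ∈ B := by
    rw [hxy, LinearMap.add_comp, LinearMap.comp_assoc]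
    exact B.add_mem (hL _ hψ _) (hL _ (hg _ hψ) _)
  exact h1

/-- A linear automorphism fixing `1` and normalising the field multiplications is a field
automorphism. -/
theorem map_mul_of_normalizes {ρ : E ≃ₗ[F] E} (h1 : ρ 1 = 1)
    (h : ∀ k, ∃ k', ∀ x, ρ (k * ρ.symm x) = k' * x) (x y : E) : ρ (x * y) = ρ x * ρ y := by
  obtain ⟨k', hk'⟩ := h x
  have h2 := hk' 1
  rw [← h1, LinearEquiv.symm_apply_apply, h1, mul_one, mul_one] at h2
  rw [h2, ← hk', LinearEquiv.symm_apply_apply]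

/-- The linear automorphisms of `E` which fix `1`. -/
abbrev UnitFixing (F E : Type*) [Field F] [Field E] [Algebra F E] :=
  {ρ : E ≃ₗ[F] E // ρ 1 = 1}

theorem le_card_unitFixing [Finite E] (hE : finrank F E = 2) (hq : 3 ≤ Nat.card F) :
    2 * Nat.card F ≤ Nat.card (UnitFixing F E) := by
  have : Finite F := Finite.of_injective _ (algebraMap F E).injective
  have : FiniteDimensional F E := Module.finite_of_finrank_pos (by omega)
  have : Finite (E ≃ₗ[F] E) := DFunLike.finite _
  have hcE : Nat.card E = Nat.card F ^ 2 := by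
    rw [Module.natCard_eq_pow_finrank (K := F), hE]
  obtain ⟨α₀, -, hα⟩ := exists_pow_eq_one_notMem (F := F) hE
  generalize ((α₀ ^ (Nat.card F - 1) : Eˣ) : E) = θ at hα
  have hli : ∀ e : E, e ∉ (algebraMap F E).range → LinearIndependent F ![1, e] := by
    intro e he
    rw [LinearIndependent.pair_iff]
    intro s t hst
    have ht : t = 0 := by
      by_contra ht
      refine he ⟨-s / t, ?_⟩
      have ht' : algebraMap F E t ≠ 0 := by simpa using ht
      rw [Algebra.smul_def, Algebra.smul_def] at hst
      rw [map_div₀, map_neg]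
      field_simp
      linear_combination -hst
    rw [ht, zero_smul, add_zero] at hst
    exact ⟨by simpa using hst, ht⟩
  let bas : ∀ e : E, e ∉ (algebraMap F E).range → Basis (Fin 2) F E := fun e he =>
    basisOfLinearIndependentOfCardEqFinrank (hli e he) (by simp [hE])
  let f : {e : E // e ∉ (algebraMap F E).range} → UnitFixing F E := fun e =>
    ⟨(bas θ hα).equiv (bas e.1 e.2) (Equiv.refl _), by
      have := (bas θ hα).equiv_apply 0 (bas e.1 e.2) (Equiv.refl _)
      simpa [bas] using this⟩
  have hf : Function.Injective f := by
    intro e e' h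
    have h1 : ∀ e : {e : E // e ∉ (algebraMap F E).range}, (f e).1 θ = e.1 := by
      intro e
      have := (bas θ hα).equiv_apply 1 (bas e.1 e.2) (Equiv.refl _)
      simpa [bas] using this
    exact Subtype.ext (by rw [← h1, h, h1])
  have h2 := Nat.card_le_card_of_injective f hf
  have h3 : Nat.card {e : E // e ∉ (algebraMap F E).range} = Nat.card E - Nat.card F := by
    have := Fintype.ofFinite E
    have := Fintype.ofFinite F
    classical
    rw [Nat.card_eq_fintype_card, Fintype.card_subtype_compl, ← Nat.card_eq_fintype_card,
      ← Nat.card_eq_fintype_card]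
    congr 1
    exact (Nat.card_congr (Equiv.ofInjective _ (algebraMap F E).injective)).symm
  rw [h3, hcE] at h2
  refine le_trans ?_ h2
  apply Nat.le_sub_of_add_le
  nlinarith

theorem card_algHom_le [Finite E] (hE : finrank F E = 2) : Nat.card (E →ₐ[F] E) ≤ 2 := by
  have : FiniteDimensional F E := Module.finite_of_finrank_pos (by omega)
  rw [Nat.card_eq_fintype_card, ← hE]
  exact AlgHom.card_le

end QuadraticBlocksCover

section QuadraticBlocksCount

open Module

variable {F E : Type*} [Field F] [Field E] [Algebra F E] {B : AddSubgroup (E →ₗ[F] E)}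

theorem map_mul_of_twistHom_mem [Finite E] (hE : finrank F E = 2) (hq : 3 ≤ Nat.card F)
    {β : Eˣ} (hβ : ∀ x, x ∈ Subgroup.zpowers β)
    (hαF : ((β ^ (Nat.card F - 1) : Eˣ) : E) ∉ (algebraMap F E).range)
    (hB : B ≠ ⊥) (hB' : B ≠ ⊤)
    (hR : ∀ ψ ∈ B, ∀ k : E, ψ ∘ₗ LinearMap.mulLeft F k ∈ B)
    (hL : ∀ ψ ∈ B, ∀ e : E, e • ψ ∈ B)
    {a b : E ≃ₗ[F] E} (ha : a 1 = 1) (hb : b 1 = 1)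
    (h : ∀ ψ ∈ B, twistHom (a * unitMul F (β ^ (Nat.card F - 1)) * a⁻¹)
      (b * unitMul F β * b⁻¹) ψ ∈ B) :
    (∀ x y, a (x * y) = a x * a y) ∧ ∀ x y, b (x * y) = b x * b y := by
  obtain ⟨hR', hL'⟩ := left_right_closed_of_twistHom_mem hE hq hβ hαF (twistHom_mem_untwist h)
  have hmem : ∀ ψ ∈ B, twistHom a⁻¹ b⁻¹ ψ ∈ untwist a b B := fun ψ hψ => by
    rwa [mem_untwist, twistHom_twistHom_inv]
  have haa : ∀ x, a (a⁻¹ x) = x := fun x => a.apply_symm_apply x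
  constructor
  · refine map_mul_of_normalizes ha fun k => ?_
    obtain ⟨k', hk'⟩ := exists_eq_mulLeft_of_left_closed hE hR hL hB hB'
      (g := a.toLinearMap ∘ₗ LinearMap.mulLeft F k ∘ₗ a.symm.toLinearMap) (fun ψ hψ => by
        have h1 := mem_untwist.1 (hL' _ (hmem ψ hψ) k)
        convert h1 using 1
        ext x
        change a (k * a.symm (ψ x)) = a (k * (a.symm (ψ (b (b.symm x)))))
        rw [LinearEquiv.apply_symm_apply])
    exact ⟨k', fun x => LinearMap.congr_fun hk' x⟩
  · refine map_mul_of_normalizes hb fun k => ?_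
    obtain ⟨k', hk'⟩ := exists_eq_mulLeft_of_right_closed hE hR hL hB hB'
      (g := b.toLinearMap ∘ₗ LinearMap.mulLeft F k ∘ₗ b.symm.toLinearMap) (fun ψ hψ => by
        have h1 := mem_untwist.1 (hR' _ (hmem ψ hψ) k)
        convert h1 using 1
        ext x
        change ψ (b (k * b.symm x)) = a (a.symm (ψ (b (k * b.symm x))))
        rw [LinearEquiv.apply_symm_apply])
    exact ⟨k', fun x => LinearMap.congr_fun hk' x⟩

/-- An automorphism fixing `1` and compatible with multiplication, as an algebra homomorphism. -/
def algHomOfMapMul (ρ : E ≃ₗ[F] E) (h1 : ρ 1 = 1) (h : ∀ x y, ρ (x * y) = ρ x * ρ y) :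
    E →ₐ[F] E := AlgHom.ofLinearMap ρ.toLinearMap h1 h

theorem le_card_of_cover_quadratic_blocks [Finite E] (hE : finrank F E = 2)
    (hq : 3 ≤ Nat.card F) {β : Eˣ} (hβ : ∀ x, x ∈ Subgroup.zpowers β)
    (hαF : ((β ^ (Nat.card F - 1) : Eˣ) : E) ∉ (algebraMap F E).range)
    (S : Finset (Subgroup ((E × E) ≃ₗ[F] (E × E)))) (hS : ∀ H ∈ S, H ≠ ⊤)
    (hcov : ∀ (a b : E ≃ₗ[F] E) g, ∃ H ∈ S,
      g * diag (a * unitMul F (β ^ (Nat.card F - 1)) * a⁻¹) (b * unitMul F β * b⁻¹) * g⁻¹ ∈ H) :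
    Nat.card F ^ 4 ≤ S.card := by
  have : Finite F := Finite.of_injective _ (algebraMap F E).injective
  have : FiniteDimensional F E := Module.finite_of_finrank_pos (by omega)
  have : Finite (E →ₗ[F] E) := DFunLike.finite _
  have : Finite (E ≃ₗ[F] E) := DFunLike.finite _
  have hcE : Nat.card E = Nat.card F ^ 2 := by
    rw [Module.natCard_eq_pow_finrank (K := F), hE]
  have hcA : Nat.card (E →ₗ[F] E) = Nat.card F ^ 4 := by rw [card_linearMap, hE]
  have hα := pow_card_sub_one_pow_card_add_one hE β
  set α := β ^ (Nat.card F - 1) with hαβ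
  have := Fintype.ofFinite (UnitFixing F E)
  have hne : Nonempty (UnitFixing F E) := ⟨⟨1, rfl⟩⟩
  refine le_card_of_cover_diag hE (I := UnitFixing F E × UnitFixing F E)
    (fun i => i.1.1 * unitMul F α * i.1.1⁻¹) (fun i => i.2.1 * unitMul F β * i.2.1⁻¹)
    (fun i => irreducible_conj (irreducible_unitMul_of_notMem hE hαF))
    (fun i => irreducible_conj (irreducible_unitMul_of_generator hβ))
    (fun i ψ h => eq_zero_of_twistHom_conj
      (twistHom_unitMul_eq_zero (q := Nat.card F) (by rw [hcE]; nlinarith) hα hβ) ψ h)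
    (fun i v => by rw [det_conj, det_conj]; exact mem_zpowers_det_unitMul hE hα hβ v)
    hcA.ge (fun B hB hB' => ?_) S hS fun i g => hcov _ _ g
  by_cases hex : ∃ i : UnitFixing F E × UnitFixing F E, ∀ ψ ∈ B, twistHom
      (i.1.1 * unitMul F α * i.1.1⁻¹) (i.2.1 * unitMul F β * i.2.1⁻¹) ψ ∈ B
  swap
  · have : IsEmpty {i : UnitFixing F E × UnitFixing F E // ∀ ψ ∈ B, twistHom
      (i.1.1 * unitMul F α * i.1.1⁻¹) (i.2.1 * unitMul F β * i.2.1⁻¹) ψ ∈ B} :=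
      ⟨fun i => hex ⟨i.1, i.2⟩⟩
    rw [Nat.card_of_isEmpty, zero_mul, zero_mul]
    exact Nat.zero_le _
  obtain ⟨i, hi⟩ := hex
  obtain ⟨hR, hL⟩ := left_right_closed_of_twistHom_mem hE hq hβ hαF (twistHom_mem_untwist hi)
  have hle := mul_card_le_of_right_closed hR (untwist_ne_top hB')
  rw [card_untwist, hcA, hcE] at hle
  have hfix : ∀ σ σ' : UnitFixing F E, (σ.1⁻¹ * σ'.1) 1 = 1 := fun σ σ' => by
    rw [LinearEquiv.mul_apply, σ'.2]
    exact inv_apply_of_eq σ.2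
  have hmul : ∀ j : UnitFixing F E × UnitFixing F E, (∀ ψ ∈ B, twistHom
      (j.1.1 * unitMul F α * j.1.1⁻¹) (j.2.1 * unitMul F β * j.2.1⁻¹) ψ ∈ B) →
      (∀ x y, (i.1.1⁻¹ * j.1.1) (x * y) = (i.1.1⁻¹ * j.1.1) x * (i.1.1⁻¹ * j.1.1) y) ∧
      ∀ x y, (i.2.1⁻¹ * j.2.1) (x * y) = (i.2.1⁻¹ * j.2.1) x * (i.2.1⁻¹ * j.2.1) y := by
    intro j hj
    refine map_mul_of_twistHom_mem hE hq hβ hαF (untwist_ne_bot hB) (untwist_ne_top hB') hR hL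
      (hfix _ _) (hfix _ _) (twistHom_mem_untwist fun ψ hψ => ?_)
    have hconj : ∀ x y c : E ≃ₗ[F] E, x * (x⁻¹ * y * c * (x⁻¹ * y)⁻¹) * x⁻¹ = y * c * y⁻¹ := by
      intro x y c
      group
    rw [hconj, hconj]
    exact hj ψ hψ
  let f : {j : UnitFixing F E × UnitFixing F E // ∀ ψ ∈ B, twistHom
      (j.1.1 * unitMul F α * j.1.1⁻¹) (j.2.1 * unitMul F β * j.2.1⁻¹) ψ ∈ B} →
      (E →ₐ[F] E) × (E →ₐ[F] E) := fun j =>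
    (algHomOfMapMul _ (hfix i.1 j.1.1) (hmul j.1 j.2).1,
      algHomOfMapMul _ (hfix i.2 j.1.2) (hmul j.1 j.2).2)
  have hf : Function.Injective f := by
    intro j j' h
    have h1 : ∀ x, (i.1.1⁻¹ * j.1.1.1) x = (i.1.1⁻¹ * j'.1.1.1) x := fun x =>
      DFunLike.congr_fun (congrArg Prod.fst h) x
    have h2 : ∀ x, (i.2.1⁻¹ * j.1.2.1) x = (i.2.1⁻¹ * j'.1.2.1) x := fun x =>
      DFunLike.congr_fun (congrArg Prod.snd h) x
    refine Subtype.ext (Prod.ext (Subtype.ext ?_) (Subtype.ext ?_))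
    · exact mul_left_cancel (LinearEquiv.ext h1)
    · exact mul_left_cancel (LinearEquiv.ext h2)
  have hcount := Nat.card_le_card_of_injective f hf
  rw [Nat.card_prod] at hcount
  have hcount4 := hcount.trans (Nat.mul_le_mul (card_algHom_le hE) (card_algHom_le hE))
  have hI := le_card_unitFixing hE hq
  rw [hcA, Fintype.card_prod, ← Nat.card_eq_fintype_card]
  calc _ ≤ (2 * 2) * Nat.card B * Nat.card F ^ 4 :=
        Nat.mul_le_mul_right _ (Nat.mul_le_mul_right _ hcount4)
    _ ≤ (2 * Nat.card F * (2 * Nat.card F)) * Nat.card F ^ 4 := by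
        refine Nat.mul_le_mul_right _ ?_
        have h1 : 0 < Nat.card F ^ 2 := by positivity
        have h2 : Nat.card B * Nat.card F ^ 2 ≤ Nat.card F ^ 2 * Nat.card F ^ 2 := by
          rw [← pow_add]; exact hle
        have := Nat.le_of_mul_le_mul_right h2 h1
        nlinarith
    _ ≤ _ := Nat.mul_le_mul_right _ (Nat.mul_le_mul hI hI)

end QuadraticBlocksCount

/-! ### Stabilizers of a vector and a covector -/

section PairStab

open Module

variable {F V : Type*} [Field F] [AddCommGroup V] [Module F V]

/-- The automorphisms fixing the vector `c` and the covector `φ`. -/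
def pairStab (c : V) (φ : Dual F V) : Subgroup (V ≃ₗ[F] V) where
  carrier := {g | g c = c ∧ ∀ x, φ (g x) = φ x}
  one_mem' := ⟨rfl, fun _ => rfl⟩
  mul_mem' := fun {g h} hg hh =>
    ⟨by rw [LinearEquiv.mul_apply, hh.1, hg.1], fun x => by
      rw [LinearEquiv.mul_apply, hg.2, hh.2]⟩
  inv_mem' := fun {g} hg => ⟨inv_apply_of_eq hg.1, fun x => by
    rw [← hg.2]
    exact congrArg φ (g.apply_symm_apply x)⟩

variable {c : V} {φ : Dual F V} {H : Subgroup (V ≃ₗ[F] V)}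

theorem memT_of_pairStab_le (hH : pairStab c φ ≤ H) {ψ : Dual F V} {u : V} (hψ : ψ c = 0)
    (hu : φ u = 0) (hψu : ψ u = 0) : MemT H ψ u := by
  refine ⟨LinearEquiv.transvection hψu, hH ⟨?_, fun x => ?_⟩, fun x => rfl⟩
  · change c + ψ c • u = c
    rw [hψ, zero_smul, add_zero]
  · change φ (x + ψ x • u) = φ x
    rw [map_add, map_smul, hu, smul_zero, add_zero]

theorem mem_span_pair_of_add {c u v : V} (hc : φ c = 1) (hu : φ u = 0) (hv : φ v = 0)
    (h : u ∈ Submodule.span F {c, v}) : u ∈ Submodule.span F {v} := by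
  obtain ⟨a, b, rfl⟩ := Submodule.mem_span_pair.1 h
  rw [map_add, map_smul, map_smul, hc, hv, smul_zero, add_zero, smul_eq_mul, mul_one] at hu
  rw [hu, zero_smul, zero_add]
  exact Submodule.smul_mem _ _ (Submodule.mem_span_singleton_self v)

/-- A subspace invariant under `pairStab c φ` lies in the line of `c` or contains the kernel
of `φ`. -/
theorem le_span_or_ker_le [FiniteDimensional F V] (hV : 4 ≤ finrank F V) (hc : φ c = 1)
    {X : Submodule F V}
    (hX : ∀ g ∈ pairStab c φ, ∀ x ∈ X, g x ∈ X) :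
    X ≤ Submodule.span F {c} ∨ LinearMap.ker φ ≤ X := by
  by_cases h : X ≤ Submodule.span F {c}
  · exact Or.inl h
  refine Or.inr ?_
  obtain ⟨x, hx, hxc⟩ := SetLike.not_le_iff_exists.1 h
  set u := x - φ x • c with hu
  have hφu : φ u = 0 := by rw [hu, map_sub, map_smul, hc, smul_eq_mul, mul_one, sub_self]
  have hu0 : u ≠ 0 := fun h0 => hxc (by
    rw [sub_eq_zero.1 h0]
    exact Submodule.smul_mem _ _ (Submodule.mem_span_singleton_self c))
  have hmem : ∀ v, φ v = 0 → v ∉ Submodule.span F {u} → v ∈ X := by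
    intro v hv hvu
    have huv : u ∉ Submodule.span F {c, v} := fun h1 => by
      obtain ⟨a, ha⟩ := Submodule.mem_span_singleton.1 (mem_span_pair_of_add hc hφu hv h1)
      have ha0 : a ≠ 0 := fun h2 => hu0 (by rw [← ha, h2, zero_smul])
      refine hvu (Submodule.mem_span_singleton.2 ⟨a⁻¹, ?_⟩)
      rw [← ha, smul_smul, inv_mul_cancel₀ ha0, one_smul]
    obtain ⟨ψ, hψ, hψ1⟩ := exists_dual_eq_one_of_notMem huv
    have hψc : ψ c = 0 := hψ c (Submodule.subset_span (by simp))
    have hψv : ψ v = 0 := hψ v (Submodule.subset_span (by simp))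
    obtain ⟨g, hg, hgx⟩ := memT_of_pairStab_le le_rfl hψc hv hψv
    have h1 : ψ x = 1 := by
      rw [← hψ1, hu, map_sub, map_smul, hψc, smul_zero, sub_zero]
    have h2 := X.sub_mem (hX g hg x hx) hx
    rwa [hgx, h1, one_smul, add_sub_cancel_left] at h2
  obtain ⟨v, hv, hvu⟩ : ∃ v ∈ LinearMap.ker φ, v ∉ Submodule.span F {u} := by
    refine SetLike.not_le_iff_exists.1 fun hle => ?_
    have h1 := Submodule.finrank_mono hle
    have h2 := finrank_span_singleton (K := F) hu0
    have h3 := LinearMap.finrank_range_add_finrank_ker φ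
    have h4 := Submodule.finrank_le (LinearMap.range φ)
    rw [finrank_self] at h4
    omega
  intro w hw
  by_cases hwu : w ∈ Submodule.span F {u}
  · have h1 : w + v ∉ Submodule.span F {u} := fun h2 => hvu (by
      simpa using Submodule.sub_mem _ h2 hwu)
    have h2 := hmem (w + v) (by rw [map_add, LinearMap.mem_ker.1 hw, LinearMap.mem_ker.1 hv,
      add_zero]) h1
    simpa using X.sub_mem h2 (hmem v hv hvu)
  · exact hmem w hw hwu

theorem exists_mem_det_eq_of_pairStab_le [FiniteDimensional F V] (hV : 4 ≤ finrank F V)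
    (hc : φ c = 1) (hH : pairStab c φ ≤ H) (u : Fˣ) : ∃ h ∈ H, LinearEquiv.det h = u := by
  obtain ⟨v, hv, hvc⟩ : ∃ v ∈ LinearMap.ker φ, v ≠ 0 := by
    refine (Submodule.ne_bot_iff _).1 fun h => ?_
    have h3 := LinearMap.finrank_range_add_finrank_ker φ
    have h4 := Submodule.finrank_le (LinearMap.range φ)
    rw [finrank_self] at h4
    rw [h, finrank_bot] at h3
    omega
  have hvs : v ∉ Submodule.span F {c} := fun h => by
    obtain ⟨a, rfl⟩ := Submodule.mem_span_singleton.1 h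
    rw [LinearMap.mem_ker, map_smul, hc, smul_eq_mul, mul_one] at hv
    exact hvc (by rw [hv, zero_smul])
  obtain ⟨ψ, hψ, hψ1⟩ := exists_dual_eq_one_of_notMem hvs
  have hψc : ψ c = 0 := hψ c (Submodule.mem_span_singleton_self c)
  have hd : (1 : F) + ψ (((u : F) - 1) • v) = u := by
    rw [map_smul, hψ1, smul_eq_mul, mul_one, add_sub_cancel]
  have hunit : IsUnit (1 + ψ (((u : F) - 1) • v)) := by rw [hd]; exact u.isUnit
  refine ⟨LinearEquiv.dilatransvection hunit, hH ⟨?_, fun x => ?_⟩, ?_⟩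
  · change c + ψ c • _ = c
    rw [hψc, zero_smul, add_zero]
  · change φ (x + ψ x • _) = φ x
    rw [map_add, map_smul, map_smul, LinearMap.mem_ker.1 hv, smul_zero, smul_zero, add_zero]
  · ext
    rw [LinearEquiv.coe_det]
    exact (LinearMap.transvection.det ψ _).trans hd

/-- A proper subgroup containing `pairStab c φ` fixes the line of `c` or that of `φ`. -/
theorem fixes_of_pairStab_le [FiniteDimensional F V] (hV : 4 ≤ finrank F V)
    (hc : φ c = 1) (hH : pairStab c φ ≤ H) (hne : H ≠ ⊤) :
    (∀ h ∈ H, h c ∈ Submodule.span F {c}) ∨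
      ∀ h ∈ H, ∀ x ∈ LinearMap.ker φ, h x ∈ LinearMap.ker φ := by
  by_contra! hcon
  obtain ⟨⟨h₁, hh₁, hc₁⟩, h₂, hh₂, y, hy, hy₂⟩ := hcon
  have hc0 : c ≠ 0 := by
    rintro rfl
    simp at hc
  have hirr : ∀ X : Submodule F V, (∀ h ∈ H, ∀ x ∈ X, h x ∈ X) → X = ⊥ ∨ X = ⊤ := by
    intro X hX
    rcases le_span_or_ker_le hV hc fun g hg => hX g (hH hg) with h | h
    · left
      rw [eq_bot_iff]
      intro x hx
      rw [Submodule.mem_bot]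
      obtain ⟨a, rfl⟩ := Submodule.mem_span_singleton.1 (h hx)
      by_contra hne
      have ha : a ≠ 0 := left_ne_zero_of_smul hne
      have hcX : c ∈ X := by
        have := X.smul_mem a⁻¹ hx
        rwa [smul_smul, inv_mul_cancel₀ ha, one_smul] at this
      exact hc₁ (h (hX _ hh₁ _ hcX))
    · right
      have h1 := hX _ hh₂ _ (h hy)
      have hdec : ∀ x, x - φ x • c ∈ X := fun x => h (by
        rw [LinearMap.mem_ker, map_sub, map_smul, hc, smul_eq_mul, mul_one, sub_self])
      have hcX : c ∈ X := by
        have h2 := X.smul_mem (φ (h₂ y))⁻¹ (X.sub_mem h1 (hdec (h₂ y)))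
        rwa [sub_sub_cancel, smul_smul, inv_mul_cancel₀ hy₂, one_smul] at h2
      rw [eq_top_iff]
      intro x _
      have := X.add_mem (hdec x) (X.smul_mem (φ x) hcX)
      rwa [sub_add_cancel] at this
  refine hne (eq_top_of_transvections ?_ (exists_mem_det_eq_of_pairStab_le hV hc hH))
  set φ' : Dual F V := φ ∘ₗ (h₁⁻¹).toLinearMap with hφ'
  obtain ⟨u, hu, huc⟩ : ∃ u ∈ LinearMap.ker (φ.prod φ'), u ∉ Submodule.span F {c, h₁ c} := by
    refine SetLike.not_le_iff_exists.1 fun hle => ?_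
    have h3 := LinearMap.finrank_range_add_finrank_ker (φ.prod φ')
    have h4 := Submodule.finrank_le (LinearMap.range (φ.prod φ'))
    rw [finrank_prod, finrank_self] at h4
    have h5 : finrank F (Submodule.span F {c, h₁ c}) ≤ 2 := by
      classical
      have := finrank_span_finset_le_card (R := F) ({c, h₁ c} : Finset V)
      rw [Finset.coe_pair] at this
      exact this.trans Finset.card_le_two
    have h6 := Submodule.eq_of_le_of_finrank_le hle (by omega)
    have h7 : c ∈ LinearMap.ker (φ.prod φ') := h6 ▸ Submodule.subset_span (by simp)
    have h8 : φ c = 0 := congrArg Prod.fst (LinearMap.mem_ker.1 h7)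
    rw [hc] at h8
    exact one_ne_zero h8
  have hu1 : φ u = 0 := congrArg Prod.fst (LinearMap.mem_ker.1 hu)
  have hu2 : φ (h₁⁻¹ u) = 0 := congrArg Prod.snd (LinearMap.mem_ker.1 hu)
  refine memT_of_irreducible hirr (c := u) (fun h => huc (h ▸ Submodule.zero_mem _)) ?_
  intro ψ hψ
  obtain ⟨ψ₁, ψ₂, h1, h2, rfl⟩ := exists_dual_add_of_inf_le (φ := ψ)
    (Y := Submodule.span F {c, u}) (Y' := Submodule.span F {h₁ c, u}) (by
      rintro x ⟨hx, hx'⟩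
      obtain ⟨a, b, rfl⟩ := Submodule.mem_span_pair.1 hx
      obtain ⟨a', b', hab⟩ := Submodule.mem_span_pair.1 hx'
      have hbb : b = b' := by
        by_contra hbb
        have hbb : b - b' ≠ 0 := sub_ne_zero.2 hbb
        refine huc (Submodule.mem_span_pair.2 ⟨(b - b')⁻¹ * -a, (b - b')⁻¹ * a', ?_⟩)
        rw [mul_smul, mul_smul, ← smul_add, inv_smul_eq_iff₀ hbb, sub_smul]
        rw [neg_smul, neg_add_eq_sub, sub_eq_sub_iff_add_eq_add, hab, add_comm]
      subst hbb
      have h3 : a' • h₁ c = a • c := add_right_cancel hab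
      have ha' : a' = 0 := by
        by_contra ha'
        refine hc₁ (Submodule.mem_span_singleton.2 ⟨a'⁻¹ * a, ?_⟩)
        rw [mul_smul, ← h3, inv_smul_smul₀ ha']
      rw [ha', zero_smul] at h3
      rw [← h3, zero_add, map_smul, hψ, smul_zero])
  refine MemT.add_left ?_ ?_ (h1 u (Submodule.subset_span (by simp)))
  · exact memT_of_pairStab_le hH (h1 c (Submodule.subset_span (by simp))) hu1
      (h1 u (Submodule.subset_span (by simp)))
  · have h3 := memT_of_pairStab_le hH (ψ := ψ₂ ∘ₗ h₁.toLinearMap) (u := h₁⁻¹ u)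
      (h2 _ (Submodule.subset_span (by simp))) hu2
      ((congrArg ψ₂ (h₁.apply_symm_apply u)).trans (h2 _ (Submodule.subset_span (by simp))))
    have h4 := h3.conj hh₁
    have h5 : h₁ (h₁⁻¹ u) = u := h₁.apply_symm_apply u
    rw [h5] at h4
    convert h4 using 1
    ext x
    exact (congrArg ψ₂ (h₁.apply_symm_apply x)).symm

end PairStab

section PairStabCover

open Module

variable {F V W : Type*} [Field F] [AddCommGroup V] [Module F V] [AddCommGroup W] [Module F W]

/-- Isomorphic modules have isomorphic automorphism groups. -/
def autMulEquiv (e : V ≃ₗ[F] W) : (V ≃ₗ[F] V) ≃* (W ≃ₗ[F] W) where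
  toFun g := (e.symm.trans g).trans e
  invFun g := (e.trans g).trans e.symm
  left_inv g := by ext x; simp
  right_inv g := by ext x; simp
  map_mul' g h := by ext x; simp

theorem CoverBound.of_finrank_eq [FiniteDimensional F V] [FiniteDimensional F W] {t : ℕ}
    (h : CoverBound (V ≃ₗ[F] V) t) (hVW : finrank F V = finrank F W) :
    CoverBound (W ≃ₗ[F] W) t :=
  h.of_mulEquiv (autMulEquiv (LinearEquiv.ofFinrankEq V W hVW))

variable {c : V} {φ : Dual F V}

/-- The projection onto the kernel of `φ` along `c`. -/
def kerProj (hc : φ c = 1) : V →ₗ[F] LinearMap.ker φ :=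
  (LinearMap.id - φ.smulRight c).codRestrict _ fun x => by simp [hc]

theorem coe_kerProj (hc : φ c = 1) (x : V) : (kerProj hc x : V) = x - φ x • c := rfl

theorem kerProj_add (hc : φ c = 1) (a : F) (u : LinearMap.ker φ) :
    kerProj hc (a • c + u) = u := by
  ext
  rw [coe_kerProj, map_add, map_smul, hc, LinearMap.mem_ker.1 u.2, smul_eq_mul, mul_one, add_zero,
    add_sub_cancel_left]

theorem apply_smul_add (hc : φ c = 1) (a : F) (u : LinearMap.ker φ) : φ (a • c + u) = a := by
  rw [map_add, map_smul, hc, LinearMap.mem_ker.1 u.2, smul_eq_mul, mul_one, add_zero]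

/-- An automorphism of the kernel of `φ`, extended by fixing `c`. -/
def extendKer (hc : φ c = 1) : (LinearMap.ker φ ≃ₗ[F] LinearMap.ker φ) →* (V ≃ₗ[F] V) where
  toFun g :=
    { φ.smulRight c + (LinearMap.ker φ).subtype ∘ₗ g.toLinearMap ∘ₗ kerProj hc with
      invFun := fun x => φ x • c + (g.symm (kerProj hc x) : V)
      left_inv := fun x => by
        change φ (φ x • c + (g (kerProj hc x) : V)) • c +
          (g.symm (kerProj hc (φ x • c + (g (kerProj hc x) : V))) : V) = x
        rw [apply_smul_add hc, kerProj_add, LinearEquiv.symm_apply_apply, coe_kerProj,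
          add_sub_cancel]
      right_inv := fun x => by
        change φ (φ x • c + (g.symm (kerProj hc x) : V)) • c +
          (g (kerProj hc (φ x • c + (g.symm (kerProj hc x) : V))) : V) = x
        rw [apply_smul_add hc, kerProj_add, LinearEquiv.apply_symm_apply, coe_kerProj,
          add_sub_cancel] }
  map_one' := by
    ext x
    change φ x • c + (kerProj hc x : V) = x
    rw [coe_kerProj, add_sub_cancel]
  map_mul' g h := by
    ext x
    change φ x • c + (g (h (kerProj hc x)) : V) = φ (φ x • c + (h (kerProj hc x) : V)) • c +
      (g (kerProj hc (φ x • c + (h (kerProj hc x) : V))) : V)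
    rw [apply_smul_add hc, kerProj_add]

theorem extendKer_apply (hc : φ c = 1) (g : LinearMap.ker φ ≃ₗ[F] LinearMap.ker φ) (x : V) :
    extendKer hc g x = φ x • c + (g (kerProj hc x) : V) := rfl

theorem pairStab_le_range_extendKer (hc : φ c = 1) : pairStab c φ ≤ (extendKer hc).range := by
  intro h hh
  have hinv := (pairStab c φ).inv_mem hh
  refine ⟨LinearEquiv.ofLinearMap
    (h.toLinearMap.restrict (p := LinearMap.ker φ) (q := LinearMap.ker φ) fun x hx => by
      rw [LinearMap.mem_ker] at hx ⊢; rw [← hx]; exact hh.2 x)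
    ((h⁻¹).toLinearMap.restrict (p := LinearMap.ker φ) (q := LinearMap.ker φ) fun x hx => by
      rw [LinearMap.mem_ker] at hx ⊢; rw [← hx]; exact hinv.2 x) ?_ ?_, ?_⟩
  · ext x
    exact h.apply_symm_apply x
  · ext x
    exact h.symm_apply_apply x
  · ext x
    rw [extendKer_apply]
    change φ x • c + h (x - φ x • c) = h x
    rw [map_sub, map_smul, hh.1, add_sub_cancel]

theorem exists_pairStab_le [FiniteDimensional F V] [FiniteDimensional F W]
    (hVW : finrank F V = finrank F W + 1) {t : ℕ} (hW : CoverBound (W ≃ₗ[F] W) t)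
    {S : Finset (Subgroup (V ≃ₗ[F] V))} (hS : ∀ g, ∃ H ∈ S, g ∈ H) (ht : S.card < t)
    (hc : φ c = 1) : ∃ H ∈ S, pairStab c φ ≤ H := by
  have hker : finrank F W = finrank F (LinearMap.ker φ) := by
    have h3 := LinearMap.finrank_range_add_finrank_ker φ
    rw [LinearMap.range_eq_top.2 fun a => ⟨a • c, by simp [hc]⟩, finrank_top, finrank_self] at h3
    omega
  by_contra! hno
  exact absurd ((hW.of_finrank_eq hker).le_card_of_hom (extendKer hc) hS fun H hH hle =>
    hno H hH ((pairStab_le_range_extendKer hc).trans hle)) (by omega)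

theorem mem_span_or_ker_eq_of_pairStab_le [FiniteDimensional F V] (hV : 4 ≤ finrank F V)
    {H : Subgroup (V ≃ₗ[F] V)} (hH : H ≠ ⊤) {c' : V} {φ' : Dual F V} (hc : φ c = 1)
    (hc' : φ' c' = 1) (h : pairStab c φ ≤ H) (h' : pairStab c' φ' ≤ H) :
    c ∈ Submodule.span F {c'} ∨ LinearMap.ker φ = LinearMap.ker φ' := by
  have hker : ∀ {φ : Dual F V} {c : V}, φ c = 1 →
      finrank F (LinearMap.ker φ) + 1 = finrank F V := by
    intro φ c hc
    have h3 := LinearMap.finrank_range_add_finrank_ker φ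
    rw [LinearMap.range_eq_top.2 fun a => ⟨a • c, by simp [hc]⟩, finrank_top, finrank_self] at h3
    omega
  have hspan : ∀ c : V, finrank F (Submodule.span F {c}) ≤ 1 := fun c => by
    have := finrank_span_finset_le_card (R := F) ({c} : Finset V)
    rwa [Finset.coe_singleton, Finset.card_singleton] at this
  have hk := hker hc
  have hk' := hker hc'
  rcases fixes_of_pairStab_le hV hc h hH with hfix | hfix
  · rcases le_span_or_ker_le hV hc' (X := Submodule.span F {c}) (fun g hg x hx => by
      obtain ⟨a, rfl⟩ := Submodule.mem_span_singleton.1 hx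
      rw [map_smul]
      exact Submodule.smul_mem _ _ (hfix g (h' hg))) with hle | hle
    · exact Or.inl (hle (Submodule.mem_span_singleton_self c))
    · have := Submodule.finrank_mono hle
      have := hspan c
      omega
  · rcases le_span_or_ker_le hV hc' (X := LinearMap.ker φ) (fun g hg => hfix g (h' hg))
      with hle | hle
    · have := Submodule.finrank_mono hle
      have := hspan c'
      omega
    · exact Or.inr (Submodule.eq_of_le_of_finrank_le hle (by omega)).symm

end PairStabCover

section FourDimensional

open Module

variable {F E : Type*} [Field F] [AddCommGroup E] [Module F E]

theorem not_diag_fixes_line (hE : finrank F E = 2) {a b : E ≃ₗ[F] E}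
    (ha : ∀ U : Submodule F E, (∀ x ∈ U, a x ∈ U) → U = ⊥ ∨ U = ⊤)
    (hb : ∀ U : Submodule F E, (∀ x ∈ U, b x ∈ U) → U = ⊥ ∨ U = ⊤) {v : E × E} (hv : v ≠ 0) :
    diag a b v ∉ Submodule.span F {v} := by
  intro h
  obtain ⟨t, ht⟩ := Submodule.mem_span_singleton.1 h
  have key : ∀ {a : E ≃ₗ[F] E}, (∀ U : Submodule F E, (∀ x ∈ U, a x ∈ U) → U = ⊥ ∨ U = ⊤) →
      ∀ x, t • x = a x → x = 0 := by
    intro a ha x hx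
    by_contra hx0
    have h1 := finrank_span_singleton (K := F) hx0
    rcases ha (Submodule.span F {x}) (fun y hy => by
      obtain ⟨s, rfl⟩ := Submodule.mem_span_singleton.1 hy
      rw [map_smul, ← hx]
      exact Submodule.smul_mem _ _ (Submodule.smul_mem _ _
        (Submodule.mem_span_singleton_self x))) with h2 | h2
    · rw [h2, finrank_bot] at h1
      omega
    · rw [h2, finrank_top] at h1
      omega
  exact hv (Prod.ext (key ha _ (congrArg Prod.fst ht)) (key hb _ (congrArg Prod.snd ht)))

theorem not_diag_fixes_hyperplane [FiniteDimensional F E] (hE : finrank F E = 2)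
    {a b : E ≃ₗ[F] E}
    (ha : ∀ U : Submodule F E, (∀ x ∈ U, a x ∈ U) → U = ⊥ ∨ U = ⊤)
    (hb : ∀ U : Submodule F E, (∀ x ∈ U, b x ∈ U) → U = ⊥ ∨ U = ⊤) {φ : Dual F (E × E)}
    (hφ : φ ≠ 0) (h : ∀ v ∈ LinearMap.ker φ, diag a b v ∈ LinearMap.ker φ) : False := by
  have key : ∀ {a : E ≃ₗ[F] E} {f : Dual F E},
      (∀ U : Submodule F E, (∀ x ∈ U, a x ∈ U) → U = ⊥ ∨ U = ⊤) →
      (∀ x ∈ LinearMap.ker f, a x ∈ LinearMap.ker f) → f = 0 := by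
    intro a f ha hf
    rcases ha _ hf with h1 | h1
    · have h3 := LinearMap.finrank_range_add_finrank_ker f
      have h4 := Submodule.finrank_le (LinearMap.range f)
      rw [finrank_self] at h4
      rw [h1, finrank_bot] at h3
      omega
    · exact LinearMap.ker_eq_top.1 h1
  have h1 : φ ∘ₗ LinearMap.inl F E E = 0 := key ha fun x hx => by
    have := h (x, 0) hx
    change φ (a x, b 0) = 0 at this
    rwa [map_zero] at this
  have h2 : φ ∘ₗ LinearMap.inr F E E = 0 := key hb fun x hx => by
    have := h (0, x) hx
    change φ (a 0, b x) = 0 at this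
    rwa [map_zero] at this
  exact hφ (LinearMap.prod_ext h1 h2)

end FourDimensional

section FourDimensionalCover

open Module

variable {F E L W : Type*} [Field F] [Field E] [Algebra F E] [Field L] [Algebra F L]
  [AddCommGroup W] [Module F W]

/-- In a cover with few members the pair stabilizers attached to the points of `ℙ F L` lie in
distinct members. -/
theorem exists_injective_pairStab_le {V : Type*} [AddCommGroup V] [Module F V] [Finite L]
    [FiniteDimensional F W] (e : L ≃ₗ[F] V) (hL : finrank F L = 4)
    (hW3 : finrank F W = 3) {t : ℕ} (hW : CoverBound (W ≃ₗ[F] W) t)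
    {S : Finset (Subgroup (V ≃ₗ[F] V))} (hS : IsSubgroupCover S) (ht : S.card < t) :
    ∃ Φ : Projectivization F L → Subgroup (V ≃ₗ[F] V), Function.Injective Φ ∧
      ∀ i, Φ i ∈ S ∧ ∃ (c : V) (φ : Dual F V), φ c = 1 ∧ pairStab c φ ≤ Φ i := by
  have : Finite F := Finite.of_injective _ (algebraMap F L).injective
  have : FiniteDimensional F L := Module.finite_of_finrank_pos (by omega)
  have : FiniteDimensional F V := e.finiteDimensional
  have hV : finrank F V = 4 := by rw [← e.finrank_eq, hL]
  obtain ⟨w, hw⟩ := Algebra.trace_surjective F L 1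
  have hw0 : w ≠ 0 := by
    rintro rfl
    rw [map_zero] at hw
    exact zero_ne_one hw
  let c : Projectivization F L → V := fun i => e i.rep
  let φ : Projectivization F L → Dual F V := fun i =>
    Algebra.traceForm F L (w * i.rep⁻¹) ∘ₗ e.symm.toLinearMap
  have hφ : ∀ i x, φ i (e x) = Algebra.trace F L (w * i.rep⁻¹ * x) := fun i x => by
    change Algebra.trace F L (w * i.rep⁻¹ * e.symm (e x)) = _
    rw [LinearEquiv.symm_apply_apply]
  have hc : ∀ i, φ i (c i) = 1 := fun i => by
    rw [hφ, mul_assoc, inv_mul_cancel₀ i.rep_nonzero, mul_one, hw]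
  choose Φ hΦS hΦ using fun i => exists_pairStab_le (by omega) hW hS.2 ht (hc i)
  refine ⟨Φ, fun i j hij => ?_, fun i => ⟨hΦS i, c i, φ i, hc i, hΦ i⟩⟩
  have hrep : ∀ a : F, a • j.rep = i.rep → i = j := by
    intro a ha
    rw [← i.mk_rep, ← j.mk_rep, Projectivization.mk_eq_mk_iff']
    exact ⟨a, ha⟩
  rcases mem_span_or_ker_eq_of_pairStab_le (by omega) (hS.1 _ (hΦS i)) (hc i) (hc j) (hΦ i)
    (hij ▸ hΦ j) with h | h
  · obtain ⟨a, ha⟩ := Submodule.mem_span_singleton.1 h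
    exact hrep a (e.injective (by rw [map_smul]; exact ha))
  · refine hrep (φ j (c i)) ?_
    have h1 : ∀ x, Algebra.trace F L ((w * j.rep⁻¹ - φ j (c i) • (w * i.rep⁻¹)) * x) = 0 := by
      intro x
      have h2 : e x - φ i (e x) • c i ∈ LinearMap.ker (φ j) := h ▸ by
        rw [LinearMap.mem_ker, map_sub, map_smul, hc, smul_eq_mul, mul_one, sub_self]
      rw [LinearMap.mem_ker, map_sub, map_smul, hφ, hφ, smul_eq_mul] at h2
      rw [sub_mul, smul_mul_assoc, map_sub, map_smul, smul_eq_mul, ← h2]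
      ring
    have h2 := sub_eq_zero.1 (eq_zero_of_trace_mul_eq_zero h1)
    rw [← mul_smul_comm] at h2
    have h3 := mul_left_cancel₀ hw0 h2
    have hi := i.rep_nonzero
    have hj := j.rep_nonzero
    rw [Algebra.smul_def] at h3 ⊢
    field_simp at h3
    rw [h3, mul_comm]

theorem coverBound_of_quadratic_blocks [Finite E] [Finite L] [FiniteDimensional F W]
    (hE : finrank F E = 2) (hL : finrank F L = 4) (hW3 : finrank F W = 3) (hq : 3 ≤ Nat.card F)
    {t : ℕ} (hW : CoverBound (W ≃ₗ[F] W) t)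
    (ht : t ≤ Nat.card F ^ 4 + Nat.card (Projectivization F L)) :
    CoverBound ((E × E) ≃ₗ[F] (E × E)) t := by
  classical
  intro S hS
  by_contra! hlt
  have : Finite F := Finite.of_injective _ (algebraMap F L).injective
  have : FiniteDimensional F L := Module.finite_of_finrank_pos (by omega)
  have : FiniteDimensional F E := Module.finite_of_finrank_pos (by omega)
  have hV : finrank F (E × E) = 4 := by rw [finrank_prod, hE]
  obtain ⟨Φ, hinj, hΦ⟩ := exists_injective_pairStab_le
    (LinearEquiv.ofFinrankEq L (E × E) (by rw [hL, hV])) hL hW3 hW hS hlt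
  obtain ⟨β, hβ, hαF⟩ := exists_pow_eq_one_notMem (F := F) hE
  let R : Finset (Subgroup ((E × E) ≃ₗ[F] (E × E))) := S.filter fun H => ∃ i, Φ i = H
  have hRcard : Nat.card (Projectivization F L) ≤ R.card := by
    have h1 := Nat.card_le_card_of_injective
      (fun i => (⟨Φ i, Finset.mem_filter.2 ⟨(hΦ i).1, i, rfl⟩⟩ : R))
      fun i j hij => hinj (Subtype.mk.inj hij)
    rwa [Nat.card_eq_fintype_card (α := R), Fintype.card_coe] at h1
  have hrest := le_card_of_cover_quadratic_blocks hE hq hβ hαF (S \ R)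
    (fun H hH => hS.1 H (Finset.sdiff_subset hH)) (fun a b g => by
      obtain ⟨H, hH, hg⟩ := hS.2
        (g * diag (a * unitMul F (β ^ (Nat.card F - 1)) * a⁻¹) (b * unitMul F β * b⁻¹) * g⁻¹)
      refine ⟨H, Finset.mem_sdiff.2 ⟨hH, fun hR => ?_⟩, hg⟩
      obtain ⟨-, i, rfl⟩ := Finset.mem_filter.1 hR
      obtain ⟨-, c, φ, hc, hle⟩ := hΦ i
      have ha' : ∀ U : Submodule F E, (∀ x ∈ U,
          (a * unitMul F (β ^ (Nat.card F - 1)) * a⁻¹) x ∈ U) → U = ⊥ ∨ U = ⊤ :=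
        irreducible_conj (irreducible_unitMul_of_notMem hE hαF)
      have hb' : ∀ U : Submodule F E, (∀ x ∈ U,
          (b * unitMul F β * b⁻¹) x ∈ U) → U = ⊥ ∨ U = ⊤ :=
        irreducible_conj (irreducible_unitMul_of_generator hβ)
      rcases fixes_of_pairStab_le (by omega) hc hle (hS.1 _ hH) with h | h
      · have h1 := h _ hg
        have hc0 : g⁻¹ c ≠ 0 := fun h0 => by
          have : c = 0 := g.symm.map_eq_zero_iff.1 h0
          rw [this, map_zero] at hc
          exact zero_ne_one hc
        refine not_diag_fixes_line hE ha' hb' hc0 ?_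
        obtain ⟨s, hs⟩ := Submodule.mem_span_singleton.1 h1
        refine Submodule.mem_span_singleton.2 ⟨s, ?_⟩
        apply g.injective
        rw [map_smul, ← LinearEquiv.mul_apply g g⁻¹, mul_inv_cancel]
        exact hs
      · refine not_diag_fixes_hyperplane hE ha' hb' (φ := φ ∘ₗ g.toLinearMap) (fun h0 => ?_)
          fun v hv => ?_
        · have h2 := LinearMap.congr_fun h0 (g⁻¹ c)
          have h3 : g (g⁻¹ c) = c := g.apply_symm_apply c
          change φ (g (g⁻¹ c)) = 0 at h2
          rw [h3, hc] at h2
          exact one_ne_zero h2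
        · have h2 := h _ hg (g v) hv
          have h3 : g⁻¹ (g v) = v := g.symm_apply_apply v
          rw [LinearEquiv.mul_apply, h3] at h2
          exact h2)
  have hRS : R ⊆ S := Finset.filter_subset _ _
  have := Finset.card_sdiff_add_card_eq_card hRS
  omega

end FourDimensionalCover

section BitMatrices

open Module

/-- The matrix over the field with two elements whose entries are the binary digits of `a`. -/
def bitMat (n a : ℕ) : Matrix (Fin n) (Fin n) (ZMod 2) :=
  Matrix.of fun i j => if a.testBit (n * i + j) then 1 else 0

/-- The first terms of the dot product of row `i` of `bitMat n a` with column `k` of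
`bitMat n b`. -/
def bitDot (n a b i k : ℕ) : ℕ → Bool
  | 0 => false
  | m + 1 => (bitDot n a b i k m).xor (a.testBit (n * i + m) && b.testBit (n * m + k))

/-- The code of the product of two matrices given by codes. -/
def bitMul (n a b : ℕ) : ℕ :=
  Nat.ofBits fun p : Fin (n * n) => bitDot n a b (p / n) (p % n) n

/-- The code of the identity matrix. -/
def bitOne (n : ℕ) : ℕ :=
  Nat.ofBits fun p : Fin (n * n) => (p / n : ℕ) == p % n

/-- The code of a power of a matrix given by its code. -/
def bitPow (n a : ℕ) : ℕ → ℕ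
  | 0 => bitOne n
  | k + 1 => bitMul n a (bitPow n a k)

/-- The code of a product of powers taken alternately from two matrices. -/
def bitWord (n : ℕ) : ℕ → ℕ → List ℕ → ℕ
  | _, _, [] => bitOne n
  | x, y, k :: l => bitMul n (bitPow n x k) (bitWord n y x l)

theorem testBit_ofBits_mul_add {n : ℕ} (f : ℕ → ℕ → Bool) (i j : Fin n) :
    (Nat.ofBits fun p : Fin (n * n) => f (p / n) (p % n)).testBit (n * i + j) = f i j := by
  have hn : 0 < n := i.pos
  have hlt : n * i + j < n * n := by
    have h1 := i.isLt
    have h2 := j.isLt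
    nlinarith
  rw [Nat.testBit_ofBits_lt _ _ hlt]
  simp only
  rw [Nat.mul_add_div hn, Nat.div_eq_of_lt j.isLt, Nat.mul_add_mod, Nat.mod_eq_of_lt j.isLt,
    add_zero]

theorem bitMat_bitOne (n : ℕ) : bitMat n (bitOne n) = 1 := by
  ext i j
  have h : (bitOne n).testBit (n * i + j) = ((i : ℕ) == j) :=
    testBit_ofBits_mul_add (fun a b => a == b) i j
  simp [bitMat, h, Matrix.one_apply, Fin.ext_iff]

theorem ite_bitDot (n a b i k m : ℕ) :
    (if bitDot n a b i k m then 1 else 0 : ZMod 2) =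
      ∑ j ∈ Finset.range m, (if a.testBit (n * i + j) then 1 else 0) *
        (if b.testBit (n * j + k) then 1 else 0) := by
  induction m with
  | zero => simp [bitDot]
  | succ m ih =>
    rw [Finset.sum_range_succ, ← ih, bitDot]
    cases bitDot n a b i k m <;> cases a.testBit (n * i + m) <;>
      cases b.testBit (n * m + k) <;> decide

theorem bitMat_bitMul (n a b : ℕ) : bitMat n (bitMul n a b) = bitMat n a * bitMat n b := by
  ext i k
  have h : (bitMul n a b).testBit (n * i + k) = bitDot n a b i k n :=
    testBit_ofBits_mul_add (fun i k => bitDot n a b i k n) i k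
  simp only [Matrix.mul_apply, bitMat, Matrix.of_apply, h]
  rw [ite_bitDot, Finset.sum_range]

/-- The automorphism `g` is given by the matrix with code `a`. -/
def HasCode {n : ℕ} (g : (Fin n → ZMod 2) ≃ₗ[ZMod 2] (Fin n → ZMod 2)) (a : ℕ) : Prop :=
  (g : (Fin n → ZMod 2) →ₗ[ZMod 2] (Fin n → ZMod 2)) = Matrix.toLin' (bitMat n a)

variable {n : ℕ} {g h : (Fin n → ZMod 2) ≃ₗ[ZMod 2] (Fin n → ZMod 2)} {a b : ℕ}

theorem HasCode.eq (hg : HasCode g a) (hh : HasCode h a) : g = h :=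
  LinearEquiv.toLinearMap_injective (hg.trans hh.symm)

theorem HasCode.apply (hg : HasCode g a) (x : Fin n → ZMod 2) :
    g x = (bitMat n a).mulVec x := by
  rw [← Matrix.toLin'_apply, ← hg]
  rfl

theorem HasCode.mul (hg : HasCode g a) (hh : HasCode h b) : HasCode (g * h) (bitMul n a b) := by
  unfold HasCode at *
  rw [bitMat_bitMul, Matrix.toLin'_mul, ← hg, ← hh]
  rfl

theorem HasCode.one : HasCode (1 : (Fin n → ZMod 2) ≃ₗ[ZMod 2] (Fin n → ZMod 2)) (bitOne n) := by
  unfold HasCode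
  rw [bitMat_bitOne, Matrix.toLin'_one]
  rfl

theorem HasCode.pow (hg : HasCode g a) (k : ℕ) : HasCode (g ^ k) (bitPow n a k) := by
  induction k with
  | zero => exact HasCode.one
  | succ k ih =>
    rw [pow_succ']
    exact hg.mul ih

theorem HasCode.exists_word {H : Subgroup ((Fin n → ZMod 2) ≃ₗ[ZMod 2] (Fin n → ZMod 2))}
    (hg : HasCode g a) (hh : HasCode h b) (hgH : g ∈ H) (hhH : h ∈ H) (l : List ℕ) :
    ∃ w ∈ H, HasCode w (bitWord n a b l) := by
  induction l generalizing g h a b with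
  | nil => exact ⟨1, H.one_mem, HasCode.one⟩
  | cons k l ih =>
    obtain ⟨w, hw, hwc⟩ := ih hh hg hhH hgH
    exact ⟨g ^ k * w, H.mul_mem (H.pow_mem hgH k) hw, (hg.pow k).mul hwc⟩

theorem exists_hasCode (hab : bitMul n a b = bitOne n) :
    ∃ g : (Fin n → ZMod 2) ≃ₗ[ZMod 2] (Fin n → ZMod 2), HasCode g a ∧ HasCode g⁻¹ b := by
  have h1 : bitMat n a * bitMat n b = 1 := by rw [← bitMat_bitMul, hab, bitMat_bitOne]
  have h2 : bitMat n b * bitMat n a = 1 := mul_eq_one_comm.mp h1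
  refine ⟨LinearEquiv.ofLinearMap (Matrix.toLin' (bitMat n a)) (Matrix.toLin' (bitMat n b)) ?_ ?_,
    rfl, rfl⟩
  · rw [← Matrix.toLin'_mul, h1, Matrix.toLin'_one]
  · rw [← Matrix.toLin'_mul, h2, Matrix.toLin'_one]

theorem eq_top_of_map_conj_eq_top {G : Type*} [Group G] {k : G} {H : Subgroup G}
    (hH : H.map (MulAut.conj k).toMonoidHom = ⊤) : H = ⊤ := by
  rw [eq_top_iff]
  intro u _
  have : k * u * k⁻¹ ∈ H.map (MulAut.conj k).toMonoidHom := by rw [hH]; trivial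
  obtain ⟨u', hu', he⟩ := this
  have he' : k * u' * k⁻¹ = k * u * k⁻¹ := he
  rwa [mul_left_cancel (mul_right_cancel he')] at hu'

/-- The data `(k, k', l, l')` certify that the matrices with codes `x` and `y` generate a
conjugate of `s` together with a transvection whose direction is fixed. -/
def pairCheck (n s x y : ℕ) (c : ℕ × ℕ × List ℕ × List ℕ) : Bool :=
  bitMul n c.1 c.2.1 == bitOne n &&
    bitMul n (bitMul n c.1 (bitWord n x y c.2.2.1)) c.2.1 == s &&
    (List.range (2 ^ (n - 1))).any fun f =>
      0 < f && bitMul n (bitMul n c.1 (bitWord n x y c.2.2.2)) c.2.1 == bitOne n ^^^ (2 * f)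

/-- The cyclic matrix with code `s` generates the whole group with every transvection in the
direction of the first basis vector. -/
def IsSingerCode (n s : ℕ) : Prop :=
  ∀ (H : Subgroup ((Fin n → ZMod 2) ≃ₗ[ZMod 2] (Fin n → ZMod 2))), ∀ g ∈ H, ∀ t ∈ H,
    HasCode g s → ∀ f, 0 < f → f < 2 ^ (n - 1) → HasCode t (bitOne n ^^^ (2 * f)) → H = ⊤

theorem IsSingerCode.eq_top {s x y : ℕ} (hs : IsSingerCode n s)
    {c : ℕ × ℕ × List ℕ × List ℕ} (hc : pairCheck n s x y c = true)
    {H : Subgroup ((Fin n → ZMod 2) ≃ₗ[ZMod 2] (Fin n → ZMod 2))} (hgH : g ∈ H) (hhH : h ∈ H)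
    (hg : HasCode g x) (hh : HasCode h y) : H = ⊤ := by
  simp only [pairCheck, Bool.and_eq_true, beq_iff_eq, List.any_eq_true, List.mem_range,
    decide_eq_true_eq] at hc
  obtain ⟨⟨hk, h1⟩, f, hf, hf0, h2⟩ := hc
  obtain ⟨k, hkc, hkc'⟩ := exists_hasCode hk
  obtain ⟨w, hw, hwc⟩ := hg.exists_word hh hgH hhH c.2.2.1
  obtain ⟨v, hv, hvc⟩ := hg.exists_word hh hgH hhH c.2.2.2
  have hmem : ∀ u ∈ H, k * u * k⁻¹ ∈ H.map (MulAut.conj k).toMonoidHom := fun u hu =>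
    ⟨u, hu, rfl⟩
  exact eq_top_of_map_conj_eq_top <| hs _ _ (hmem w hw) _ (hmem v hv)
    (h1 ▸ (hkc.mul hwc).mul hkc') f hf0 hf
    (h2 ▸ (hkc.mul hvc).mul hkc')

/-- A family of group elements no two of which lie in a common proper subgroup bounds the size of
a cover from below. -/
theorem coverBound_of_clique {G ι : Type*} [Group G] [Finite ι] (x : ι → G)
    (hx : ∀ i j, i ≠ j → ∀ H : Subgroup G, x i ∈ H → x j ∈ H → H = ⊤) :
    CoverBound G (Nat.card ι) := by
  have := Fintype.ofFinite ι
  intro S hS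
  choose Φ hΦS hΦ using fun i => hS.2 (x i)
  rw [Nat.card_eq_fintype_card]
  refine Finset.card_le_card_of_injOn Φ (fun i _ => hΦS i) fun i _ j _ hij => ?_
  by_contra hne
  exact hS.1 _ (hΦS i) (hx i j hne _ (hΦ i) (hij ▸ hΦ j))

/-- The conjugates of two elements by the powers of a third one, together with that element, bound
the size of a cover from below as soon as they pairwise generate the group. -/
theorem coverBound_of_conj_pow {G : Type*} [Group G] {N : ℕ} {s y z : G} (hN : s ^ N = 1)
    (hsy : ∀ H : Subgroup G, s ∈ H → y ∈ H → H = ⊤)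
    (hsz : ∀ H : Subgroup G, s ∈ H → z ∈ H → H = ⊤)
    (hyy : ∀ j < N, 0 < j → ∀ H : Subgroup G, y ∈ H → s ^ j * y * s ^ (N - j) ∈ H → H = ⊤)
    (hzz : ∀ j < N, 0 < j → ∀ H : Subgroup G, z ∈ H → s ^ j * z * s ^ (N - j) ∈ H → H = ⊤)
    (hyz : ∀ j < N, ∀ H : Subgroup G, y ∈ H → s ^ j * z * s ^ (N - j) ∈ H → H = ⊤) :
    CoverBound G (2 * N + 1) := by
  have hinv : ∀ j ≤ N, s ^ (N - j) = (s ^ j)⁻¹ := fun j hj => by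
    rw [eq_inv_iff_mul_eq_one, ← pow_add, Nat.sub_add_cancel hj, hN]
  have hmem : ∀ (k : G) (H : Subgroup G) (u v : G), u ∈ H → k * u * k⁻¹ = v →
      v ∈ H.map (MulAut.conj k).toMonoidHom := fun k H u v hu h => ⟨u, hu, h⟩
  have key : ∀ (a b : G) (P : ℕ → Prop),
      (∀ j < N, P j → ∀ H : Subgroup G, a ∈ H → s ^ j * b * s ^ (N - j) ∈ H → H = ⊤) →
      ∀ i j : Fin N, P ((j + (N - i)) % N) → ∀ H : Subgroup G,
        s ^ (i : ℕ) * a * (s ^ (i : ℕ))⁻¹ ∈ H → s ^ (j : ℕ) * b * (s ^ (j : ℕ))⁻¹ ∈ H →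
        H = ⊤ := by
    intro a b P hab i j hP H hi hj
    have hlt : (j + (N - i)) % N < N := Nat.mod_lt _ i.pos
    have hpow : s ^ ((j + (N - i)) % N) = (s ^ (i : ℕ))⁻¹ * s ^ (j : ℕ) := by
      rw [← pow_mod_orderOf, Nat.mod_mod_of_dvd _ (orderOf_dvd_of_pow_eq_one hN),
        pow_mod_orderOf, add_comm, pow_add, hinv _ i.isLt.le]
    refine eq_top_of_map_conj_eq_top (k := (s ^ (i : ℕ))⁻¹)
      (hab _ hlt hP _ (hmem _ _ _ _ hi ?_) (hmem _ _ _ _ hj ?_))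
    · group
    · rw [hinv _ hlt.le, hpow]
      group
  have hs : ∀ a : G, (∀ H : Subgroup G, s ∈ H → a ∈ H → H = ⊤) → ∀ i : Fin N,
      ∀ H : Subgroup G, s ∈ H → s ^ (i : ℕ) * a * (s ^ (i : ℕ))⁻¹ ∈ H → H = ⊤ := by
    intro a ha i H hsH hi
    refine eq_top_of_map_conj_eq_top (k := (s ^ (i : ℕ))⁻¹)
      (ha _ (hmem _ _ _ _ hsH ?_) (hmem _ _ _ _ hi ?_))
    · group
    · group
  have hne : ∀ i j : Fin N, i ≠ j → 0 < ((j + (N - i)) % N : ℕ) := by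
    intro i j hij
    have hi := i.isLt
    have hj := j.isLt
    rw [Ne, Fin.ext_iff] at hij
    rcases lt_or_gt_of_ne hij with h | h
    · rw [show (j + (N - i) : ℕ) = (j - i) + N by omega, Nat.add_mod_right,
        Nat.mod_eq_of_lt (by omega)]
      omega
    · rw [Nat.mod_eq_of_lt (by omega)]
      omega
  have hcard : Nat.card (Option (Fin N ⊕ Fin N)) = 2 * N + 1 := by
    simp [Nat.card_eq_fintype_card]
    omega
  rw [← hcard]
  let x : Option (Fin N ⊕ Fin N) → G := fun o => match o with
    | none => s
    | some (.inl i) => s ^ (i : ℕ) * y * (s ^ (i : ℕ))⁻¹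
    | some (.inr i) => s ^ (i : ℕ) * z * (s ^ (i : ℕ))⁻¹
  refine coverBound_of_clique x ?_
  rintro (_ | i | i) (_ | j | j) hij H hi hj
  · exact (hij rfl).elim
  · exact hs y hsy j H hi hj
  · exact hs z hsz j H hi hj
  · exact hs y hsy i H hj hi
  · exact key y y (0 < ·) hyy i j (hne i j fun h => hij (by rw [h])) H hi hj
  · exact key y z (fun _ => True) (fun j hj _ => hyz j hj) i j trivial H hi hj
  · exact hs z hsz i H hj hi
  · exact key y z (fun _ => True) (fun j hj _ => hyz j hj) j i trivial H hj hi
  · exact key z z (0 < ·) hzz i j (hne i j fun h => hij (by rw [h])) H hi hj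

end BitMatrices

section SingerCodes

open Module

/-- The matrix with code `s` permutes the nonzero vectors transitively. -/
def IsTransitiveCode (n s : ℕ) [NeZero n] : Prop :=
  ∀ c : Fin n → ZMod 2, c ≠ 0 →
    ∃ i : Fin (2 ^ n), (bitMat n (bitPow n s i)).mulVec (Pi.single 0 1) = c

instance (n s : ℕ) [NeZero n] : Decidable (IsTransitiveCode n s) := by
  unfold IsTransitiveCode
  infer_instance

theorem bitMat_xor_mulVec {n : ℕ} [NeZero n] (b : Fin n) (hb : b ≠ 0) (x : Fin n → ZMod 2) :
    (bitMat n (bitOne n ^^^ 2 ^ (b : ℕ))).mulVec x = x + x b • Pi.single 0 1 := by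
  have hmat : bitMat n (bitOne n ^^^ 2 ^ (b : ℕ)) = 1 + Matrix.single 0 b 1 := by
    rw [← bitMat_bitOne n]
    ext i j
    have hij : (b : ℕ) = n * i + j ↔ 0 = i ∧ b = j := by
      constructor
      · intro h
        have hi : (i : ℕ) = 0 := by
          by_contra h0
          have : n * 1 ≤ n * i := Nat.mul_le_mul_left n (by omega)
          have := b.isLt
          omega
        refine ⟨Fin.ext (by simp [hi]), Fin.ext (by simpa [hi] using h)⟩
      · rintro ⟨rfl, rfl⟩
        simp
    simp only [bitMat, Matrix.of_apply, Matrix.add_apply, Matrix.single_apply, Nat.testBit_xor,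
      Nat.testBit_two_pow, hij]
    by_cases h : 0 = i ∧ b = j
    · obtain ⟨rfl, rfl⟩ := h
      have h1 : (bitOne n).testBit (n * ((0 : Fin n) : ℕ) + b) = false := by
        have h2 := congrFun (congrFun (bitMat_bitOne n) 0) b
        rw [Matrix.one_apply_ne hb.symm] at h2
        by_contra h3
        simp only [bitMat, Matrix.of_apply, Bool.not_eq_false] at h2 h3
        rw [if_pos h3] at h2
        exact one_ne_zero h2
      simp only [h1]
      simp
    · simp [h]
  rw [hmat, Matrix.add_mulVec, Matrix.one_mulVec, Matrix.single_mulVec]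
  congr 1
  ext i
  by_cases h : i = 0 <;> simp [h]

theorem isSingerCode_of_words {n s : ℕ} [NeZero n] (hs : IsTransitiveCode n s)
    (hw : ∀ f < 2 ^ (n - 1), 0 < f → ∀ b : Fin n, b ≠ 0 →
      ∃ l, bitWord n s (bitOne n ^^^ (2 * f)) l = bitOne n ^^^ 2 ^ (b : ℕ)) :
    IsSingerCode n s := by
  intro H g hgH t htH hg f hf0 hf ht
  have hproj : ∀ b : Fin n, b ≠ 0 → MemT H (LinearMap.proj b) (Pi.single 0 1) := by
    intro b hb
    obtain ⟨l, hl⟩ := hw f hf hf0 b hb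
    obtain ⟨w, hwH, hwc⟩ := hg.exists_word ht hgH htH l
    refine ⟨w, hwH, fun x => ?_⟩
    rw [hwc.apply, hl, bitMat_xor_mulVec b hb]
    rfl
  have hdir : ∀ φ : Dual (ZMod 2) (Fin n → ZMod 2), φ (Pi.single 0 1) = 0 →
      MemT H φ (Pi.single 0 1) := by
    intro φ hφ
    have hsum : φ = ∑ b, φ (Pi.single b 1) • LinearMap.proj b := by
      refine LinearMap.pi_ext' fun i => LinearMap.ext_ring ?_
      simp [Pi.single_apply]
    have hz : ∀ b : Fin n, φ (Pi.single b 1) • (Pi.single 0 1 : Fin n → ZMod 2) b = 0 := by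
      intro b
      by_cases hb : b = 0
      · rw [hb, hφ, zero_smul]
      · rw [Pi.single_eq_of_ne hb, smul_zero]
    rw [hsum]
    refine (Finset.sum_induction (s := Finset.univ)
      (fun b : Fin n => φ (Pi.single b 1) • (LinearMap.proj b : Dual (ZMod 2) (Fin n → ZMod 2)))
      (fun ψ => MemT H ψ (Pi.single 0 1) ∧ ψ (Pi.single 0 1) = 0) ?_ ?_ ?_).1
    · rintro ψ χ ⟨h1, h2⟩ ⟨h3, h4⟩
      exact ⟨h1.add_left h3 h2, by simp [h2, h4]⟩
    · exact ⟨MemT.zero_left _, rfl⟩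
    · intro b _
      refine ⟨?_, hz b⟩
      by_cases hb : b = 0
      · rw [hb, hφ, zero_smul]
        exact MemT.zero_left _
      · have h01 : ∀ a : ZMod 2, a = 0 ∨ a = 1 := by decide
        rcases h01 (φ (Pi.single b 1)) with h | h
        · rw [h, zero_smul]
          exact MemT.zero_left _
        · rw [h, one_smul]
          exact hproj b hb
  refine eq_top_of_transvections (fun φ c hφc => ?_) fun u => ⟨1, H.one_mem, Subsingleton.elim _ _⟩
  by_cases hc : c = 0
  · rw [hc]
    exact MemT.zero_right _
  · obtain ⟨i, hi⟩ := hs c hc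
    have hgi : (g ^ (i : ℕ)) (Pi.single 0 1) = c := by rw [(hg.pow i).apply, hi]
    have := (hdir (φ ∘ₗ (g ^ (i : ℕ)).toLinearMap) (by simpa [hgi] using hφc)).conj
      (H.pow_mem hgH i)
    rw [hgi] at this
    convert this using 1
    refine LinearMap.ext fun x => ?_
    change φ x = φ ((g ^ (i : ℕ) * (g ^ (i : ℕ))⁻¹) x)
    rw [mul_inv_cancel]
    rfl

theorem isSingerCode_three : IsSingerCode 3 226 := by
  refine isSingerCode_of_words (by decide +kernel) ?_
  have h : ∀ f < 4, 0 < f → ∀ b : Fin 3, b ≠ 0 →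
      ∃ l ∈ [[0, 1], [1, 1, 3, 1, 2], [3, 1, 3, 1, 2], [3, 1, 1, 1, 1], [4, 1, 5, 1, 1]],
        bitWord 3 226 (bitOne 3 ^^^ (2 * f)) l = bitOne 3 ^^^ 2 ^ (b : ℕ) := by
    decide +kernel
  intro f hf hf0 b hb
  obtain ⟨l, -, hl⟩ := h f hf hf0 b hb
  exact ⟨l, hl⟩

theorem isSingerCode_four : IsSingerCode 4 14402 := by
  refine isSingerCode_of_words (by decide +kernel) ?_
  have h : ∀ f < 8, 0 < f → ∀ b : Fin 4, b ≠ 0 →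
      ∃ l ∈ [[0, 1], [3, 1, 7, 1, 11, 1, 8], [6, 1, 7, 1, 8, 1, 9],
        [3, 1, 11, 1, 4, 1, 12], [4, 1, 7, 1, 12, 1, 6], [1, 1, 3, 1, 12, 1, 14],
        [8, 1, 9, 1, 6, 1, 7], [0, 1, 1, 1, 3, 1, 12, 1, 14], [3, 1, 6, 1, 1, 1, 7],
        [4, 1, 12, 1, 3, 1, 11], [2, 1, 6, 1, 9, 1, 13], [9, 1, 13, 1, 2, 1, 6],
        [0, 1, 2, 1, 6, 1, 9, 1, 13], [4, 1, 11, 1, 4, 1, 11], [2, 1, 13, 1, 2, 1, 13],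
        [11, 1, 1, 1, 14, 1, 4]],
        bitWord 4 14402 (bitOne 4 ^^^ (2 * f)) l = bitOne 4 ^^^ 2 ^ (b : ℕ) := by
    decide +kernel
  intro f hf hf0 b hb
  obtain ⟨l, -, hl⟩ := h f hf hf0 b hb
  exact ⟨l, hl⟩

end SingerCodes

section BinaryCover

theorem coverBound_of_pairCheck {n N s y z : ℕ} (hs : IsSingerCode n s)
    {y' z' : ℕ} (hN : bitPow n s (N + 1) = bitOne n) (hy : bitMul n y y' = bitOne n)
    (hz : bitMul n z z' = bitOne n) {A B C : List (ℕ × ℕ × List ℕ × List ℕ)}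
    (hA : pairCheck n s s y (A.getD 0 default) = true)
    (hA' : ∀ j < N + 1, 0 < j → pairCheck n s y
      (bitMul n (bitMul n (bitPow n s j) y) (bitPow n s (N + 1 - j))) (A.getD j default) = true)
    (hB : pairCheck n s s z (B.getD 0 default) = true)
    (hB' : ∀ j < N + 1, 0 < j → pairCheck n s z
      (bitMul n (bitMul n (bitPow n s j) z) (bitPow n s (N + 1 - j))) (B.getD j default) = true)
    (hC : ∀ j < N + 1, pairCheck n s y
      (bitMul n (bitMul n (bitPow n s j) z) (bitPow n s (N + 1 - j))) (C.getD j default) = true) :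
    CoverBound ((Fin n → ZMod 2) ≃ₗ[ZMod 2] (Fin n → ZMod 2)) (2 * (N + 1) + 1) := by
  obtain ⟨σ, hσ, -⟩ := exists_hasCode hN
  obtain ⟨η, hη, -⟩ := exists_hasCode hy
  obtain ⟨ζ, hζ, -⟩ := exists_hasCode hz
  refine coverBound_of_conj_pow (s := σ) (y := η) (z := ζ)
    ((HasCode.pow hσ (N + 1)).eq (hN ▸ HasCode.one)) ?_ ?_ ?_ ?_ ?_
  · exact fun H h1 h2 => hs.eq_top hA h1 h2 hσ hη
  · exact fun H h1 h2 => hs.eq_top hB h1 h2 hσ hζ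
  · exact fun j hj hj0 H h1 h2 => hs.eq_top (hA' j hj hj0) h1 h2 hη
      (((hσ.pow _).mul hη).mul (hσ.pow _))
  · exact fun j hj hj0 H h1 h2 => hs.eq_top (hB' j hj hj0) h1 h2 hζ
      (((hσ.pow _).mul hζ).mul (hσ.pow _))
  · exact fun j hj H h1 h2 => hs.eq_top (hC j hj) h1 h2 hη
      (((hσ.pow _).mul hζ).mul (hσ.pow _))

/-- Generation certificates for the conjugates of the first element in dimension three. -/
def pairWordsThreeA : List (ℕ × ℕ × List ℕ × List ℕ) := [(226, 141, [1], [0, 2]),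
  (250, 397, [1, 2, 2, 1], [2]),
  (285, 317, [1, 1], [2]),
  (473, 409, [1, 1, 2, 2], [2]),
  (477, 431, [1, 2, 2, 1], [2]),
  (314, 271, [1, 1], [2]),
  (250, 397, [1, 1, 2, 2], [2])]

/-- Generation certificates for the conjugates of the second element in dimension three. -/
def pairWordsThreeB : List (ℕ × ℕ × List ℕ × List ℕ) := [(273, 273, [1], [1, 5]),
  (239, 351, [3], [1, 2]),
  (380, 117, [3], [1, 4]),
  (157, 486, [3], [1, 1]),
  (403, 403, [3], [1, 1]),
  (270, 298, [3], [1, 4]),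
  (114, 204, [3], [1, 2])]

/-- Generation certificates for mixed pairs of conjugates in dimension three. -/
def pairWordsThreeC : List (ℕ × ℕ × List ℕ × List ℕ) := [(481, 185, [0, 3], [2]),
  (318, 299, [0, 3], [2]),
  (485, 171, [0, 3], [2]),
  (229, 187, [0, 3], [2]),
  (473, 409, [0, 3], [2]),
  (250, 397, [0, 3], [2]),
  (486, 157, [0, 3], [2])]

theorem coverBound_binary_three :
    CoverBound ((Fin 3 → ZMod 2) ≃ₗ[ZMod 2] (Fin 3 → ZMod 2)) 15 :=
  coverBound_of_pairCheck (N := 6) (y := 270) (y' := 298) (z := 426) (z' := 335)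
    (A := pairWordsThreeA) (B := pairWordsThreeB) (C := pairWordsThreeC) isSingerCode_three
    (by decide +kernel) (by decide +kernel) (by decide +kernel) (by decide +kernel)
    (by decide +kernel) (by decide +kernel) (by decide +kernel) (by decide +kernel)

/-- Generation certificates for the conjugates of the first element in dimension four. -/
def pairWordsFourA : List (ℕ × ℕ × List ℕ × List ℕ) := [(59301, 31323, [1], [1, 1, 10, 11]),
  (6266, 20312, [1], [1, 1, 8, 10]),
  (13541, 46293, [1], [1, 1, 1, 3]),
  (22060, 30254, [1], [1, 1, 9, 5]),
  (6266, 20312, [1], [1, 1, 1, 1]),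
  (51709, 54585, [1], [1, 1, 3, 6]),
  (43828, 25068, [1], [1, 1, 5, 6]),
  (31411, 14710, [1], [1, 3, 12, 3]),
  (45902, 49915, [1], [1, 6, 1, 6]),
  (40913, 39521, [1], [1, 2, 6, 9]),
  (53639, 11956, [1], [1, 1, 2, 14]),
  (45902, 49915, [1], [1, 1, 1, 1]),
  (34731, 36259, [1], [1, 1, 2, 5]),
  (51709, 54585, [1], [1, 1, 3, 1]),
  (11423, 64397, [1], [1, 1, 5, 8])]

/-- Generation certificates for the conjugates of the second element in dimension four. -/
def pairWordsFourB : List (ℕ × ℕ × List ℕ × List ℕ) := [(8605, 25476, [1], [1, 9]),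
  (23197, 37851, [1], [1, 1, 1, 4]),
  (60529, 49089, [1], [1, 3]),
  (33462, 34126, [1], [1, 2, 3, 6]),
  (11118, 14991, [1], [1, 2, 3, 2]),
  (17833, 55548, [1], [1, 1, 4, 12]),
  (17833, 55548, [1], [1, 2, 9, 10]),
  (33462, 34126, [1], [1, 2, 10, 7]),
  (55339, 19239, [1], [1, 2, 3, 9]),
  (40322, 11290, [1], [1, 1, 5, 7]),
  (28359, 52841, [1], [1, 3, 4, 4]),
  (28359, 52841, [1], [1, 2, 3, 2]),
  (62277, 57971, [1], [1, 2, 3, 6]),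
  (28359, 52841, [1], [1, 3]),
  (50975, 23986, [1], [1, 1, 1, 4])]

/-- Generation certificates for mixed pairs of conjugates in dimension four. -/
def pairWordsFourC : List (ℕ × ℕ × List ℕ × List ℕ) := [(34731, 36259, [1], [1, 1, 3, 14]),
  (51709, 54585, [1], [2, 3]),
  (45902, 49915, [1], [1, 1, 3, 1]),
  (25289, 60495, [1], [1, 1, 9, 14]),
  (22060, 30254, [1], [1, 5, 10, 12]),
  (25289, 60495, [1], [1, 1, 1, 1]),
  (20054, 22682, [1], [1, 1, 5, 6]),
  (34731, 36259, [1], [1, 1, 1, 4]),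
  (31411, 14710, [1], [1, 1, 10, 10]),
  (40913, 39521, [1], [1, 1, 2, 14]),
  (25289, 60495, [1], [1, 2, 5, 14]),
  (22060, 30254, [1], [1, 8]),
  (13541, 46293, [1], [1, 2, 2, 5]),
  (53639, 11956, [1], [1, 1, 8, 10]),
  (45902, 49915, [1], [1, 1, 10, 11])]

theorem coverBound_binary_four :
    CoverBound ((Fin 4 → ZMod 2) ≃ₗ[ZMod 2] (Fin 4 → ZMod 2)) 31 :=
  coverBound_of_pairCheck (N := 14) (y := 4973) (y' := 32456) (z := 54151) (z' := 9663)
    (A := pairWordsFourA) (B := pairWordsFourB) (C := pairWordsFourC) isSingerCode_four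
    (by decide +kernel) (by decide +kernel) (by decide +kernel) (by decide +kernel)
    (by decide +kernel) (by decide +kernel) (by decide +kernel) (by decide +kernel)

end BinaryCover

section Assembly

open Module

theorem CoverBound.generalLinearGroup {F V : Type*} [Field F] [AddCommGroup V] [Module F V]
    [FiniteDimensional F V] {t n : ℕ} (h : CoverBound (V ≃ₗ[F] V) t) (hV : finrank F V = n) :
    CoverBound (Matrix.GeneralLinearGroup (Fin n) F) t :=
  (h.of_finrank_eq (W := Fin n → F) (by rw [hV, Module.finrank_fin_fun])).of_mulEquiv
    (Matrix.GeneralLinearGroup.toLin.trans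
      (LinearMap.GeneralLinearGroup.generalLinearEquiv F (Fin n → F))).symm

theorem coverBound_generalLinearGroup_of_card_eq_two {F : Type*} [Field F] [Fintype F]
    (hF : Fintype.card F = 2) {n t : ℕ}
    (h : CoverBound ((Fin n → ZMod 2) ≃ₗ[ZMod 2] (Fin n → ZMod 2)) t) :
    CoverBound (Matrix.GeneralLinearGroup (Fin n) F) t :=
  (h.generalLinearGroup (Module.finrank_fin_fun _)).of_mulEquiv
    (Units.mapEquiv (ZMod.ringEquivOfPrime F Nat.prime_two hF).mapMatrix.toMulEquiv)

theorem coverBound_cubic_of_three_le {F K : Type*} [Field F] [Finite F] [Field K] [Algebra F K]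
    (h3 : finrank F K = 3) (hq : 3 ≤ Nat.card F) :
    CoverBound (K ≃ₗ[F] K) (∑ i ∈ Finset.range 5, Nat.card F ^ i) := by
  have : Fintype F := Fintype.ofFinite F
  have : FiniteDimensional F K := Module.finite_of_finrank_pos (by omega)
  have : Finite K := Module.finite_of_finite F
  have hcard : Nat.card (K ≃ₗ[F] K) = Nat.card (Matrix.GeneralLinearGroup (Fin 3) F) :=
    Nat.card_congr ((autMulEquiv (LinearEquiv.ofFinrankEq K (Fin 3 → F)
      (by rw [h3, Module.finrank_fin_fun]))).trans (Matrix.GeneralLinearGroup.toLin.trans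
      (LinearMap.GeneralLinearGroup.generalLinearEquiv F (Fin 3 → F))).symm).toEquiv
  refine coverBound_of_cubic h3 ?_
  rw [hcard, Matrix.card_GL_field, Module.natCard_eq_pow_finrank (K := F) (V := K), h3,
    ← Nat.card_eq_fintype_card]
  obtain ⟨r, hr⟩ := Nat.exists_eq_add_of_le hq
  simp only [hr, Fin.prod_univ_three, Finset.sum_range_succ, Finset.sum_range_zero]
  have h1 : (3 + r) ^ 3 - (3 + r) ^ ((1 : Fin 3) : ℕ) = (3 + r) * (2 + r) * (4 + r) := by
    refine Nat.sub_eq_of_eq_add ?_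
    simp
    ring
  have h2 : (3 + r) ^ 3 - (3 + r) ^ ((2 : Fin 3) : ℕ) = (3 + r) ^ 2 * (2 + r) := by
    refine Nat.sub_eq_of_eq_add ?_
    simp
    ring
  rw [h1, h2]
  simp only [Fin.val_zero, pow_zero, mul_assoc]
  refine Nat.mul_le_mul_left _ ?_
  rw [← Nat.cast_le (α := ℤ), ← sub_nonneg]
  push_cast
  ring_nf
  positivity

theorem coverBound_generalLinearGroup {F : Type} [Field F] [Fintype F] {n : ℕ} (hn : 3 ≤ n) :
    CoverBound (Matrix.GeneralLinearGroup (Fin n) F)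
      (∑ i ∈ Finset.range (n + 1), Nat.card F ^ i) := by
  obtain ⟨p, hp⟩ := CharP.exists F
  have : Fact p.Prime := ⟨CharP.char_is_prime F p⟩
  have hq2 : 2 ≤ Nat.card F := Finite.one_lt_card
  have hK : ∀ (k : ℕ) [NeZero k], finrank F (FiniteField.Extension F p k) = k := fun k _ =>
    FiniteField.finrank_extension F p k
  rcases Nat.lt_or_ge n 5 with h5 | h5
  · rcases hq2.eq_or_lt with hq | hq
    · have hF : Fintype.card F = 2 := by rw [← Nat.card_eq_fintype_card, ← hq]
      rw [← hq]
      obtain rfl | rfl : n = 3 ∨ n = 4 := by omega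
      · exact coverBound_generalLinearGroup_of_card_eq_two hF coverBound_binary_three
      · exact coverBound_generalLinearGroup_of_card_eq_two hF coverBound_binary_four
    · have hW := coverBound_cubic_of_three_le (hK 3) hq
      obtain rfl | rfl : n = 3 ∨ n = 4 := by omega
      · exact (hW.generalLinearGroup (hK 3)).mono
          (Finset.sum_le_sum_of_subset (Finset.range_mono (by omega)))
      · refine (coverBound_of_quadratic_blocks (E := FiniteField.Extension F p 2)
          (L := FiniteField.Extension F p 4) (hK 2) (hK 4) (hK 3) hq hW ?_).generalLinearGroup ?_
        · rw [Projectivization.card_of_finrank F _ (hK 4), Finset.sum_range_succ, add_comm]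
        · rw [Module.finrank_prod, hK]
  · have : NeZero (n - 2) := ⟨by omega⟩
    refine (coverBound_of_large_block (F := F) (E := FiniteField.Extension F p 2)
      (K := FiniteField.Extension F p (n - 2)) (hK 2) (by rw [hK]; omega) ?_).generalLinearGroup ?_
    · rw [hK, show n - 2 + 3 = n + 1 by omega, Nat.geomSum_eq hq2]
      exact (Nat.div_le_self _ _).trans (Nat.sub_le _ _)
    · rw [Module.finrank_prod, hK, hK]
      omega

end Assembly

theorem statement18 (p d n : ℕ) (hp : p.Prime) (hd : 0 < d) (hn : 3 ≤ n)
    (F : Type) [Field F] [Fintype F] (hF : Fintype.card F = p ^ d) :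
    ((((p ^ d) ^ (n + 1) - 1) / (p ^ d - 1) : ℕ) : ℕ∞) ≤
      coveringNumber (Matrix.GeneralLinearGroup (Fin n) F) := by
  have hq : 2 ≤ p ^ d := hF ▸ Fintype.one_lt_card
  rw [← Nat.geomSum_eq hq, ← hF, ← Nat.card_eq_fintype_card]
  exact (coverBound_generalLinearGroup hn).le_coveringNumber
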